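/- arXiv:2311.08634 — 3 statements merged into one kernel-verified Lean document; each statement's English description precedes it below -/
import Mathlib

section
/- Let G be a minimally t-tough, claw-free graph and e = uv a non-bridge edge of G with D(e) ≠ ∅. If |N_{S(e)}(C(e))| = 4t−2, then every component C_j of G−S(e) other than C(e) satisfies |N_{S(e)}(C_j)| ≤ 2t+1, and there are at least 2t−1 vertices of N_{S(e)}(C(e)) that are contained in some 2t-vertex-cut of G. -/
open SimpleGraph

variable {V : Type*}

/-- `numComponents G S` is the number of connected components of `G − S`,
the graph obtained from `G` by deleting the vertices of `S`. -/
noncomputable def numComponents (G : SimpleGraph V) (S : Set V) : ℕ :=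
  Nat.card ((G.induce Sᶜ).ConnectedComponent)

/-- `HasToughness G t` says that the toughness of `G` is exactly `t`, i.e.
`t = min { |S| / w(G−S) : S ⊆ V(G), w(G−S) ≥ 2 }`.  (For a complete graph no
such `S` exists and this predicate never holds, matching `τ(G) = ∞`.) -/
def HasToughness [Fintype V] (G : SimpleGraph V) (t : ℚ) : Prop :=
  (∀ S : Finset V, 2 ≤ numComponents G ↑S →
      t ≤ (S.card : ℚ) / (numComponents G ↑S : ℚ)) ∧
  ∃ S : Finset V, 2 ≤ numComponents G ↑S ∧
      t = (S.card : ℚ) / (numComponents G ↑S : ℚ)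

/-- `G` is minimally `t`-tough: `τ(G) = t` and `τ(G − e) < t` for every edge
`e` of `G` (i.e. some vertex set witnesses a ratio `< t` in `G − e`). -/
def MinimallyTough [Fintype V] (G : SimpleGraph V) (t : ℚ) : Prop :=
  HasToughness G t ∧
  ∀ u v : V, G.Adj u v →
    ∃ S : Finset V, 2 ≤ numComponents (G.deleteEdges {s(u, v)}) ↑S ∧
      (S.card : ℚ) / (numComponents (G.deleteEdges {s(u, v)}) ↑S : ℚ) < t

/-- `G` is claw-free: it has no induced subgraph isomorphic to `K_{1,3}`. -/
def ClawFree (G : SimpleGraph V) : Prop :=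
  ¬ ∃ v a b c : V, a ≠ b ∧ a ≠ c ∧ b ≠ c ∧
      G.Adj v a ∧ G.Adj v b ∧ G.Adj v c ∧
      ¬ G.Adj a b ∧ ¬ G.Adj a c ∧ ¬ G.Adj b c

/-- The vertex connectivity `κ(G)` of a noncomplete graph: the least cardinality
of a vertex set whose deletion disconnects `G`. -/
noncomputable def vconn [Fintype V] (G : SimpleGraph V) : ℕ :=
  sInf {k | ∃ S : Finset V, S.card = k ∧ 2 ≤ numComponents G ↑S}

/-- The vertex set of the connected component of `G − S` containing `u`
(empty if `u ∈ S`). -/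
def compOf (G : SimpleGraph V) (S : Set V) (u : V) : Set V :=
  {w | ∃ (hu : u ∈ Sᶜ) (hw : w ∈ Sᶜ), (G.induce Sᶜ).Reachable ⟨u, hu⟩ ⟨w, hw⟩}

/-- `Dset G S u` is the union of the components of `G − S` other than the one
containing `u`. -/
def Dset (G : SimpleGraph V) (S : Set V) (u : V) : Set V :=
  Sᶜ \ compOf G S u

/-- `nbrsIn G X Y = N_X(Y)`: the set of vertices in `X − Y` adjacent (in `G`)
to some vertex of `Y`. -/
def nbrsIn (G : SimpleGraph V) (X Y : Set V) : Set V :=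
  {x | x ∈ X \ Y ∧ ∃ y ∈ Y, G.Adj x y}

/-- The edge `uv` is a bridge of the graph `G − S`: both endpoints survive the
deletion of `S`, they are adjacent, and deleting the edge `uv` increases the
number of connected components of `G − S`. -/
def IsBridgeIn (G : SimpleGraph V) (S : Set V) (u v : V) : Prop :=
  u ∉ S ∧ v ∉ S ∧ G.Adj u v ∧
    numComponents G S < numComponents (G.deleteEdges {s(u, v)}) S

/-- `GoodCut G t u v S`: `S` is a vertex set with `w(G−S) ≤ |S|/t`,
`w((G−e)−S) > |S|/t` and such that `e = uv` is a bridge in `G − S`. -/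
def GoodCut [Fintype V] (G : SimpleGraph V) (t : ℚ) (u v : V) (S : Finset V) : Prop :=
  (numComponents G ↑S : ℚ) ≤ (S.card : ℚ) / t ∧
  (S.card : ℚ) / t < (numComponents (G.deleteEdges {s(u, v)}) ↑S : ℚ) ∧
  IsBridgeIn G ↑S u v

/-- `S` is a minimum-cardinality vertex set as guaranteed by Lemma 2.2,
i.e. `S = S(e)` for the edge `e = uv`. -/
def IsMinGoodCut [Fintype V] (G : SimpleGraph V) (t : ℚ) (u v : V) (S : Finset V) : Prop :=
  GoodCut G t u v S ∧ ∀ S' : Finset V, GoodCut G t u v S' → S.card ≤ S'.card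

/-- `x` is contained in some `2t`-vertex-cut of `G`. -/
def InTwoTCut [Fintype V] (G : SimpleGraph V) (t : ℚ) (x : V) : Prop :=
  ∃ T : Finset V, (T.card : ℚ) = 2 * t ∧ 2 ≤ numComponents G ↑T ∧ x ∈ T

/-- A fragment of `G`: the vertex set of a connected component of `G − T` for
some minimum vertex cut `T` of `G`. -/
def IsGraphFragment [Fintype V] (G : SimpleGraph V) (A : Set V) : Prop :=
  ∃ (T : Finset V) (a : V), T.card = vconn G ∧ 2 ≤ numComponents G ↑T ∧
    a ∉ T ∧ A = compOf G ↑T a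

/-- An atom of `G`: a fragment of minimum cardinality. -/
def IsGraphAtom [Fintype V] (G : SimpleGraph V) (A : Set V) : Prop :=
  IsGraphFragment G A ∧ ∀ B : Set V, IsGraphFragment G B → A.ncard ≤ B.ncard


section Aux
open Classical

noncomputable def nbF (G : SimpleGraph V) (S : Finset V) (A : Set V) : Finset V :=
  S.filter (fun s => ∃ y ∈ A, G.Adj s y)

theorem mem_nbF {G : SimpleGraph V} {S : Finset V} {A : Set V} {s : V} :
    s ∈ nbF G S A ↔ s ∈ S ∧ ∃ y ∈ A, G.Adj s y := by
  simp [nbF]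

theorem closed_reach (G : SimpleGraph V) (T A : Set V)
    (hcl : ∀ a ∈ A, ∀ z, G.Adj a z → z ∈ A ∨ z ∈ T) (a b : (Tᶜ : Set V))
    (h : (G.induce Tᶜ).Reachable a b) (ha : (a : V) ∈ A) : (b : V) ∈ A := by
  obtain ⟨p⟩ := h
  induction p with
  | nil => exact ha
  | @cons x y z hadj p ih =>
    apply ih
    rcases hcl x ha y (by simpa using hadj) with h | h
    · exact h
    · exact absurd h y.2

theorem numComp_ge [Fintype V] (G : SimpleGraph V) {ι : Type*} [Fintype ι] (C : ι → Set V)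
    (T : Set V) (hne : ∀ i, (C i).Nonempty) (hT : ∀ i, ∀ a ∈ C i, a ∉ T)
    (hcl : ∀ i, ∀ a ∈ C i, ∀ z, G.Adj a z → z ∈ C i ∨ z ∈ T)
    (hdis : ∀ i j, ∀ a, a ∈ C i → a ∈ C j → i = j) :
    Fintype.card ι ≤ numComponents G T := by
  choose r hr using hne
  unfold numComponents
  rw [← Nat.card_eq_fintype_card]
  apply Nat.card_le_card_of_injective
    (fun i => (G.induce Tᶜ).connectedComponentMk ⟨r i, hT i _ (hr i)⟩)
  intro i j hij
  have h1 := SimpleGraph.ConnectedComponent.eq.1 hij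
  exact hdis i j (r j) (closed_reach G T (C i) (hcl i) _ _ h1 (hr i)) (hr j)

theorem cut_of_closed [Fintype V] (G : SimpleGraph V) (A : Set V) (T : Finset V)
    (hne : A.Nonempty) (hT : ∀ a ∈ A, a ∉ T)
    (hcl : ∀ a ∈ A, ∀ z, G.Adj a z → z ∈ A ∨ z ∈ T)
    (z : V) (hzA : z ∉ A) (hzT : z ∉ T) : 2 ≤ numComponents G ↑T := by
  have := numComp_ge G (ι := Bool) (fun b => if b then A else {w | w ∉ A ∧ w ∉ T}) (T : Set V)
    ?_ ?_ ?_ ?_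
  · simpa using this
  · intro b; cases b
    · exact ⟨z, hzA, hzT⟩
    · simpa using hne
  · intro b a; cases b
    · simp
    · simpa using hT a
  · intro b a; cases b
    · intro ha w hw
      simp only [Bool.false_eq_true, if_false, Set.mem_setOf_eq, Finset.mem_coe] at ha ⊢
      by_contra hcon
      have hwT : w ∉ T := by tauto
      have hwA : w ∈ A := by tauto
      rcases hcl w hwA a hw.symm with h | h <;> tauto
    · simpa using hcl a
  · intro b c a; cases b <;> cases c <;> simp <;> tauto

def compSet (G : SimpleGraph V) (T : Set V) (c : (G.induce Tᶜ).ConnectedComponent) : Set V :=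
  {a | ∃ h : a ∈ Tᶜ, (G.induce Tᶜ).connectedComponentMk ⟨a, h⟩ = c}

theorem compSet_ne (G : SimpleGraph V) (T : Set V) (c) : (compSet G T c).Nonempty := by
  induction c using SimpleGraph.ConnectedComponent.ind with
  | h a => exact ⟨a, a.2, rfl⟩

theorem compSet_T (G : SimpleGraph V) (T : Set V) (c) (a) (h : a ∈ compSet G T c) : a ∉ T := h.1

theorem compSet_cl (G : SimpleGraph V) (T : Set V) (c) (a) (h : a ∈ compSet G T c) (z)
    (hz : G.Adj a z) : z ∈ compSet G T c ∨ z ∈ T := by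
  by_cases hzT : z ∈ T
  · exact Or.inr hzT
  · left
    obtain ⟨h1, h2⟩ := h
    refine ⟨hzT, ?_⟩
    rw [← h2]
    apply SimpleGraph.ConnectedComponent.sound
    apply SimpleGraph.Adj.reachable
    simpa using hz.symm

theorem compSet_dis (G : SimpleGraph V) (T : Set V) (c d) (a) (h : a ∈ compSet G T c)
    (h' : a ∈ compSet G T d) : c = d := by
  obtain ⟨h1, h2⟩ := h
  obtain ⟨h3, h4⟩ := h'
  rw [← h2, ← h4]

theorem compSet_reach (G : SimpleGraph V) (T : Set V) (c) (a b) (h : a ∈ compSet G T c)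
    (h' : b ∈ compSet G T c) : ∃ (ha : a ∈ Tᶜ) (hb : b ∈ Tᶜ),
      (G.induce Tᶜ).Reachable ⟨a, ha⟩ ⟨b, hb⟩ := by
  obtain ⟨h1, h2⟩ := h
  obtain ⟨h3, h4⟩ := h'
  exact ⟨h1, h3, SimpleGraph.ConnectedComponent.eq.1 (h2.trans h4.symm)⟩

theorem count_le [Fintype V] (G : SimpleGraph V) (hcf : ClawFree G) {κ : Type*} [Fintype κ]
    (C : κ → Set V) (S L : Finset V) (hLS : L ⊆ S)
    (hS : ∀ i, ∀ a ∈ C i, a ∉ S)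
    (hcl : ∀ i, ∀ a ∈ C i, ∀ z, G.Adj a z → z ∈ C i ∨ z ∈ S)
    (hdis : ∀ i j, ∀ a, a ∈ C i → a ∈ C j → i = j)
    (hL : ∀ s ∈ L, ∀ i j, s ∈ nbF G S (C i) → s ∈ nbF G S (C j) → i = j) :
    ∑ i, (nbF G S (C i)).card + L.card ≤ 2 * S.card := by
  have h1 : ∑ i, (nbF G S (C i)).card
      = ∑ s ∈ S, (Finset.univ.filter (fun i => s ∈ nbF G S (C i))).card := by
    have : ∀ i, nbF G S (C i) = S.filter (fun s => s ∈ nbF G S (C i)) := by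
      intro i; ext s; simp [mem_nbF]
    calc _ = ∑ i, (S.filter (fun s => s ∈ nbF G S (C i))).card := by
            refine Finset.sum_congr rfl (fun i _ => ?_)
            rw [← this i]
      _ = _ := by
            simp only [Finset.card_filter]
            rw [Finset.sum_comm]
  have h2 : L.card = ∑ s ∈ S, if s ∈ L then 1 else 0 := by
    rw [← Finset.card_filter]
    congr 1
    ext s; simp; exact fun h => hLS h
  rw [h1, h2, ← Finset.sum_add_distrib, mul_comm, ← smul_eq_mul]
  apply Finset.sum_le_card_nsmul
  intro s hs
  have hd : (Finset.univ.filter (fun i => s ∈ nbF G S (C i))).card ≤ 2 := by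
    by_contra hcon
    push Not at hcon
    obtain ⟨i, j, k, hi, hj, hk, hij, hik, hjk⟩ := Finset.two_lt_card_iff.1 hcon
    simp only [Finset.mem_filter, Finset.mem_univ, true_and, mem_nbF] at hi hj hk
    obtain ⟨-, a, ha, ha'⟩ := hi
    obtain ⟨-, b, hb, hb'⟩ := hj
    obtain ⟨-, c, hc, hc'⟩ := hk
    have key : ∀ p q, p ≠ q → ∀ x ∈ C p, ∀ y ∈ C q, x ≠ y ∧ ¬ G.Adj x y := by
      intro p q hpq x hx y hy
      refine ⟨?_, ?_⟩
      · rintro rfl; exact hpq (hdis _ _ _ hx hy)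
      · intro hxy
        rcases hcl p x hx y hxy with h | h
        · exact hpq (hdis _ _ _ h hy)
        · exact hS q y hy h
    exact hcf ⟨s, a, b, c, (key i j hij a ha b hb).1, (key i k hik a ha c hc).1,
      (key j k hjk b hb c hc).1, ha', hb', hc', (key i j hij a ha b hb).2,
      (key i k hik a ha c hc).2, (key j k hjk b hb c hc).2⟩
  by_cases hsL : s ∈ L
  · have : (Finset.univ.filter (fun i => s ∈ nbF G S (C i))).card ≤ 1 := by
      rw [Finset.card_le_one]
      intro i hi j hj
      simp only [Finset.mem_filter, Finset.mem_univ, true_and] at hi hj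
      exact hL s hsL i j hi hj
    simp [hsL]; exact this
  · simp [hsL]; exact hd

/-- structure of `G - S` around an edge `xy` that is a bridge of it -/
structure Str (G : SimpleGraph V) (x y : V) (S : Finset V) (Cx Cy : Set V) {ι : Type*}
    (C : ι → Set V) : Prop where
  adj : G.Adj x y
  xm : x ∈ Cx
  ym : y ∈ Cy
  xS : ∀ a ∈ Cx, a ∉ S
  yS : ∀ a ∈ Cy, a ∉ S
  dxy : ∀ a ∈ Cx, a ∉ Cy
  ne : ∀ i, (C i).Nonempty
  iS : ∀ i, ∀ a ∈ C i, a ∉ S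
  ix : ∀ i, ∀ a ∈ C i, a ∉ Cx
  iy : ∀ i, ∀ a ∈ C i, a ∉ Cy
  dis : ∀ i j, ∀ a, a ∈ C i → a ∈ C j → i = j
  cov : ∀ a, a ∈ S ∨ a ∈ Cx ∨ a ∈ Cy ∨ ∃ i, a ∈ C i
  clx : ∀ a ∈ Cx, ∀ z, G.Adj a z → z ∈ Cx ∨ z ∈ S ∨ (a = x ∧ z = y)
  cly : ∀ a ∈ Cy, ∀ z, G.Adj a z → z ∈ Cy ∨ z ∈ S ∨ (a = y ∧ z = x)
  cli : ∀ i, ∀ a ∈ C i, ∀ z, G.Adj a z → z ∈ C i ∨ z ∈ S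
  compx : compOf G ↑S x = Cx ∪ Cy
  compi : ∀ i, ∀ w ∈ C i, compOf G ↑S w = C i

theorem exists_str [Fintype V] (G : SimpleGraph V) (x y : V) (S : Finset V) (hxy : G.Adj x y)
    (hlt : numComponents G ↑S < numComponents (G.deleteEdges {s(x, y)}) ↑S) :
    ∃ (n : ℕ) (Cx Cy : Set V) (C : Fin n → Set V), Str G x y S Cx Cy C ∧
      n + 2 = numComponents (G.deleteEdges {s(x, y)}) ↑S := by
  set H := G.deleteEdges {s(x, y)} with hH
  have hHa : ∀ a z, G.Adj a z → H.Adj a z ∨ (a = x ∧ z = y) ∨ (a = y ∧ z = x) := by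
    intro a z h
    by_cases h' : s(a, z) = s(x, y)
    · right; simpa using h'
    · left; simp [hH, h]; simpa using h'
  have hHle : H ≤ G := SimpleGraph.deleteEdges_le _
  have hx : ∃ (hx : x ∈ ((S : Set V))ᶜ) (hy : y ∈ ((S : Set V))ᶜ),
      (H.induce (↑S)ᶜ).connectedComponentMk ⟨x, hx⟩ ≠
      (H.induce (↑S)ᶜ).connectedComponentMk ⟨y, hy⟩ := by
    by_contra hcon
    push Not at hcon
    apply absurd hlt
    push Not
    have : Fintype ((H.induce ((S : Set V))ᶜ).ConnectedComponent) := Fintype.ofFinite _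
    have := numComp_ge G (compSet H (↑S)) (↑S : Set V) (compSet_ne H _) (compSet_T H _) ?_
      (compSet_dis H _)
    · rw [← Nat.card_eq_fintype_card] at this
      exact this
    · intro c a ha z hz
      rcases hHa a z hz with h | ⟨rfl, rfl⟩ | ⟨rfl, rfl⟩
      · exact compSet_cl H _ c a ha z h
      · by_cases hzS : z ∈ (S : Set V)
        · exact Or.inr hzS
        · left
          obtain ⟨h1, h2⟩ := ha
          exact ⟨hzS, by rw [← h2, hcon h1 hzS]⟩
      · by_cases hzS : z ∈ (S : Set V)
        · exact Or.inr hzS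
        · left
          obtain ⟨h1, h2⟩ := ha
          exact ⟨hzS, by rw [← h2, hcon hzS h1]⟩
  obtain ⟨hx, hy, hne⟩ := hx
  set cx := (H.induce (↑S)ᶜ).connectedComponentMk ⟨x, hx⟩ with hcx
  set cy := (H.induce (↑S)ᶜ).connectedComponentMk ⟨y, hy⟩ with hcy
  let K := (H.induce ((S : Set V))ᶜ).ConnectedComponent
  have : Fintype K := Fintype.ofFinite _
  let I := {c : K // c ≠ cx ∧ c ≠ cy}
  have hcard : Fintype.card I + 2 = Fintype.card K := by
    have h1 : Fintype.card I = (Finset.univ \ {cx, cy} : Finset K).card := by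
      rw [Fintype.card_subtype]
      congr 1; ext c; simp
    rw [h1]
    have h2 : ({cx, cy} : Finset K).card = 2 := Finset.card_pair hne
    rw [← h2, Finset.card_sdiff_add_card_eq_card (Finset.subset_univ _), Finset.card_univ]
  let e := (Fintype.equivFin I).symm
  have hxm : x ∈ compSet H (↑S) cx := ⟨hx, rfl⟩
  have hym : y ∈ compSet H (↑S) cy := ⟨hy, rfl⟩
  have hclx : ∀ a ∈ compSet H (↑S) cx, ∀ z, G.Adj a z →
      z ∈ compSet H (↑S) cx ∨ z ∈ S ∨ (a = x ∧ z = y) := by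
    intro a ha z hz
    rcases hHa a z hz with h | h | ⟨rfl, rfl⟩
    · rcases compSet_cl H _ cx a ha z h with h | h
      · exact Or.inl h
      · exact Or.inr (Or.inl h)
    · exact Or.inr (Or.inr h)
    · exact absurd (compSet_dis H _ _ _ a ha hym) hne
  have hcly : ∀ a ∈ compSet H (↑S) cy, ∀ z, G.Adj a z →
      z ∈ compSet H (↑S) cy ∨ z ∈ S ∨ (a = y ∧ z = x) := by
    intro a ha z hz
    rcases hHa a z hz with h | ⟨rfl, rfl⟩ | h
    · rcases compSet_cl H _ cy a ha z h with h | h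
      · exact Or.inl h
      · exact Or.inr (Or.inl h)
    · exact absurd (compSet_dis H _ _ _ a hxm ha) hne
    · exact Or.inr (Or.inr h)
  have hcli : ∀ i : I, ∀ a ∈ compSet H (↑S) i.1, ∀ z, G.Adj a z →
      z ∈ compSet H (↑S) i.1 ∨ z ∈ (S : Set V) := by
    intro i a ha z hz
    rcases hHa a z hz with h | ⟨rfl, rfl⟩ | ⟨rfl, rfl⟩
    · exact compSet_cl H _ _ a ha z h
    · exact absurd (compSet_dis H _ _ _ a ha hxm) i.2.1
    · exact absurd (compSet_dis H _ _ _ a ha hym) i.2.2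
  have hmono : ∀ a b : (((S : Set V))ᶜ : Set V), (H.induce (↑S)ᶜ).Reachable a b →
      (G.induce (↑S)ᶜ).Reachable a b := by
    intro a b h
    refine h.mono ?_
    intro p q hpq
    simp only [SimpleGraph.comap_adj] at hpq ⊢
    exact hHle hpq
  have hxyr : (G.induce (↑S)ᶜ).Reachable ⟨x, hx⟩ ⟨y, hy⟩ := by
    apply SimpleGraph.Adj.reachable
    simpa using hxy
  refine ⟨Fintype.card I, compSet H (↑S) cx, compSet H (↑S) cy,
    fun i => compSet H (↑S) (e i).1, ?_, ?_⟩
  · refine ⟨hxy, hxm, hym, compSet_T H _ _, compSet_T H _ _, ?_, fun i => compSet_ne H _ _,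
      fun i => compSet_T H _ _, ?_, ?_, ?_, ?_, hclx, hcly, fun i => hcli (e i), ?_, ?_⟩
    · intro a h1 h2; exact hne (compSet_dis H _ _ _ a h1 h2)
    · intro i a h1 h2; exact (e i).2.1 (compSet_dis H _ _ _ a h1 h2)
    · intro i a h1 h2; exact (e i).2.2 (compSet_dis H _ _ _ a h1 h2)
    · intro i j a h1 h2
      have := compSet_dis H _ _ _ a h1 h2
      exact e.injective (Subtype.ext this)
    · intro a
      by_cases haS : a ∈ S
      · exact Or.inl haS
      · right
        have haS' : a ∈ ((S : Set V))ᶜ := haS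
        set c : K := (H.induce (↑S)ᶜ).connectedComponentMk ⟨a, haS'⟩ with hc
        have hac : a ∈ compSet H (↑S) c := ⟨haS', rfl⟩
        by_cases h1 : c = cx
        · left; rw [← h1]; exact hac
        · by_cases h2 : c = cy
          · right; left; rw [← h2]; exact hac
          · right; right
            refine ⟨e.symm ⟨c, h1, h2⟩, ?_⟩
            simpa using hac
    · ext b
      constructor
      · rintro ⟨h1, h2, h3⟩
        refine closed_reach G (↑S) (compSet H (↑S) cx ∪ compSet H (↑S) cy) ?_ _ _ h3 (Or.inl hxm)
        rintro a (ha | ha) z hz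
        · rcases hclx a ha z hz with h | h | ⟨-, rfl⟩
          · exact Or.inl (Or.inl h)
          · exact Or.inr h
          · exact Or.inl (Or.inr hym)
        · rcases hcly a ha z hz with h | h | ⟨-, rfl⟩
          · exact Or.inl (Or.inr h)
          · exact Or.inr h
          · exact Or.inl (Or.inl hxm)
      · rintro (h | h)
        · obtain ⟨h1, h2, h3⟩ := compSet_reach H _ _ _ _ hxm h
          exact ⟨h1, h2, hmono _ _ h3⟩
        · obtain ⟨h1, h2, h3⟩ := compSet_reach H _ _ _ _ hym h
          exact ⟨hx, h2, hxyr.trans (hmono _ _ h3)⟩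
    · intro i w hw
      ext b
      constructor
      · rintro ⟨h1, h2, h3⟩
        exact closed_reach G (↑S) _ (hcli (e i)) _ _ h3 hw
      · intro h
        obtain ⟨h1, h2, h3⟩ := compSet_reach H _ _ _ _ hw h
        exact ⟨h1, h2, hmono _ _ h3⟩
  · rw [hcard, ← Nat.card_eq_fintype_card]; rfl

def Gd (G : SimpleGraph V) (m : ℕ) (x : V) : Prop :=
  ∃ T : Finset V, T.card = m ∧ 2 ≤ numComponents G ↑T ∧ x ∈ T

def TLow [Fintype V] (G : SimpleGraph V) (m : ℕ) : Prop :=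
  ∀ T : Finset V, 2 ≤ numComponents G ↑T → m * numComponents G ↑T ≤ 2 * T.card

theorem TLow.card_le [Fintype V] {G : SimpleGraph V} {m : ℕ} (h : TLow G m) (T : Finset V)
    (hT : 2 ≤ numComponents G ↑T) : m ≤ T.card := by
  have := h T hT
  nlinarith

/-- a closed set of vertices outside `T` gives `m ≤ |T|`, with equality when `|T| ≤ m`. -/
theorem TLow.sep [Fintype V] {G : SimpleGraph V} {m : ℕ} (h : TLow G m) (A : Set V) (T : Finset V)
    (hne : A.Nonempty) (hT : ∀ a ∈ A, a ∉ T)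
    (hcl : ∀ a ∈ A, ∀ z, G.Adj a z → z ∈ A ∨ z ∈ T)
    (z : V) (hzA : z ∉ A) (hzT : z ∉ T) : m ≤ T.card ∧ (T.card ≤ m → ∀ x ∈ T, Gd G m x) := by
  have h2 := cut_of_closed G A T hne hT hcl z hzA hzT
  have h3 := h.card_le T h2
  exact ⟨h3, fun h4 x hx => ⟨T, le_antisymm h4 h3, h2, hx⟩⟩

theorem exists_m [Fintype V] (G : SimpleGraph V) (t : ℚ) (ht : HasToughness G t)
    (hcf : ClawFree G) : ∃ m : ℕ, (m : ℚ) = 2 * t := by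
  obtain ⟨hlow, S, hS, hSt⟩ := ht
  have : Fintype ((G.induce ((S : Set V))ᶜ).ConnectedComponent) := Fintype.ofFinite _
  have hk : numComponents G ↑S = Fintype.card ((G.induce ((S : Set V))ᶜ).ConnectedComponent) := by
    unfold numComponents; rw [Nat.card_eq_fintype_card]
  have hcount := count_le G hcf (compSet G ↑S) S ∅ (by simp) (compSet_T G _) (compSet_cl G _)
    (compSet_dis G _) (by simp)
  simp only [Finset.card_empty, add_zero] at hcount
  have hge : ∀ c, 2 * t ≤ ((nbF G S (compSet G ↑S c)).card : ℚ) := by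
    intro c
    obtain ⟨d, hd⟩ : ∃ d, d ≠ c := by
      have : 1 < Fintype.card ((G.induce ((S : Set V))ᶜ).ConnectedComponent) := by omega
      exact Fintype.exists_ne_of_one_lt_card this c
    obtain ⟨z, hz⟩ := compSet_ne G ↑S d
    have h2 := cut_of_closed G (compSet G ↑S c) (nbF G S (compSet G ↑S c)) (compSet_ne G _ c)
      (fun a ha h => compSet_T G _ c a ha (mem_nbF.1 h).1)
      (fun a ha z hz => by
        rcases compSet_cl G _ c a ha z hz with h | h
        · exact Or.inl h
        · exact Or.inr (mem_nbF.2 ⟨h, a, ha, hz.symm⟩))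
      z (fun h => hd (compSet_dis G _ _ _ z hz h)) (fun h => compSet_T G _ d z hz (mem_nbF.1 h).1)
    have h3 := hlow _ h2
    have h4 : (2 : ℚ) ≤ (numComponents G ↑(nbF G S (compSet G ↑S c)) : ℚ) := by exact_mod_cast h2
    rw [le_div_iff₀ (by linarith)] at h3
    have h5 : 0 ≤ t := by rw [hSt]; positivity
    nlinarith
  have hkpos : (2 : ℚ) ≤ (numComponents G ↑S : ℚ) := by exact_mod_cast hS
  have hSt' : t * (numComponents G ↑S : ℚ) = S.card := by
    rw [hSt]; field_simp
  have hcount' : ∑ c, ((nbF G S (compSet G ↑S c)).card : ℚ) ≤ 2 * S.card := by exact_mod_cast hcount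
  have hsum : ∑ c : (G.induce ((S : Set V))ᶜ).ConnectedComponent, (2 * t) = 2 * S.card := by
    rw [Finset.sum_const, Finset.card_univ, ← hk, nsmul_eq_mul, ← hSt']; ring
  have heq : ∑ c : (G.induce ((S : Set V))ᶜ).ConnectedComponent, (2 * t)
      = ∑ c, ((nbF G S (compSet G ↑S c)).card : ℚ) :=
    le_antisymm (Finset.sum_le_sum (fun c _ => hge c)) (by rw [hsum]; exact hcount')
  have hall := (Finset.sum_eq_sum_iff_of_le (fun c _ => hge c)).1 heq
  obtain ⟨c⟩ : Nonempty ((G.induce ((S : Set V))ᶜ).ConnectedComponent) := by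
    apply Fintype.card_pos_iff.1; omega
  exact ⟨_, (hall c (Finset.mem_univ _)).symm⟩

theorem Str.count [Fintype V] {G : SimpleGraph V} (hcf : ClawFree G) {x y : V} {S : Finset V}
    {Cx Cy : Set V} {n : ℕ} {C : Fin n → Set V} (h : Str G x y S Cx Cy C) (L : Finset V)
    (hLS : L ⊆ S) (hL1 : ∀ s ∈ L, ∀ i, s ∈ nbF G S (Cx ∪ Cy) → s ∉ nbF G S (C i))
    (hL2 : ∀ s ∈ L, ∀ i j, s ∈ nbF G S (C i) → s ∈ nbF G S (C j) → i = j) :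
    (nbF G S (Cx ∪ Cy)).card + ∑ i, (nbF G S (C i)).card + L.card ≤ 2 * S.card := by
  have := count_le G hcf (κ := Option (Fin n))
    (fun o => match o with | none => Cx ∪ Cy | some i => C i) S L hLS ?_ ?_ ?_ ?_
  · simpa [Fintype.sum_option] using this
  · rintro (_ | i) a ha
    · rcases ha with ha | ha
      · exact h.xS a ha
      · exact h.yS a ha
    · exact h.iS i a ha
  · rintro (_ | i) a ha z hz
    · rcases ha with ha | ha
      · rcases h.clx a ha z hz with h1 | h1 | ⟨-, rfl⟩
        · exact Or.inl (Or.inl h1)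
        · exact Or.inr h1
        · exact Or.inl (Or.inr h.ym)
      · rcases h.cly a ha z hz with h1 | h1 | ⟨-, rfl⟩
        · exact Or.inl (Or.inr h1)
        · exact Or.inr h1
        · exact Or.inl (Or.inl h.xm)
    · exact h.cli i a ha z hz
  · rintro (_ | i) (_ | j) a ha hb
    · rfl
    · rcases ha with ha | ha
      · exact absurd ha (h.ix j a hb)
      · exact absurd ha (h.iy j a hb)
    · rcases hb with hb | hb
      · exact absurd hb (h.ix i a ha)
      · exact absurd hb (h.iy i a ha)
    · exact congrArg some (h.dis i j a ha hb)
  · rintro s hs (_ | i) (_ | j) ha hb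
    · rfl
    · exact absurd hb (hL1 s hs j ha)
    · exact absurd ha (hL1 s hs i hb)
    · exact congrArg some (hL2 s hs i j ha hb)

theorem Str.cut_i [Fintype V] {G : SimpleGraph V} {m : ℕ} (ht : TLow G m) {x y : V} {S : Finset V}
    {Cx Cy : Set V} {n : ℕ} {C : Fin n → Set V} (h : Str G x y S Cx Cy C) (i : Fin n) :
    m ≤ (nbF G S (C i)).card ∧
      ((nbF G S (C i)).card ≤ m → ∀ s ∈ nbF G S (C i), Gd G m s) := by
  refine ht.sep (C i) _ (h.ne i) (fun a ha hh => h.iS i a ha (mem_nbF.1 hh).1) ?_ x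
    (fun hh => h.ix i x hh h.xm) (fun hh => h.xS x h.xm (mem_nbF.1 hh).1)
  intro a ha z hz
  rcases h.cli i a ha z hz with h1 | h1
  · exact Or.inl h1
  · exact Or.inr (mem_nbF.2 ⟨h1, a, ha, hz.symm⟩)

structure Crit (G : SimpleGraph V) (x y : V) (S : Finset V) (Cx Cy O : Set V) : Prop where
  xm : x ∈ Cx
  ym : y ∈ Cy
  xS : ∀ a ∈ Cx, a ∉ S
  yS : ∀ a ∈ Cy, a ∉ S
  dxy : ∀ a ∈ Cx, a ∉ Cy
  oS : ∀ a ∈ O, a ∉ S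
  ox : ∀ a ∈ O, a ∉ Cx
  oy : ∀ a ∈ O, a ∉ Cy
  clx : ∀ a ∈ Cx, ∀ z, G.Adj a z → z ∈ Cx ∨ z ∈ S ∨ (a = x ∧ z = y)
  cly : ∀ a ∈ Cy, ∀ z, G.Adj a z → z ∈ Cy ∨ z ∈ S ∨ (a = y ∧ z = x)
  clo : ∀ a ∈ O, ∀ z, G.Adj a z → z ∈ O ∨ z ∈ S
  alt : S.card ≤ 2 ∨ (O.Nonempty ∧
    (nbF G S (Cx ∪ Cy)).card + (nbF G S (Cx ∪ Cy) \ nbF G S O).card ≤ 5 ∧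
    ((nbF G S (Cx ∪ Cy)).card + (nbF G S (Cx ∪ Cy) \ nbF G S O).card = 5 →
      ∀ s ∈ nbF G S O, Gd G 3 s))

def TCrit [Fintype V] (G : SimpleGraph V) (m : ℕ) : Prop :=
  ∀ x y : V, G.Adj x y → ∃ S : Finset V, 2 ≤ numComponents (G.deleteEdges {s(x, y)}) ↑S ∧
    2 * S.card < m * numComponents (G.deleteEdges {s(x, y)}) ↑S

theorem exists_crit [Fintype V] (G : SimpleGraph V) (hcf : ClawFree G) (hl : TLow G 3)
    (hc : TCrit G 3) (x y : V) (hxy : G.Adj x y) :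
    ∃ (S : Finset V) (Cx Cy O : Set V), Crit G x y S Cx Cy O := by
  obtain ⟨S, h2, hlt⟩ := hc x y hxy
  have hlt' : numComponents G ↑S < numComponents (G.deleteEdges {s(x, y)}) ↑S := by
    by_contra hcon
    have := hl S (by omega)
    omega
  obtain ⟨n, Cx, Cy, C, h, hn⟩ := exists_str G x y S hxy hlt'
  refine ⟨S, Cx, Cy, ⋃ i, C i, h.xm, h.ym, h.xS, h.yS, h.dxy, ?_, ?_, ?_, h.clx, h.cly, ?_, ?_⟩
  · intro a ha; obtain ⟨i, hi⟩ := Set.mem_iUnion.1 ha; exact h.iS i a hi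
  · intro a ha; obtain ⟨i, hi⟩ := Set.mem_iUnion.1 ha; exact h.ix i a hi
  · intro a ha; obtain ⟨i, hi⟩ := Set.mem_iUnion.1 ha; exact h.iy i a hi
  · intro a ha z hz; obtain ⟨i, hi⟩ := Set.mem_iUnion.1 ha
    rcases h.cli i a hi z hz with h1 | h1
    · exact Or.inl (Set.mem_iUnion.2 ⟨i, h1⟩)
    · exact Or.inr h1
  · rw [← hn] at hlt
    rcases Nat.eq_zero_or_pos n with rfl | hpos
    · left; omega
    · right
      refine ⟨?_, ?_⟩
      · obtain ⟨a, ha⟩ := h.ne ⟨0, hpos⟩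
        exact ⟨a, Set.mem_iUnion.2 ⟨_, ha⟩⟩
      have hmem : ∀ s, s ∈ nbF G S (⋃ i, C i) ↔ ∃ i, s ∈ nbF G S (C i) := by
        intro s
        simp only [mem_nbF, Set.mem_iUnion]
        constructor
        · rintro ⟨h1, y, ⟨i, hi⟩, h2⟩; exact ⟨i, h1, y, hi, h2⟩
        · rintro ⟨i, h1, y, hi, h2⟩; exact ⟨h1, y, ⟨i, hi⟩, h2⟩
      have hcount := h.count hcf (nbF G S (Cx ∪ Cy) \ nbF G S (⋃ i, C i)) ?_ ?_ ?_
      · have hge := fun i => (h.cut_i hl i).1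
        have hsum : 3 * n ≤ ∑ i, (nbF G S (C i)).card := by
          have := Finset.card_nsmul_le_sum (Finset.univ : Finset (Fin n))
            (fun i => (nbF G S (C i)).card) 3 (fun i _ => hge i)
          simp at this
          omega
        refine ⟨by omega, ?_⟩
        intro h5 s hs
        obtain ⟨i, hi⟩ := (hmem s).1 hs
        refine (h.cut_i hl i).2 ?_ s hi
        by_contra hcon
        have : ∑ i : Fin n, 3 < ∑ i, (nbF G S (C i)).card :=
          Finset.sum_lt_sum (fun i _ => hge i) ⟨i, Finset.mem_univ _, by omega⟩
        simp at this
        omega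
      · intro s hs; exact (mem_nbF.1 (Finset.mem_sdiff.1 hs).1).1
      · intro s hs i _ hi
        exact (Finset.mem_sdiff.1 hs).2 ((hmem s).2 ⟨i, hi⟩)
      · intro s hs i j hi
        exact absurd ((hmem s).2 ⟨i, hi⟩) (Finset.mem_sdiff.1 hs).2

structure Cfg (G : SimpleGraph V) (u v : V) (S : Finset V) (D : Set V) : Prop where
  adj : G.Adj u v
  uS : u ∉ S
  vS : v ∉ S
  card : S.card = 4
  cov : ∀ a, a = u ∨ a = v ∨ a ∈ S ∨ a ∈ D
  dS : ∀ a ∈ D, a ∉ S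
  uD : ∀ a ∈ D, ¬ G.Adj u a
  vD : ∀ a ∈ D, ¬ G.Adj v a
  sD : ∀ s ∈ S, ∃ d ∈ D, G.Adj s d
  suv : ∀ s ∈ S, G.Adj u s ∨ G.Adj v s
  pu : ∀ p ∈ S, ∀ q ∈ S, p ≠ q → G.Adj u p ∨ G.Adj u q
  pv : ∀ p ∈ S, ∀ q ∈ S, p ≠ q → G.Adj v p ∨ G.Adj v q

theorem Cfg.symm {G : SimpleGraph V} {u v : V} {S : Finset V} {D : Set V} (h : Cfg G u v S D) :
    Cfg G v u S D :=
  ⟨h.adj.symm, h.vS, h.uS, h.card, fun a => by have := h.cov a; tauto, h.dS, h.vD, h.uD, h.sD,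
    fun s hs => (h.suv s hs).symm, h.pv, h.pu⟩

theorem cf_use {G : SimpleGraph V} (hcf : ClawFree G) {s a b c : V} (ha : G.Adj s a)
    (hb : G.Adj s b) (hc : G.Adj s c) (hab : a ≠ b) (hac : a ≠ c) (hbc : b ≠ c)
    (h1 : ¬ G.Adj a b) (h2 : ¬ G.Adj a c) : G.Adj b c := by
  by_contra h3
  exact hcf ⟨s, a, b, c, hab, hac, hbc, ha, hb, hc, h1, h2, h3⟩

theorem Crit.common {G : SimpleGraph V} {x y : V} {S : Finset V} {Cx Cy O : Set V}
    (h : Crit G x y S Cx Cy O) {z : V} (hx : G.Adj x z) (hy : G.Adj y z) : z ∈ S := by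
  rcases h.clx x h.xm z hx with h1 | h1 | ⟨-, rfl⟩
  · rcases h.cly y h.ym z hy with h2 | h2 | ⟨-, rfl⟩
    · exact absurd h2 (h.dxy z h1)
    · exact h2
    · exact absurd rfl hx.ne
  · exact h1
  · exact absurd rfl hy.ne

theorem Crit.ox_adj {G : SimpleGraph V} {x y : V} {S : Finset V} {Cx Cy O : Set V}
    (h : Crit G x y S Cx Cy O) {o a : V} (ho : o ∈ O) (ha : a ∈ Cx ∨ a ∈ Cy) :
    o ≠ a ∧ ¬ G.Adj o a := by
  constructor
  · rintro rfl
    rcases ha with ha | ha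
    · exact h.ox _ ho ha
    · exact h.oy _ ho ha
  · intro hoa
    rcases h.clo o ho a hoa with h1 | h1
    · rcases ha with ha | ha
      · exact h.ox _ h1 ha
      · exact h.oy _ h1 ha
    · rcases ha with ha | ha
      · exact h.xS _ ha h1
      · exact h.yS _ ha h1

/-- a vertex of `S` adjacent to `Cx`, `Cy` and `O` only sees `x` and `y`. -/
theorem Crit.three {G : SimpleGraph V} (hcf : ClawFree G) {x y : V} {S : Finset V}
    {Cx Cy O : Set V} (h : Crit G x y S Cx Cy O) {s a b o : V} (ha : a ∈ Cx) (hb : b ∈ Cy)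
    (ho : o ∈ O) (hsa : G.Adj s a) (hsb : G.Adj s b) (hso : G.Adj s o) : a = x ∧ b = y := by
  have h1 := h.ox_adj ho (Or.inl ha)
  have h2 := h.ox_adj ho (Or.inr hb)
  have hab : a ≠ b := by rintro rfl; exact h.dxy a ha hb
  have := cf_use hcf hso hsa hsb h1.1 h2.1 hab h1.2 h2.2
  rcases h.clx a ha b this with h3 | h3 | h3
  · exact absurd hb (h.dxy b h3)
  · exact absurd h3 (h.yS b hb)
  · exact h3

theorem lemma_two [Fintype V] (G : SimpleGraph V) (hcf : ClawFree G) (hl : TLow G 3)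
    (hc : TCrit G 3) {u v : V} {S : Finset V} {D : Set V} (h : Cfg G u v S D)
    (y s : V) (hy : y ∈ S) (hs : s ∈ S) (huy : G.Adj u y) (hvy : G.Adj v y) (hys : G.Adj y s)
    (hbad : ¬ Gd G 3 y) :
    Gd G 3 s ∧ ∃ d ∈ D, ∃ c, G.Adj s d ∧ G.Adj s c ∧ c ≠ u ∧ c ≠ v ∧ c ≠ y ∧ c ≠ d ∧
      ¬ G.Adj c d := by
  obtain ⟨d, hd, hyd⟩ := h.sD y hy
  obtain ⟨S2, Cy, Cd, O, hk⟩ := exists_crit G hcf hl hc y d hyd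
  have hsd : s ≠ d := by rintro rfl; exact h.dS _ hd hs
  have hud : u ≠ d := by rintro rfl; exact h.vD _ hd h.adj.symm
  have hvd : v ≠ d := by rintro rfl; exact h.uD _ hd h.adj
  have hus : s ≠ u := by rintro rfl; exact h.uS hs
  have hvs : s ≠ v := by rintro rfl; exact h.vS hs
  have hsingle : (∀ p ∈ Cy, p = y) → ∀ z, G.Adj y z → z ≠ d → z ∈ S2 := by
    intro hp z hz hzd
    rcases hk.clx y hk.xm z hz with h1 | h1 | h1
    · exact absurd (hp z h1).symm hz.ne
    · exact h1
    · exact absurd h1.2 hzd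
  rcases hk.alt with h2 | ⟨⟨o, ho⟩, h5, h5'⟩
  · exfalso
    by_cases hp : ∃ p ∈ Cy, p ≠ y
    · obtain ⟨p, hp, hpy⟩ := hp
      have := hl.sep Cd (insert y S2) ⟨d, hk.ym⟩ ?_ ?_ p (hk.dxy p hp) ?_
      · refine hbad (this.2 ?_ y (Finset.mem_insert_self _ _))
        have := Finset.card_insert_le y S2
        omega
      · intro a ha hh
        rcases Finset.mem_insert.1 hh with rfl | hh
        · exact hk.dxy _ hk.xm ha
        · exact hk.yS a ha hh
      · intro a ha z hz
        rcases hk.cly a ha z hz with h1 | h1 | h1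
        · exact Or.inl h1
        · exact Or.inr (Finset.mem_insert_of_mem h1)
        · right; rw [h1.2]; exact Finset.mem_insert_self _ _
      · intro hh
        rcases Finset.mem_insert.1 hh with hh | hh
        · exact hpy hh
        · exact hk.xS p hp hh
    · push Not at hp
      have h3 : ({u, v, s} : Finset V) ⊆ S2 := by
        intro z hz
        simp only [Finset.mem_insert, Finset.mem_singleton] at hz
        rcases hz with rfl | rfl | rfl
        · exact hsingle hp _ huy.symm hud
        · exact hsingle hp _ hvy.symm hvd
        · exact hsingle hp _ hys hsd
      have h4 := Finset.card_le_card h3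
      rw [Finset.card_eq_three.2 ⟨u, v, s, h.adj.ne, hus.symm, hvs.symm, rfl⟩] at h4
      omega
  · set N := nbF G S2 (Cy ∪ Cd) with hN
    set Q := nbF G S2 Cd with hQ
    set Sl := N \ nbF G S2 O with hSl
    have hQN : Q ⊆ N := by
      intro z hz
      obtain ⟨h1, w, hw, h2⟩ := mem_nbF.1 hz
      exact mem_nbF.2 ⟨h1, w, Or.inr hw, h2⟩
    have hPc : (N \ Q).card + Q.card = N.card := Finset.card_sdiff_add_card_eq_card hQN
    have hQ3 : 3 ≤ Q.card := by
      by_contra hcon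
      have := hl.sep Cd (insert y Q) ⟨d, hk.ym⟩ ?_ ?_ o (hk.oy o ho) ?_
      · refine hbad (this.2 ?_ y (Finset.mem_insert_self _ _))
        have := Finset.card_insert_le y Q
        omega
      · intro a ha hh
        rcases Finset.mem_insert.1 hh with rfl | hh
        · exact hk.dxy _ hk.xm ha
        · exact hk.yS a ha (mem_nbF.1 hh).1
      · intro a ha z hz
        rcases hk.cly a ha z hz with h1 | h1 | h1
        · exact Or.inl h1
        · exact Or.inr (Finset.mem_insert_of_mem (mem_nbF.2 ⟨h1, a, ha, hz.symm⟩))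
        · right; rw [h1.2]; exact Finset.mem_insert_self _ _
      · intro hh
        rcases Finset.mem_insert.1 hh with hh | hh
        · exact hk.ox o ho (hh ▸ hk.xm)
        · exact hk.oS o ho (mem_nbF.1 hh).1
    have hPS : ((N \ Q) ∪ Sl).card ≤ (N \ Q).card + Sl.card := Finset.card_union_le _ _
    have hkey : ∀ a ∈ Cy, ∀ z ∈ S2, G.Adj a z → z ∉ (N \ Q) ∪ Sl → a = y ∧ G.Adj z d ∧ z ∈ nbF G S2 O := by
      intro a ha z hz haz hzn
      have hzN : z ∈ N := mem_nbF.2 ⟨hz, a, Or.inl ha, haz.symm⟩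
      simp only [Finset.mem_union, hSl, Finset.mem_sdiff, not_or, not_and, not_not] at hzn
      have hzQ := hzn.1 hzN
      have hzO := hzn.2 hzN
      obtain ⟨-, w, hw, hzw⟩ := mem_nbF.1 hzQ
      obtain ⟨-, o', ho', hzo'⟩ := mem_nbF.1 hzO
      obtain ⟨e1, e2⟩ := hk.three hcf ha hw ho' haz.symm hzw hzo'
      exact ⟨e1, e2 ▸ hzw, hzO⟩
    by_cases hp : ∃ p ∈ Cy, p ≠ y
    · exfalso
      obtain ⟨p, hp, hpy⟩ := hp
      have := hl.sep (Cy \ {y}) (insert y ((N \ Q) ∪ Sl)) ⟨p, hp, hpy⟩ ?_ ?_ d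
        (fun hh => hk.dxy d hh.1 hk.ym) ?_
      · refine hbad (this.2 ?_ y (Finset.mem_insert_self _ _))
        have := Finset.card_insert_le y ((N \ Q) ∪ Sl)
        omega
      · rintro a ⟨ha, hay⟩ hh
        rcases Finset.mem_insert.1 hh with hh | hh
        · exact hay hh
        · have : a ∈ N := by
            rcases Finset.mem_union.1 hh with hh | hh <;> exact (Finset.mem_sdiff.1 hh).1
          exact hk.xS a ha (mem_nbF.1 this).1
      · rintro a ⟨ha, hay⟩ z hz
        rcases hk.clx a ha z hz with h1 | h1 | h1
        · by_cases hzy : z = y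
          · right; rw [hzy]; exact Finset.mem_insert_self _ _
          · exact Or.inl ⟨h1, hzy⟩
        · right
          apply Finset.mem_insert_of_mem
          by_contra hcon
          exact hay (hkey a ha z h1 hz hcon).1
        · exact absurd h1.1 hay
      · intro hh
        rcases Finset.mem_insert.1 hh with hh | hh
        · exact hyd.ne hh.symm
        · have : d ∈ N := by
            rcases Finset.mem_union.1 hh with hh | hh <;> exact (Finset.mem_sdiff.1 hh).1
          exact hk.yS d hk.ym (mem_nbF.1 this).1
    · push Not at hp
      have huS := hsingle hp _ huy.symm hud
      have hvS := hsingle hp _ hvy.symm hvd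
      have hsS := hsingle hp _ hys hsd
      have hu : u ∈ (N \ Q) ∪ Sl := by
        by_contra hcon
        exact h.uD d hd (hkey y hk.xm u huS huy.symm hcon).2.1
      have hv : v ∈ (N \ Q) ∪ Sl := by
        by_contra hcon
        exact h.vD d hd (hkey y hk.xm v hvS hvy.symm hcon).2.1
      have hsub : ({u, v} : Finset V) ⊆ (N \ Q) ∪ Sl := by
        intro z hz
        simp only [Finset.mem_insert, Finset.mem_singleton] at hz
        rcases hz with rfl | rfl
        · exact hu
        · exact hv
      have hc2 : ({u, v} : Finset V).card = 2 := Finset.card_pair h.adj.ne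
      have hc3 := Finset.card_le_card hsub
      have heq := Finset.eq_of_subset_of_card_le hsub (by omega)
      have hsn : s ∉ (N \ Q) ∪ Sl := by
        rw [← heq]; simp [hus, hvs]
      obtain ⟨-, hsd', hsO⟩ := hkey y hk.xm s hsS hys hsn
      refine ⟨h5' (by omega) s hsO, d, hd, ?_⟩
      obtain ⟨-, c, hcO, hsc⟩ := mem_nbF.1 hsO
      have hd' := hk.ox_adj hcO (Or.inr hk.ym)
      refine ⟨c, hsd', hsc, ?_, ?_, (hk.ox_adj hcO (Or.inl hk.xm)).1, hd'.1, hd'.2⟩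
      · rintro rfl; exact hk.oS _ hcO huS
      · rintro rfl; exact hk.oS _ hcO hvS

theorem Cfg.no_triple [Fintype V] {G : SimpleGraph V} (hcf : ClawFree G) (hl : TLow G 3)
    (hc : TCrit G 3) {u v : V} {S : Finset V} {D : Set V} (h : Cfg G u v S D)
    {p q r : V} (hp : p ∈ S) (hq : q ∈ S) (hr : r ∈ S) (hpq : p ≠ q) (hpr : p ≠ r) (hqr : q ≠ r)
    (bp : ¬ Gd G 3 p) (bq : ¬ Gd G 3 q) (br : ¬ Gd G 3 r)
    (up : G.Adj u p) (uq : G.Adj u q) (ur : G.Adj u r) : False := by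
  have key : ∀ a ∈ S, ∀ b ∈ S, a ≠ b → ¬ Gd G 3 a → ¬ Gd G 3 b → G.Adj u a → G.Adj u b →
      ¬ G.Adj a b := by
    intro a ha b hb hab ba bb ua ub hadj
    rcases h.pv a ha b hb hab with hv | hv
    · exact bb (lemma_two G hcf hl hc h a b ha hb ua hv hadj ba).1
    · exact ba (lemma_two G hcf hl hc h b a hb ha ub hv hadj.symm bb).1
  exact hcf ⟨u, p, q, r, hpq, hpr, hqr, up, uq, ur, key p hp q hq hpq bp bq up uq,
    key p hp r hr hpr bp br up ur, key q hq r hr hqr bq br uq ur⟩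

theorem final_cfg [Fintype V] (G : SimpleGraph V) (hcf : ClawFree G) (hl : TLow G 3)
    (hc : TCrit G 3) {u v : V} {S : Finset V} {D : Set V} (h : Cfg G u v S D) :
    2 ≤ (S.filter (fun s => Gd G 3 s)).card := by
  by_contra hcon
  have hsum := Finset.card_filter_add_card_filter_not (s := S) (fun s => Gd G 3 s)
  have hB : 2 < (S.filter (fun s => ¬ Gd G 3 s)).card := by
    have := h.card; omega
  obtain ⟨p, q, r, hp, hq, hr, hpq, hpr, hqr⟩ := Finset.two_lt_card_iff.1 hB
  rw [Finset.mem_filter] at hp hq hr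
  have hb : ∃ b ∈ S, ¬ Gd G 3 b ∧ ¬ G.Adj u b := by
    by_contra hcc
    push Not at hcc
    exact h.no_triple hcf hl hc hp.1 hq.1 hr.1 hpq hpr hqr hp.2 hq.2 hr.2
      (hcc p hp.1 hp.2) (hcc q hq.1 hq.2) (hcc r hr.1 hr.2)
  have ha : ∃ b ∈ S, ¬ Gd G 3 b ∧ ¬ G.Adj v b := by
    by_contra hcc
    push Not at hcc
    exact h.symm.no_triple hcf hl hc hp.1 hq.1 hr.1 hpq hpr hqr hp.2 hq.2 hr.2
      (hcc p hp.1 hp.2) (hcc q hq.1 hq.2) (hcc r hr.1 hr.2)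
  obtain ⟨b, hbS, bb, hub⟩ := hb
  obtain ⟨a, haS, ba, hva⟩ := ha
  have hua : G.Adj u a := (h.suv a haS).resolve_right hva
  have hvb : G.Adj v b := (h.suv b hbS).resolve_left hub
  have hab : a ≠ b := by rintro rfl; exact hub hua
  obtain ⟨y, hy, hyn⟩ : ∃ y ∈ S.filter (fun s => ¬ Gd G 3 s), y ∉ ({a, b} : Finset V) :=
    Finset.exists_mem_notMem_of_card_lt_card (by
      have := Finset.card_le_two (a := a) (b := b); omega)
  rw [Finset.mem_filter] at hy
  obtain ⟨hyS, by'⟩ := hy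
  simp only [Finset.mem_insert, Finset.mem_singleton, not_or] at hyn
  obtain ⟨g, hgS, hgn⟩ : ∃ g ∈ S, g ∉ ({a, b, y} : Finset V) :=
    Finset.exists_mem_notMem_of_card_lt_card (by
      have := Finset.card_le_three (a := a) (b := b) (c := y); have := h.card; omega)
  simp only [Finset.mem_insert, Finset.mem_singleton, not_or] at hgn
  obtain ⟨hga, hgb, hgy⟩ := hgn
  have hSeq : ∀ z ∈ S, z = a ∨ z = b ∨ z = y ∨ z = g := by
    have h4 : ({a, b, y, g} : Finset V).card = 4 := by
      rw [Finset.card_insert_of_notMem, Finset.card_eq_three.2 ⟨b, y, g, ?_, ?_, ?_, rfl⟩]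
      · exact fun e => hyn.2 e.symm
      · exact fun e => hgb e.symm
      · exact fun e => hgy e.symm
      · simp only [Finset.mem_insert, Finset.mem_singleton, not_or]
        exact ⟨hab, fun e => hyn.1 e.symm, fun e => hga e.symm⟩
    have hsub : ({a, b, y, g} : Finset V) ⊆ S := by
      intro z hz
      simp only [Finset.mem_insert, Finset.mem_singleton] at hz
      rcases hz with rfl | rfl | rfl | rfl <;> assumption
    have := Finset.eq_of_subset_of_card_le hsub (by rw [h4, h.card])
    intro z hz
    rw [← this] at hz
    simpa using hz
  have huy : G.Adj u y := (h.pu y hyS b hbS hyn.2).resolve_right hub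
  have hug : G.Adj u g := (h.pu g hgS b hbS hgb).resolve_right hub
  have hvy : G.Adj v y := (h.pv y hyS a haS hyn.1).resolve_right hva
  have hvg : G.Adj v g := (h.pv g hgS a haS hga).resolve_right hva
  have hya : ¬ G.Adj y a := fun hh => ba (lemma_two G hcf hl hc h y a hyS haS huy hvy hh by').1
  have hyb : ¬ G.Adj y b := fun hh => bb (lemma_two G hcf hl hc h y b hyS hbS huy hvy hh by').1
  have hyg : ¬ G.Adj y g := by
    intro hh
    obtain ⟨-, d, hd, c, hgd, hgc, hcu, hcv, hcy, hcd, hcd'⟩ :=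
      lemma_two G hcf hl hc h y g hyS hgS huy hvy hh by'
    have hdu : d ≠ u := by rintro rfl; exact h.vD _ hd h.adj.symm
    have hdv : d ≠ v := by rintro rfl; exact h.uD _ hd h.adj
    have huc : G.Adj c u :=
      cf_use hcf hgd hgc hug.symm hcd.symm hdu hcu (fun e => hcd' e.symm)
        (fun e => h.uD d hd e.symm)
    have hvc : G.Adj c v :=
      cf_use hcf hgd hgc hvg.symm hcd.symm hdv hcv (fun e => hcd' e.symm)
        (fun e => h.vD d hd e.symm)
    have hcS : c ∈ S := by
      rcases h.cov c with h1 | h1 | h1 | h1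
      · exact absurd h1 hcu
      · exact absurd h1 hcv
      · exact h1
      · exact absurd huc.symm (h.uD c h1)
    rcases hSeq c hcS with rfl | rfl | rfl | rfl
    · exact hva hvc.symm
    · exact hub huc.symm
    · exact hcy rfl
    · exact hgc.ne rfl
  have hgA : G.Adj a g :=
    cf_use hcf huy hua hug hyn.1 (fun e => hgy e.symm) (fun e => hga e.symm) hya hyg
  have hgB : G.Adj b g :=
    cf_use hcf hvy hvb hvg hyn.2 (fun e => hgy e.symm) (fun e => hgb e.symm) hyb hyg
  obtain ⟨S2, Cu, Cg, O, hk⟩ := exists_crit G hcf hl hc u g hug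
  have hvS2 : v ∈ S2 := hk.common h.adj hvg.symm
  have haS2 : a ∈ S2 := hk.common hua hgA.symm
  have hav : a ≠ v := by rintro rfl; exact h.vS haS
  have hyv : y ≠ v := by rintro rfl; exact h.vS hyS
  have hyu : y ≠ u := by rintro rfl; exact h.uS hyS
  have hbu : b ≠ u := by rintro rfl; exact h.uS hbS
  have hbv : b ≠ v := by rintro rfl; exact h.vS hbS
  have hyC : y ∈ Cu ∨ y ∈ S2 := by
    rcases hk.clx u hk.xm y huy with h1 | h1 | h1
    · exact Or.inl h1
    · exact Or.inr h1
    · exact absurd h1.2.symm hgy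
  have hbC : b ∈ Cg ∨ b ∈ S2 := by
    rcases hk.cly g hk.ym b hgB.symm with h1 | h1 | h1
    · exact Or.inl h1
    · exact Or.inr h1
    · exact absurd h1.2 hbu
  rcases hk.alt with h2 | ⟨⟨o, ho⟩, h5, -⟩
  · have hyCu : y ∈ Cu := by
      refine hyC.resolve_right (fun hyS2 => ?_)
      have hsub : ({v, a, y} : Finset V) ⊆ S2 := by
        intro z hz
        simp only [Finset.mem_insert, Finset.mem_singleton] at hz
        rcases hz with rfl | rfl | rfl <;> assumption
      have h4 := Finset.card_le_card hsub
      rw [Finset.card_eq_three.2 ⟨v, a, y, hav.symm, hyv.symm, fun e => hyn.1 e.symm, rfl⟩] at h4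
      omega
    have := hl.sep (Cu \ {u}) (insert u S2) ⟨y, hyCu, hyu⟩ ?_ ?_ g
      (fun hh => hk.dxy g hh.1 hk.ym) ?_
    · refine ba (this.2 ?_ a (Finset.mem_insert_of_mem haS2))
      have := Finset.card_insert_le u S2
      omega
    · rintro z ⟨hz, hzu⟩ hh
      rcases Finset.mem_insert.1 hh with hh | hh
      · exact hzu hh
      · exact hk.xS z hz hh
    · rintro w ⟨hw, hwu⟩ z hz
      rcases hk.clx w hw z hz with h1 | h1 | h1
      · by_cases hzu : z = u
        · right; rw [hzu]; exact Finset.mem_insert_self _ _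
        · exact Or.inl ⟨h1, hzu⟩
      · exact Or.inr (Finset.mem_insert_of_mem h1)
      · exact absurd h1.1 hwu
    · intro hh
      rcases Finset.mem_insert.1 hh with hh | hh
      · exact hug.ne hh.symm
      · exact hk.yS g hk.ym hh
  · set N := nbF G S2 (Cu ∪ Cg) with hN
    have hvN : v ∈ N := mem_nbF.2 ⟨hvS2, u, Or.inl hk.xm, h.adj.symm⟩
    have hvnb : ∀ z, G.Adj v z → z = u ∨ z = b ∨ z = y ∨ z = g := by
      intro z hz
      rcases h.cov z with h1 | h1 | h1 | h1
      · exact Or.inl h1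
      · exact absurd h1.symm hz.ne
      · rcases hSeq z h1 with rfl | h2
        · exact absurd hz hva
        · exact Or.inr h2
      · exact absurd hz (h.vD z h1)
    have hvO : v ∉ nbF G S2 O := by
      intro hh
      obtain ⟨-, z, hzO, hvz⟩ := mem_nbF.1 hh
      rcases hvnb z hvz with rfl | rfl | rfl | rfl
      · exact hk.ox _ hzO hk.xm
      · exact (hk.ox_adj hzO (Or.inr hk.ym)).2 hgB
      · exact (hk.ox_adj hzO (Or.inl hk.xm)).2 huy.symm
      · exact hk.oy _ hzO hk.ym
    have hSl : 0 < (N \ nbF G S2 O).card :=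
      Finset.card_pos.2 ⟨v, Finset.mem_sdiff.2 ⟨hvN, hvO⟩⟩
    have hTc := Finset.card_erase_of_mem hvN
    have haN : a ∈ N := mem_nbF.2 ⟨haS2, u, Or.inl hk.xm, hua.symm⟩
    have := hl.sep (insert v (Cu ∪ Cg)) (N.erase v) ⟨v, Or.inl rfl⟩ ?_ ?_ o ?_ ?_
    · exact ba (this.2 (by omega) a (Finset.mem_erase.2 ⟨hav, haN⟩))
    · rintro z hz hh
      obtain ⟨h1, h2⟩ := Finset.mem_erase.1 hh
      rcases hz with hz | hz | hz
      · exact h1 hz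
      · exact hk.xS z hz (mem_nbF.1 h2).1
      · exact hk.yS z hz (mem_nbF.1 h2).1
    · have hS2 : ∀ w ∈ Cu ∪ Cg, ∀ z ∈ S2, G.Adj w z →
          z ∈ insert v (Cu ∪ Cg) ∨ z ∈ N.erase v := by
        intro w hw z hz hwz
        by_cases hzv : z = v
        · exact Or.inl (Or.inl hzv)
        · exact Or.inr (Finset.mem_erase.2 ⟨hzv, mem_nbF.2 ⟨hz, w, hw, hwz.symm⟩⟩)
      rintro w hw z hz
      rcases hw with rfl | hw | hw
      · rcases hvnb z hz with rfl | rfl | rfl | rfl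
        · exact Or.inl (Or.inr (Or.inl hk.xm))
        · rcases hbC with h1 | h1
          · exact Or.inl (Or.inr (Or.inr h1))
          · exact hS2 g (Or.inr hk.ym) _ h1 hgB.symm
        · rcases hyC with h1 | h1
          · exact Or.inl (Or.inr (Or.inl h1))
          · exact hS2 u (Or.inl hk.xm) _ h1 huy
        · exact Or.inl (Or.inr (Or.inr hk.ym))
      · rcases hk.clx w hw z hz with h1 | h1 | h1
        · exact Or.inl (Or.inr (Or.inl h1))
        · exact hS2 w (Or.inl hw) z h1 hz
        · rw [h1.2]; exact Or.inl (Or.inr (Or.inr hk.ym))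
      · rcases hk.cly w hw z hz with h1 | h1 | h1
        · exact Or.inl (Or.inr (Or.inr h1))
        · exact hS2 w (Or.inr hw) z h1 hz
        · rw [h1.2]; exact Or.inl (Or.inr (Or.inl hk.xm))
    · rintro (hh | hh | hh)
      · exact hk.oS o ho (hh ▸ hvS2)
      · exact hk.ox o ho hh
      · exact hk.oy o ho hh
    · intro hh
      exact hk.oS o ho (mem_nbF.1 (Finset.mem_erase.1 hh).2).1

structure Two (G : SimpleGraph V) (x y : V) (S : Finset V) (Cx Cy O : Set V) : Prop where
  adj : G.Adj x y
  xm : x ∈ Cx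
  ym : y ∈ Cy
  xS : ∀ a ∈ Cx, a ∉ S
  yS : ∀ a ∈ Cy, a ∉ S
  dxy : ∀ a ∈ Cx, a ∉ Cy
  one : O.Nonempty
  oS : ∀ a ∈ O, a ∉ S
  ox : ∀ a ∈ O, a ∉ Cx
  oy : ∀ a ∈ O, a ∉ Cy
  cov : ∀ a, a ∈ S ∨ a ∈ Cx ∨ a ∈ Cy ∨ a ∈ O
  clx : ∀ a ∈ Cx, ∀ z, G.Adj a z → z ∈ Cx ∨ z ∈ S ∨ (a = x ∧ z = y)
  cly : ∀ a ∈ Cy, ∀ z, G.Adj a z → z ∈ Cy ∨ z ∈ S ∨ (a = y ∧ z = x)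
  clo : ∀ a ∈ O, ∀ z, G.Adj a z → z ∈ O ∨ z ∈ S
  sO : ∀ s ∈ S, ∃ d ∈ O, G.Adj s d
  sC : ∀ s ∈ S, (∃ d ∈ Cx, G.Adj s d) ∨ (∃ d ∈ Cy, G.Adj s d)
  card : S.card = 4

theorem Two.symm {G : SimpleGraph V} {x y : V} {S : Finset V} {Cx Cy O : Set V}
    (h : Two G x y S Cx Cy O) : Two G y x S Cy Cx O :=
  ⟨h.adj.symm, h.ym, h.xm, h.yS, h.xS, fun a ha hb => h.dxy a hb ha, h.one, h.oS, h.oy, h.ox,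
    fun a => by have := h.cov a; tauto, h.cly, h.clx, h.clo, h.sO, fun s hs => (h.sC s hs).symm,
    h.card⟩

theorem Two.crit {G : SimpleGraph V} {x y : V} {S : Finset V} {Cx Cy O : Set V}
    [Fintype V] (h : Two G x y S Cx Cy O) : Crit G x y S Cx Cy O := by
  refine ⟨h.xm, h.ym, h.xS, h.yS, h.dxy, h.oS, h.ox, h.oy, h.clx, h.cly, h.clo, Or.inr ⟨h.one, ?_⟩⟩
  have h1 : nbF G S O = S := by
    ext s; rw [mem_nbF]; exact ⟨fun h => h.1, fun hs => ⟨hs, h.sO s hs⟩⟩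
  have h2 : nbF G S (Cx ∪ Cy) ⊆ S := fun s hs => (mem_nbF.1 hs).1
  have h3 := Finset.card_le_card h2
  rw [h1, Finset.sdiff_eq_empty_iff_subset.2 h2]
  have := h.card
  simp only [Finset.card_empty]
  constructor
  · omega
  · intro h; omega

/-- `Cx` has three neighbours in `S`, unless two vertices of `S` are good. -/
theorem Two.three_nb [Fintype V] {G : SimpleGraph V} (hl : TLow G 3)
    {x y : V} {S : Finset V} {Cx Cy O : Set V} (h : Two G x y S Cx Cy O)
    (hng : ¬ 2 ≤ (S.filter (fun s => Gd G 3 s)).card) : 3 ≤ (nbF G S Cx).card := by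
  by_contra hcon
  obtain ⟨o, ho⟩ := h.one
  have hsub : nbF G S Cx ⊆ S := fun s hs => (mem_nbF.1 hs).1
  have key := hl.sep Cx (insert y (nbF G S Cx)) ⟨x, h.xm⟩ ?_ ?_ o (h.ox o ho) ?_
  · have hc := Finset.card_insert_le y (nbF G S Cx)
    have hg := key.2 (by omega)
    have : nbF G S Cx ⊆ S.filter (fun s => Gd G 3 s) := by
      intro s hs
      exact Finset.mem_filter.2 ⟨hsub hs, hg s (Finset.mem_insert_of_mem hs)⟩
    have := Finset.card_le_card this
    omega
  · intro a ha hh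
    rcases Finset.mem_insert.1 hh with rfl | hh
    · exact h.dxy _ ha h.ym
    · exact h.xS a ha (hsub hh)
  · intro a ha z hz
    rcases h.clx a ha z hz with h1 | h1 | h1
    · exact Or.inl h1
    · exact Or.inr (Finset.mem_insert_of_mem (mem_nbF.2 ⟨h1, a, ha, hz.symm⟩))
    · exact Or.inr (by rw [h1.2]; exact Finset.mem_insert_self _ _)
  · intro hh
    rcases Finset.mem_insert.1 hh with rfl | hh
    · exact h.oy _ ho h.ym
    · exact h.oS o ho (hsub hh)

theorem Two.single [Fintype V] {G : SimpleGraph V} (hcf : ClawFree G) (hl : TLow G 3)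
    {x y : V} {S : Finset V} {Cx Cy O : Set V} (h : Two G x y S Cx Cy O)
    (hy : 3 ≤ (nbF G S Cy).card) : ∀ a ∈ Cx, a = x := by
  by_contra hcon
  push Not at hcon
  obtain ⟨a, ha, hax⟩ := hcon
  obtain ⟨o, ho⟩ := h.one
  have hsub : nbF G S Cy ⊆ S := fun s hs => (mem_nbF.1 hs).1
  have key := hl.sep (Cx \ {x}) (insert x (S \ nbF G S Cy)) ⟨a, ha, hax⟩ ?_ ?_ o
    (fun hh => h.ox o ho hh.1) ?_
  · have hc := Finset.card_insert_le x (S \ nbF G S Cy)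
    have h2 := Finset.card_sdiff_add_card_eq_card hsub
    have h3 := h.card
    have := key.1
    omega
  · intro b hb hh
    rcases Finset.mem_insert.1 hh with rfl | hh
    · exact hb.2 rfl
    · exact h.xS b hb.1 (Finset.mem_sdiff.1 hh).1
  · intro b hb z hz
    by_cases hzx : z = x
    · right; rw [hzx]; exact Finset.mem_insert_self _ _
    rcases h.clx b hb.1 z hz with h1 | h1 | h1
    · exact Or.inl ⟨h1, hzx⟩
    · right
      refine Finset.mem_insert_of_mem (Finset.mem_sdiff.2 ⟨h1, fun hh => ?_⟩)
      obtain ⟨-, c, hc, hzc⟩ := mem_nbF.1 hh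
      obtain ⟨d, hd, hzd⟩ := h.sO z h1
      exact hb.2 (h.crit.three hcf hb.1 hc hd hz.symm hzc hzd).1
    · exact absurd h1.1 hb.2
  · intro hh
    rcases Finset.mem_insert.1 hh with rfl | hh
    · exact h.ox _ ho h.xm
    · exact h.oS o ho (Finset.mem_sdiff.1 hh).1

theorem Two.pair [Fintype V] {G : SimpleGraph V} 
    {x y : V} {S : Finset V} {Cx Cy O : Set V} (h : Two G x y S Cx Cy O)
    (hx : 3 ≤ (nbF G S Cx).card) (hs : ∀ a ∈ Cx, a = x) :
    ∀ p ∈ S, ∀ q ∈ S, p ≠ q → G.Adj x p ∨ G.Adj x q := by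
  intro p hp q hq hpq
  by_contra hcon
  push Not at hcon
  have : nbF G S Cx ⊆ (S.erase p).erase q := by
    intro s hh
    obtain ⟨h1, a, ha, hsa⟩ := mem_nbF.1 hh
    rw [hs a ha] at hsa
    refine Finset.mem_erase.2 ⟨?_, Finset.mem_erase.2 ⟨?_, h1⟩⟩
    · rintro rfl; exact hcon.2 hsa.symm
    · rintro rfl; exact hcon.1 hsa.symm
  have h1 := Finset.card_le_card this
  rw [Finset.card_erase_of_mem (Finset.mem_erase.2 ⟨hpq.symm, hq⟩),
    Finset.card_erase_of_mem hp, h.card] at h1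
  omega

theorem Two.good [Fintype V] {G : SimpleGraph V} (hcf : ClawFree G) (hl : TLow G 3)
    (hc : TCrit G 3) {x y : V} {S : Finset V} {Cx Cy O : Set V} (h : Two G x y S Cx Cy O) :
    2 ≤ (S.filter (fun s => Gd G 3 s)).card := by
  by_contra hng
  have hx := h.three_nb hl hng
  have hy := h.symm.three_nb hl hng
  have sx := h.single hcf hl hy
  have sy := h.symm.single hcf hl hx
  refine hng (final_cfg G hcf hl hc (u := x) (v := y) (S := S) (D := O) ?_)
  refine ⟨h.adj, h.xS x h.xm, h.yS y h.ym, h.card, ?_, h.oS, ?_, ?_, h.sO, ?_,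
    h.pair hx sx, h.symm.pair hy sy⟩
  · intro a
    rcases h.cov a with h1 | h1 | h1 | h1
    · tauto
    · exact Or.inl (sx a h1)
    · exact Or.inr (Or.inl (sy a h1))
    · tauto
  · intro a ha hh
    exact (h.crit.ox_adj ha (Or.inl h.xm)).2 hh.symm
  · intro a ha hh
    exact (h.crit.ox_adj ha (Or.inr h.ym)).2 hh.symm
  · intro s hs
    rcases h.sC s hs with ⟨d, hd, hsd⟩ | ⟨d, hd, hsd⟩
    · rw [sx d hd] at hsd; exact Or.inl hsd.symm
    · rw [sy d hd] at hsd; exact Or.inr hsd.symm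

/-- the merging step: two or more other components. -/
theorem Str.merge [Fintype V] {G : SimpleGraph V} {m : ℕ} (hcf : ClawFree G) (hl : TLow G m)
    {x y : V} {S : Finset V}
    {Cx Cy : Set V} {n : ℕ} {C : Fin n → Set V} (h : Str G x y S Cx Cy C) (hn : 2 ≤ n)
    (i : Fin n) :
    m * n + 2 * (nbF G S (Cx ∪ Cy) ∩ nbF G S (C i)).card ≤ 2 * S.card := by
  set Z := nbF G S (Cx ∪ Cy) ∩ nbF G S (C i) with hZ
  have hZS : Z ⊆ S := fun s hs => (mem_nbF.1 (Finset.mem_inter.1 hs).1).1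
  have hZn : ∀ s ∈ Z, ∀ j, j ≠ i → ∀ a ∈ C j, ¬ G.Adj s a := by
    intro s hs j hj a ha hsa
    obtain ⟨h1, h2⟩ := Finset.mem_inter.1 hs
    obtain ⟨-, b, hb, hsb⟩ := mem_nbF.1 h1
    obtain ⟨-, c, hc, hsc⟩ := mem_nbF.1 h2
    have hna : ∀ k, ∀ a ∈ C k, a ≠ b ∧ ¬ G.Adj a b := by
      intro k a ha
      constructor
      · rintro rfl
        rcases hb with hb | hb
        · exact h.ix k _ ha hb
        · exact h.iy k _ ha hb
      · intro hab
        rcases h.cli k a ha b hab with h3 | h3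
        · rcases hb with hb | hb
          · exact h.ix k _ h3 hb
          · exact h.iy k _ h3 hb
        · rcases hb with hb | hb
          · exact h.xS _ hb h3
          · exact h.yS _ hb h3
    have hac : a ≠ c := by rintro rfl; exact hj (h.dis _ _ a ha hc)
    have := cf_use hcf hsb hsa hsc (hna j a ha).1.symm (hna i c hc).1.symm hac
      (fun hh => (hna j a ha).2 hh.symm) (fun hh => (hna i c hc).2 hh.symm)
    rcases h.cli j a ha c this with h3 | h3
    · exact hj (h.dis _ _ c h3 hc)
    · exact h.iS _ _ hc h3
  let F : Fin n → Set V := fun j => if j = i then Cx ∪ Cy ∪ C i ∪ ↑Z else C j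
  have hFi : F i = Cx ∪ Cy ∪ C i ∪ ↑Z := by simp [F]
  have hFj : ∀ j, j ≠ i → F j = C j := by intro j hj; simp [F, hj]
  have key := numComp_ge G F (↑(S \ Z) : Set V) ?_ ?_ ?_ ?_
  · rw [Fintype.card_fin] at key
    have h1 := hl (S \ Z) (by omega)
    have h2 := Finset.card_sdiff_add_card_eq_card hZS
    have h3 : m * n ≤ m * numComponents G ↑(S \ Z) := Nat.mul_le_mul_left _ key
    omega
  · intro j
    by_cases hj : j = i
    · subst hj; rw [hFi]; exact ⟨x, Or.inl (Or.inl (Or.inl h.xm))⟩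
    · rw [hFj j hj]; exact h.ne j
  · intro j a ha hh
    have hh' := Finset.mem_sdiff.1 (Finset.mem_coe.1 hh)
    by_cases hj : j = i
    · subst hj; rw [hFi] at ha
      rcases ha with ((ha | ha) | ha) | ha
      · exact h.xS a ha hh'.1
      · exact h.yS a ha hh'.1
      · exact h.iS _ a ha hh'.1
      · exact hh'.2 ha
    · rw [hFj j hj] at ha; exact h.iS _ a ha hh'.1
  · intro j a ha z hz
    have hS : z ∈ S → z ∈ F i ∨ z ∈ (↑(S \ Z) : Set V) := by
      intro hzS
      by_cases hzZ : z ∈ Z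
      · left; rw [hFi]; exact Or.inr hzZ
      · right; exact Finset.mem_coe.2 (Finset.mem_sdiff.2 ⟨hzS, hzZ⟩)
    by_cases hj : j = i
    · subst hj; rw [hFi] at ha
      by_cases hzS : z ∈ S
      · exact hS hzS
      left; rw [hFi]
      rcases ha with ((ha | ha) | ha) | ha
      · rcases h.clx a ha z hz with h1 | h1 | ⟨-, rfl⟩
        · exact Or.inl (Or.inl (Or.inl h1))
        · exact absurd h1 hzS
        · exact Or.inl (Or.inl (Or.inr h.ym))
      · rcases h.cly a ha z hz with h1 | h1 | ⟨-, rfl⟩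
        · exact Or.inl (Or.inl (Or.inr h1))
        · exact absurd h1 hzS
        · exact Or.inl (Or.inl (Or.inl h.xm))
      · rcases h.cli j a ha z hz with h1 | h1
        · exact Or.inl (Or.inr h1)
        · exact absurd h1 hzS
      · rcases h.cov z with h1 | h1 | h1 | ⟨k, h1⟩
        · exact absurd h1 hzS
        · exact Or.inl (Or.inl (Or.inl h1))
        · exact Or.inl (Or.inl (Or.inr h1))
        · by_cases hk : k = j
          · subst hk; exact Or.inl (Or.inr h1)
          · exact absurd hz (hZn a ha k hk z h1)
    · rw [hFj j hj] at ha ⊢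
      rcases h.cli j a ha z hz with h1 | h1
      · exact Or.inl h1
      · right
        refine Finset.mem_coe.2 (Finset.mem_sdiff.2 ⟨h1, fun hzZ => hZn z hzZ j hj a ha hz.symm⟩)
  · have hd : ∀ j, j ≠ i → ∀ a, a ∈ F i → a ∈ C j → False := by
      intro j hj a ha hb
      rw [hFi] at ha
      rcases ha with ((ha | ha) | ha) | ha
      · exact h.ix j a hb ha
      · exact h.iy j a hb ha
      · exact hj (h.dis j i a hb ha)
      · exact h.iS j a hb (hZS ha)
    intro j k a ha hb
    by_cases hj : j = i
    · by_cases hk : k = i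
      · rw [hj, hk]
      · rw [hFj k hk] at hb; rw [hj] at ha; exact (hd k hk a ha hb).elim
    · rw [hFj j hj] at ha
      by_cases hk : k = i
      · rw [hk] at hb; exact (hd j hj a hb ha).elim
      · rw [hFj k hk] at hb; exact h.dis j k a ha hb

theorem Str.main [Fintype V] {G : SimpleGraph V} {m : ℕ} (hcf : ClawFree G) (hl : TLow G m)
    (hc : TCrit G m) {x y : V} {S : Finset V}
    {Cx Cy : Set V} {n : ℕ} {C : Fin n → Set V} (h : Str G x y S Cx Cy C) (hn : 1 ≤ n)
    (hSn : 2 * S.card + 1 ≤ m * (n + 2)) (hN : (nbF G S (Cx ∪ Cy)).card + 2 = 2 * m) :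
    (∀ i, (nbF G S (C i)).card ≤ m + 1) ∧
    m ≤ ((nbF G S (Cx ∪ Cy)).filter (fun s => Gd G m s)).card + 1 := by
  set N0 := nbF G S (Cx ∪ Cy) with hN0
  have hcount : ∀ L : Finset V, L ⊆ S → (∀ s ∈ L, ∀ i, s ∈ N0 → s ∉ nbF G S (C i)) →
      (∀ s ∈ L, ∀ i j, s ∈ nbF G S (C i) → s ∈ nbF G S (C j) → i = j) →
      N0.card + ∑ i, (nbF G S (C i)).card + L.card ≤ 2 * S.card :=
    fun L h1 h2 h3 => h.count hcf L h1 h2 h3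
  have hge := fun i => h.cut_i hl i
  have hN0S : N0 ⊆ S := fun s hs => (mem_nbF.1 hs).1
  have hmn : m * (n + 2) = m * n + 2 * m := by ring
  have hsumge : ∀ i, (nbF G S (C i)).card + m * (n - 1) ≤ ∑ i, (nbF G S (C i)).card := by
    intro i
    rw [← Finset.add_sum_erase Finset.univ _ (Finset.mem_univ i)]
    have := Finset.card_nsmul_le_sum (Finset.univ.erase i) (fun i => (nbF G S (C i)).card) m
      (fun j _ => (hge j).1)
    rw [Finset.card_erase_of_mem (Finset.mem_univ i), Finset.card_univ, Fintype.card_fin,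
      smul_eq_mul, mul_comm] at this
    omega
  have hmn1 : m * n = m * (n - 1) + m := by
    obtain ⟨k, rfl⟩ : ∃ k, n = k + 1 := ⟨n - 1, by omega⟩
    simp; ring
  have hub : ∀ i, (nbF G S (C i)).card ≤ m + 1 := by
    intro i
    have h1 := hcount ∅ (by simp) (by simp) (by simp)
    have := hsumge i
    simp only [Finset.card_empty] at h1
    omega
  refine ⟨hub, ?_⟩
  by_cases hA : ∀ i, (nbF G S (C i)).card ≤ m
  · -- all equal to `m`
    have h1 := hcount (N0.filter (fun s => ∀ i, s ∉ nbF G S (C i)))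
      (fun s hs => hN0S (Finset.mem_filter.1 hs).1)
      (fun s hs i _ => (Finset.mem_filter.1 hs).2 i)
      (fun s hs i _ hi => absurd hi ((Finset.mem_filter.1 hs).2 i))
    have h2 := hsumge ⟨0, hn⟩
    have h3 := (hge ⟨0, hn⟩).1
    have h4 := Finset.card_filter_add_card_filter_not (s := N0)
      (fun s => ∀ i, s ∉ nbF G S (C i))
    have h5 : N0.filter (fun s => ¬ ∀ i, s ∉ nbF G S (C i)) ⊆ N0.filter (fun s => Gd G m s) := by
      intro s hs
      obtain ⟨hs1, hs2⟩ := Finset.mem_filter.1 hs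
      push Not at hs2
      obtain ⟨i, hi⟩ := hs2
      exact Finset.mem_filter.2 ⟨hs1, (hge i).2 (hA i) s hi⟩
    have h6 := Finset.card_le_card h5
    omega
  · push Not at hA
    obtain ⟨i, hi⟩ := hA
    have hi' := hub i
    have hs0 := hsumge i
    -- every vertex of `S` has two neighbouring components
    have hdeg : ∀ s ∈ S, ¬ ((∀ j, s ∈ N0 → s ∉ nbF G S (C j)) ∧
        (∀ j k, s ∈ nbF G S (C j) → s ∈ nbF G S (C k) → j = k)) := by
      intro s hs hh
      have h1 := hcount {s} (by simpa using hs)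
        (by intro a ha; rw [Finset.mem_singleton.1 ha]; exact hh.1)
        (by intro a ha; rw [Finset.mem_singleton.1 ha]; exact hh.2)
      rw [Finset.card_singleton] at h1
      omega
    have hother : ∀ j, j ≠ i → (nbF G S (C j)).card ≤ m := by
      intro j hj
      by_contra hcon
      have h1 := hcount ∅ (by simp) (by simp) (by simp)
      simp only [Finset.card_empty] at h1
      have hji : j ∈ Finset.univ.erase i := Finset.mem_erase.2 ⟨hj, Finset.mem_univ _⟩
      have h2 := Finset.add_sum_erase Finset.univ (fun i => (nbF G S (C i)).card)
        (Finset.mem_univ i)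
      have h3 := Finset.add_sum_erase _ (fun i => (nbF G S (C i)).card) hji
      have h4 := Finset.card_nsmul_le_sum ((Finset.univ.erase i).erase j)
        (fun i => (nbF G S (C i)).card) m (fun j _ => (hge j).1)
      rw [Finset.card_erase_of_mem hji, Finset.card_erase_of_mem (Finset.mem_univ i),
        Finset.card_univ, Fintype.card_fin, smul_eq_mul, mul_comm] at h4
      have h5 : 2 ≤ n := by
        have := i.2; have := j.2
        have : (i : ℕ) ≠ j := fun hh => hj (Fin.ext hh.symm)
        omega
      have h6 : m * (n - 1) = m * (n - 1 - 1) + m := by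
        obtain ⟨k, rfl⟩ : ∃ k, n = k + 2 := ⟨n - 2, by omega⟩
        simp; ring
      omega
    have hW : N0 \ nbF G S (C i) ⊆ N0.filter (fun s => Gd G m s) := by
      intro s hs
      obtain ⟨hs1, hs2⟩ := Finset.mem_sdiff.1 hs
      refine Finset.mem_filter.2 ⟨hs1, ?_⟩
      by_contra hng
      have hno : ∀ j, s ∉ nbF G S (C j) := by
        intro j hj
        by_cases hji : j = i
        · exact hs2 (hji ▸ hj)
        · exact hng ((hge j).2 (hother j hji) s hj)
      exact hdeg s (hN0S hs1) ⟨fun j _ => hno j, fun j k hj => absurd hj (hno j)⟩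
    have hWc := Finset.card_le_card hW
    have hsd := Finset.card_sdiff_add_card_inter N0 (nbF G S (C i))
    by_cases hn2 : 2 ≤ n
    · have := h.merge hcf hl hn2 i
      rw [← hN0] at this
      omega
    · have hn1 : n = 1 := by omega
      subst hn1
      have hi0 : ∀ j, j = i := fun j => Subsingleton.elim _ _
      have hboth : ∀ s ∈ S, s ∈ N0 ∧ s ∈ nbF G S (C i) := by
        intro s hs
        have := hdeg s hs
        by_contra hcon
        apply this
        refine ⟨fun j h1 h2 => hcon ⟨h1, hi0 j ▸ h2⟩, fun j k _ _ => Subsingleton.elim _ _⟩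
      have e1 : N0 = S := Finset.Subset.antisymm hN0S (fun s hs => (hboth s hs).1)
      have e2 : nbF G S (C i) = S :=
        Finset.Subset.antisymm (fun s hs => (mem_nbF.1 hs).1) (fun s hs => (hboth s hs).2)
      rw [e1] at hN
      rw [e2] at hi hi'
      have hm3 : m = 3 := by omega
      subst hm3
      have htwo : Two G x y S Cx Cy (C i) := by
        refine ⟨h.adj, h.xm, h.ym, h.xS, h.yS, h.dxy, h.ne i, h.iS i, h.ix i, h.iy i, ?_, h.clx,
          h.cly, h.cli i, fun s hs => (mem_nbF.1 (hboth s hs).2).2, ?_, by omega⟩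
        · intro a
          rcases h.cov a with h1 | h1 | h1 | ⟨j, h1⟩
          · tauto
          · tauto
          · tauto
          · rw [hi0 j] at h1; tauto
        · intro s hs
          obtain ⟨-, a, ha, hsa⟩ := mem_nbF.1 (hboth s hs).1
          rcases ha with ha | ha
          · exact Or.inl ⟨a, ha, hsa⟩
          · exact Or.inr ⟨a, ha, hsa⟩
      have := htwo.good hcf hl hc
      rw [e1]; omega

theorem nbrs_eq (G : SimpleGraph V) (S : Finset V) (A : Set V) [Fintype V]
    (hA : ∀ a ∈ A, a ∉ S) : nbrsIn G ↑S A = ↑(nbF G S A) := by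
  ext s
  rw [Finset.mem_coe, mem_nbF]
  constructor
  · rintro ⟨h1, h2⟩; exact ⟨h1.1, h2⟩
  · rintro ⟨h1, h2⟩; exact ⟨⟨h1, fun h => hA s h h1⟩, h2⟩

end Aux

/-- Let `G` be minimally `t`-tough and claw-free, `e = uv` a non-bridge edge
with `D(e) ≠ ∅`.  If `|N_{S(e)}(C(e))| = 4t − 2`, then every component `C_j`
of `G − S(e)` other than `C(e)` satisfies `|N_{S(e)}(C_j)| ≤ 2t + 1`, and at
least `2t − 1` vertices of `N_{S(e)}(C(e))` lie in some `2t`-vertex-cut. -/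
theorem min_good_cut_neighbors_4t_sub_two [Fintype V] (G : SimpleGraph V)
    (t : ℚ) (hmt : MinimallyTough G t) (hcf : ClawFree G)
    (u v : V) (huv : G.Adj u v) (hnb : ¬ IsBridgeIn G (∅ : Set V) u v)
    (S : Finset V) (hS : IsMinGoodCut G t u v S)
    (hD : (Dset G ↑S u).Nonempty)
    (hN : ((nbrsIn G ↑S (compOf G ↑S u)).ncard : ℚ) = 4 * t - 2) :
    (∀ w ∈ Dset G ↑S u,
        ((nbrsIn G ↑S (compOf G ↑S w)).ncard : ℚ) ≤ 2 * t + 1) ∧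
    ∃ W : Set V, W ⊆ nbrsIn G ↑S (compOf G ↑S u) ∧
      (2 * t - 1 ≤ (W.ncard : ℚ)) ∧ ∀ x ∈ W, InTwoTCut G t x := by

  classical
  obtain ⟨m, hm⟩ := exists_m G t hmt.1 hcf
  obtain ⟨⟨hg1, hg2, huS, hvS, -, hlt⟩, -⟩ := hS
  have ht0 : 0 < t := by
    have h0 : (0 : ℚ) ≤ t := by
      have : (0 : ℚ) ≤ m := Nat.cast_nonneg m
      linarith
    rcases h0.lt_or_eq with h1 | h1
    · exact h1
    · exfalso
      rw [← h1, div_zero] at hg1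
      have h3 : numComponents G ↑S = 0 := by
        have : (numComponents G ↑S : ℚ) = 0 := le_antisymm hg1 (Nat.cast_nonneg _)
        exact_mod_cast this
      have := numComp_ge G (ι := Unit) (fun _ => ((↑S : Set V))ᶜ) ↑S (fun _ => ⟨u, huS⟩)
        (fun _ a ha => ha) (fun _ a ha z hz => (em (z ∈ (↑S : Set V))).symm)
        (fun _ _ _ _ _ => rfl)
      simp at this
      omega
  have hl : TLow G m := by
    intro T hT
    have h1 := hmt.1.1 T hT
    have h2 : (0 : ℚ) < numComponents G ↑T := by exact_mod_cast (by omega : 0 < numComponents G ↑T)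
    rw [le_div_iff₀ h2] at h1
    have h3 : (m : ℚ) * numComponents G ↑T ≤ 2 * T.card := by rw [hm]; linarith
    exact_mod_cast h3
  have hc : TCrit G m := by
    intro x y hxy
    obtain ⟨T, hT, h1⟩ := hmt.2 x y hxy
    refine ⟨T, hT, ?_⟩
    have h2 : (0 : ℚ) < numComponents (G.deleteEdges {s(x, y)}) ↑T := by
      exact_mod_cast (by omega : 0 < numComponents (G.deleteEdges {s(x, y)}) ↑T)
    rw [div_lt_iff₀ h2] at h1
    have h3 : 2 * (T.card : ℚ) < (m : ℚ) * numComponents (G.deleteEdges {s(x, y)}) ↑T := by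
      rw [hm]; linarith
    exact_mod_cast h3
  obtain ⟨n, Cu, Cv, C, h, hn⟩ := exists_str G u v S huv hlt
  rw [← hn, div_lt_iff₀ ht0] at hg2
  have hSn : 2 * S.card + 1 ≤ m * (n + 2) := by
    have h3 : 2 * (S.card : ℚ) < (m : ℚ) * ((n + 2 : ℕ) : ℚ) := by rw [hm]; linarith
    have : 2 * S.card < m * (n + 2) := by exact_mod_cast h3
    omega
  have hin : ∀ w ∈ Dset G ↑S u, ∃ i, w ∈ C i := by
    intro w hw
    have h1 : w ∉ Cu ∪ Cv := by rw [← h.compx]; exact hw.2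
    rcases h.cov w with h2 | h2 | h2 | h2
    · exact absurd h2 hw.1
    · exact absurd (Or.inl h2) h1
    · exact absurd (Or.inr h2) h1
    · exact h2
  have hn1 : 1 ≤ n := by
    obtain ⟨w, hw⟩ := hD
    obtain ⟨i, -⟩ := hin w hw
    have := i.2
    omega
  have e0 : nbrsIn G ↑S (compOf G ↑S u) = ↑(nbF G S (Cu ∪ Cv)) := by
    rw [h.compx]
    apply nbrs_eq
    rintro a (ha | ha)
    · exact h.xS a ha
    · exact h.yS a ha
  rw [e0, Set.ncard_coe_finset] at hN
  have hN' : (nbF G S (Cu ∪ Cv)).card + 2 = 2 * m := by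
    have : ((nbF G S (Cu ∪ Cv)).card : ℚ) + 2 = 2 * m := by rw [hm, hN]; ring
    exact_mod_cast this
  obtain ⟨k1, k2⟩ := h.main hcf hl hc hn1 hSn hN'
  refine ⟨?_, ↑((nbF G S (Cu ∪ Cv)).filter (fun s => Gd G m s)), ?_, ?_, ?_⟩
  · intro w hw
    obtain ⟨i, hi⟩ := hin w hw
    rw [h.compi i w hi, nbrs_eq G S (C i) (h.iS i), Set.ncard_coe_finset, ← hm]
    exact_mod_cast k1 i
  · rw [e0]
    exact Finset.coe_subset.2 (Finset.filter_subset _ _)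
  · rw [Set.ncard_coe_finset, ← hm]
    have : (m : ℚ) ≤ ((nbF G S (Cu ∪ Cv)).filter (fun s => Gd G m s)).card + 1 := by
      exact_mod_cast k2
    linarith
  · intro x hx
    obtain ⟨T, h1, h2, h3⟩ := (Finset.mem_filter.1 (Finset.mem_coe.1 hx)).2
    exact ⟨T, by rw [h1, hm], h2, h3⟩
end

section
/- Let G be a minimally t-tough, claw-free graph and e = uv a non-bridge edge of G with D(e) ≠ ∅, and set S₁ = N_{S(e)}(C(e)) − N_{S(e)}(D(e)). Assume the component C_u(e) of (G−e)−S(e) containing u is not {u} and the component C_v(e) containing v is not {v}. If there exists a vertex w ∈ S(e) with N_{C(e)}(w) = {u, v}, then each of u and v is contained in a 2t-vertex-cut of G; otherwise, every vertex of {u} ∪ S₁ is contained in a 2t-vertex-cut of G, or every vertex of {v} ∪ S₁ is contained in a 2t-vertex-cut of G. -/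
open SimpleGraph

variable {V : Type*}

theorem card_cc_le {α β : Type*} [Finite α] (H₁ : SimpleGraph α) (H₂ : SimpleGraph β)
    (f : α → β) (hf : ∀ a b, H₁.Adj a b → H₂.Reachable (f a) (f b))
    (hs : ∀ b, ∃ a, H₂.Reachable (f a) b) :
    Nat.card H₂.ConnectedComponent ≤ Nat.card H₁.ConnectedComponent := by
  have hr : ∀ a b, H₁.Reachable a b → H₂.Reachable (f a) (f b) := by
    rintro a b ⟨p⟩
    induction p with
    | nil => exact Reachable.refl _
    | cons h p ih => exact (hf _ _ h).trans ih
  let F : H₁.ConnectedComponent → H₂.ConnectedComponent :=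
    fun c => H₂.connectedComponentMk (f c.out)
  have hfin : Finite H₁.ConnectedComponent :=
    Finite.of_surjective H₁.connectedComponentMk Quot.mk_surjective
  refine Nat.card_le_card_of_surjective F ?_
  intro c
  induction c using ConnectedComponent.ind with
  | h b =>
    obtain ⟨a, ha⟩ := hs b
    refine ⟨H₁.connectedComponentMk a, ?_⟩
    refine ConnectedComponent.sound ?_
    refine Reachable.trans (hr _ _ ?_) ha
    exact ConnectedComponent.exact (Quot.out_eq (H₁.connectedComponentMk a))

theorem closed_of_reachable (G : SimpleGraph V) (T A : Set V)
    (hcl : ∀ y ∈ A, ∀ z, z ∉ T → G.Adj y z → z ∈ A)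
    (a b : ↥(Tᶜ)) (h : (G.induce Tᶜ).Reachable a b) (ha : (a : V) ∈ A) : (b : V) ∈ A := by
  obtain ⟨p⟩ := h
  induction p with
  | nil => exact ha
  | @cons a b c h p ih => exact ih (hcl _ ha _ b.2 h)

theorem two_le_numComponents [Fintype V] (G : SimpleGraph V) (T A : Set V)
    (hcl : ∀ y ∈ A, ∀ z, z ∉ T → G.Adj y z → z ∈ A)
    (a b : V) (ha : a ∈ A) (haT : a ∉ T) (hb : b ∉ A) (hbT : b ∉ T) :
    2 ≤ numComponents G T := by
  have hfin : Finite (G.induce Tᶜ).ConnectedComponent :=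
    Finite.of_surjective (G.induce Tᶜ).connectedComponentMk Quot.mk_surjective
  have : Nontrivial (G.induce Tᶜ).ConnectedComponent := by
    refine ⟨(G.induce Tᶜ).connectedComponentMk ⟨a, haT⟩,
      (G.induce Tᶜ).connectedComponentMk ⟨b, hbT⟩, fun h => hb ?_⟩
    exact closed_of_reachable G T A hcl _ _ (ConnectedComponent.exact h) ha
  exact Finite.one_lt_card

theorem two_t_le [Fintype V] (G : SimpleGraph V) (t : ℚ) (ht : HasToughness G t)
    (T : Finset V) (h : 2 ≤ numComponents G ↑T) (ht0 : 0 < t) : 2 * t ≤ T.card := by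
  have h1 := ht.1 T h
  have h2 : (2 : ℚ) ≤ numComponents G ↑T := by exact_mod_cast h
  rw [le_div_iff₀ (by linarith)] at h1
  nlinarith

open Classical in
/-- The vertices of the finite set `S` adjacent to a vertex of `A`. -/
noncomputable def nbS (G : SimpleGraph V) (S : Finset V) (A : Set V) : Finset V :=
  S.filter (fun x => ∃ y ∈ A, G.Adj x y)

theorem mem_nbS (G : SimpleGraph V) (S : Finset V) (A : Set V) (x : V) :
    x ∈ nbS G S A ↔ x ∈ S ∧ ∃ y ∈ A, G.Adj x y := by
  simp [nbS]

open Classical in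
/-- Number of parts `P i` to which `x` is adjacent. -/
noncomputable def cnt {ι : Type*} [Fintype ι] (G : SimpleGraph V) (P : ι → Set V) (x : V) : ℕ :=
  (Finset.univ.filter (fun i => ∃ y ∈ P i, G.Adj x y)).card

theorem sum_nbS {ι : Type*} [Fintype ι] (G : SimpleGraph V) (S : Finset V) (P : ι → Set V) :
    ∑ i, (nbS G S (P i)).card = ∑ x ∈ S, cnt G P x := by
  classical
  have := Finset.sum_card_bipartiteAbove_eq_sum_card_bipartiteBelow
    (s := S) (t := (Finset.univ : Finset ι)) (fun x i => ∃ y ∈ P i, G.Adj x y)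
  simp only [Finset.bipartiteAbove, Finset.bipartiteBelow] at this
  simp only [nbS, cnt]
  convert this.symm

theorem cnt_le_two {ι : Type*} [Fintype ι] (G : SimpleGraph V) (hcf : ClawFree G)
    (P : ι → Set V)
    (hP : ∀ i j, i ≠ j → ∀ a ∈ P i, ∀ b ∈ P j, a ≠ b ∧ ¬ G.Adj a b) (x : V) :
    cnt G P x ≤ 2 := by
  classical
  by_contra h
  push Not at h
  unfold cnt at h
  obtain ⟨i, j, k, hi, hj, hk, hij, hik, hjk⟩ := Finset.two_lt_card_iff.mp h
  simp only [Finset.mem_filter, Finset.mem_univ, true_and] at hi hj hk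
  obtain ⟨a, ha, hxa⟩ := hi
  obtain ⟨b, hb, hxb⟩ := hj
  obtain ⟨c, hc, hxc⟩ := hk
  obtain ⟨n1, m1⟩ := hP i j hij a ha b hb
  obtain ⟨n2, m2⟩ := hP i k hik a ha c hc
  obtain ⟨n3, m3⟩ := hP j k hjk b hb c hc
  exact hcf ⟨x, a, b, c, n1, n2, n3, hxa, hxb, hxc, m1, m2, m3⟩

theorem cnt_le_one {ι : Type*} [Fintype ι] (G : SimpleGraph V) (P : ι → Set V) (x : V)
    (h : ∀ i j, (∃ y ∈ P i, G.Adj x y) → (∃ y ∈ P j, G.Adj x y) → i = j) :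
    cnt G P x ≤ 1 := by
  classical
  unfold cnt
  rw [Finset.card_le_one]
  intro i hi j hj
  simp only [Finset.mem_filter, Finset.mem_univ, true_and] at hi hj
  exact h i j hi hj

theorem two_t_int [Fintype V] (G : SimpleGraph V) (t : ℚ) (ht : HasToughness G t)
    (hcf : ClawFree G) (ht0 : 0 < t) : ∃ m : ℕ, (m : ℚ) = 2 * t := by
  classical
  obtain ⟨T, hT, hTt⟩ := ht.2
  have hfin : Finite (G.induce (↑T : Set V)ᶜ).ConnectedComponent :=
    Finite.of_surjective (G.induce (↑T : Set V)ᶜ).connectedComponentMk Quot.mk_surjective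
  have hft : Fintype (G.induce (↑T : Set V)ᶜ).ConnectedComponent := Fintype.ofFinite _
  let P : (G.induce (↑T : Set V)ᶜ).ConnectedComponent → Set V := fun i =>
    {y | ∃ hy : y ∈ (↑T : Set V)ᶜ, (G.induce (↑T : Set V)ᶜ).connectedComponentMk ⟨y, hy⟩ = i}
  have hadj : ∀ i, ∀ y ∈ P i, ∀ z, z ∉ (↑T : Set V) → G.Adj y z → z ∈ P i := by
    rintro i y ⟨hy, rfl⟩ z hz h
    refine ⟨hz, ConnectedComponent.sound (Adj.reachable ?_)⟩
    exact h.symm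
  have hP : ∀ i j, i ≠ j → ∀ a ∈ P i, ∀ b ∈ P j, a ≠ b ∧ ¬ G.Adj a b := by
    intro i j hij a ha b hb
    constructor
    · rintro rfl
      obtain ⟨_, h1⟩ := ha
      obtain ⟨_, h2⟩ := hb
      exact hij (h1.symm.trans h2)
    · intro h
      obtain ⟨hbT, h2⟩ := hb
      obtain ⟨_, h1⟩ := hadj i a ha b hbT h
      exact hij (h1.symm.trans h2)
  have hlow : ∀ i, 2 * t ≤ ((nbS G T (P i)).card : ℚ) := by
    intro i
    obtain ⟨⟨a, haT⟩, ha⟩ := i.exists_rep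
    have : Nontrivial (G.induce (↑T : Set V)ᶜ).ConnectedComponent :=
      Finite.one_lt_card_iff_nontrivial.mp hT
    obtain ⟨j, hj⟩ := exists_ne i
    obtain ⟨⟨b, hbT⟩, hb⟩ := j.exists_rep
    refine two_t_le G t ht _ (two_le_numComponents G _ (P i) ?_ a b ⟨haT, ha⟩ ?_ ?_ ?_) ht0
    · intro y hy z hz h
      by_cases hzT : z ∈ T
      · exact absurd (Finset.mem_coe.mpr ((mem_nbS _ _ _ _).mpr ⟨hzT, y, hy, h.symm⟩)) hz
      · exact hadj i y hy z hzT h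
    · intro h; exact haT ((mem_nbS _ _ _ _).mp (Finset.mem_coe.mp h)).1
    · rintro ⟨_, h⟩; exact hj (hb.symm.trans h)
    · intro h; exact hbT ((mem_nbS _ _ _ _).mp (Finset.mem_coe.mp h)).1
  have hup : ∑ i, ((nbS G T (P i)).card : ℚ) ≤ 2 * T.card := by
    have h1 : ∑ x ∈ T, cnt G P x ≤ ∑ x ∈ T, 2 :=
      Finset.sum_le_sum (fun x _ => cnt_le_two G hcf P hP x)
    rw [← sum_nbS, Finset.sum_const, smul_eq_mul] at h1
    have : ((∑ i, (nbS G T (P i)).card : ℕ) : ℚ) ≤ ((T.card * 2 : ℕ) : ℚ) := by exact_mod_cast h1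
    push_cast at this
    linarith
  by_contra hno
  push Not at hno
  have hne : Nonempty (G.induce (↑T : Set V)ᶜ).ConnectedComponent := by
    have : Nontrivial (G.induce (↑T : Set V)ᶜ).ConnectedComponent :=
      Finite.one_lt_card_iff_nontrivial.mp hT
    infer_instance
  have hlt : ∑ i : (G.induce (↑T : Set V)ᶜ).ConnectedComponent, (2 * t)
      < ∑ i, ((nbS G T (P i)).card : ℚ) := by
    refine Finset.sum_lt_sum_of_nonempty Finset.univ_nonempty ?_
    intro i _
    exact lt_of_le_of_ne (hlow i) (hno _).symm
  rw [Finset.sum_const, Finset.card_univ, nsmul_eq_mul, ← Nat.card_eq_fintype_card] at hlt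
  have hw : (2 : ℚ) ≤ numComponents G ↑T := by exact_mod_cast hT
  rw [eq_div_iff (by linarith)] at hTt
  change (numComponents G ↑T : ℚ) * (2 * t) < _ at hlt
  linarith

/-- Arithmetic core. -/
theorem core_count {ι : Type*} [Fintype ι] (G : SimpleGraph V) (hcf : ClawFree G)
    (S : Finset V) (P : ι → Set V)
    (hP : ∀ i j, i ≠ j → ∀ a ∈ P i, ∀ b ∈ P j, a ≠ b ∧ ¬ G.Adj a b)
    (m : ℕ) (iu iv : ι) (huv : iu ≠ iv)
    (hlow : ∀ i, i ≠ iu → i ≠ iv → m ≤ (nbS G S (P i)).card)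
    (hu : m ≤ (nbS G S (P iu)).card + 1) (hv : m ≤ (nbS G S (P iv)).card + 1)
    (hlt : 2 * S.card < m * Fintype.card ι) :
    ((nbS G S (P iu)).card + 1 = m ∨ (nbS G S (P iv)).card + 1 = m) ∧
    (∀ x ∈ S, cnt G P x ≤ 1 →
      (nbS G S (P iu)).card + 1 = m ∧ (nbS G S (P iv)).card + 1 = m ∧
      ∀ y ∈ S, cnt G P y ≤ 1 → y = x) := by
  classical
  have h2 : ∀ x, cnt G P x ≤ 2 := cnt_le_two G hcf P hP
  have hsum := sum_nbS G S P
  have hlow' : m * Fintype.card ι + (nbS G S (P iu)).card + (nbS G S (P iv)).card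
      ≤ (∑ i, (nbS G S (P i)).card) + 2 * m := by
    rw [← Finset.add_sum_erase _ _ (Finset.mem_univ iu),
      ← Finset.add_sum_erase (Finset.univ.erase iu) _
        (Finset.mem_erase.mpr ⟨huv.symm, Finset.mem_univ iv⟩)]
    have h3 : ∑ _i ∈ (Finset.univ.erase iu).erase iv, m
        ≤ ∑ i ∈ (Finset.univ.erase iu).erase iv, (nbS G S (P i)).card := by
      refine Finset.sum_le_sum ?_
      intro i hi
      simp only [Finset.mem_erase, Finset.mem_univ, and_true] at hi
      exact hlow i hi.2 hi.1
    have h4 : ((Finset.univ.erase iu).erase iv).card + 2 = Fintype.card ι := by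
      rw [← Finset.card_univ, ← Finset.card_erase_add_one (Finset.mem_univ iu),
        ← Finset.card_erase_add_one
        (Finset.mem_erase.mpr ⟨huv.symm, Finset.mem_univ iv⟩)]
    rw [Finset.sum_const, smul_eq_mul] at h3
    rw [← h4]
    nlinarith
  have hup : ∑ x ∈ S, cnt G P x ≤ S.card * 2 := by
    have h1 : ∑ x ∈ S, cnt G P x ≤ ∑ x ∈ S, 2 := Finset.sum_le_sum (fun x _ => h2 x)
    rwa [Finset.sum_const, smul_eq_mul] at h1
  constructor
  · omega
  · intro x hx hx1
    have e1 := Finset.add_sum_erase S (cnt G P) hx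
    have e2 : ∑ y ∈ S.erase x, cnt G P y ≤ (S.erase x).card * 2 := by
      have h1 : ∑ x ∈ S.erase x, cnt G P x ≤ ∑ x ∈ S.erase x, 2 :=
        Finset.sum_le_sum (fun x _ => h2 x)
      rwa [Finset.sum_const, smul_eq_mul] at h1
    have e3 := Finset.card_erase_add_one hx
    refine ⟨by omega, by omega, ?_⟩
    intro y hy hy1
    by_contra hne
    have hy' : y ∈ S.erase x := Finset.mem_erase.mpr ⟨hne, hy⟩
    have f1 := Finset.add_sum_erase (S.erase x) (cnt G P) hy'
    have f2 : ∑ y ∈ (S.erase x).erase y, cnt G P y ≤ ((S.erase x).erase y).card * 2 := by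
      have h1 : ∑ z ∈ (S.erase x).erase y, cnt G P z ≤ ∑ z ∈ (S.erase x).erase y, 2 :=
        Finset.sum_le_sum (fun x _ => h2 x)
      rwa [Finset.sum_const, smul_eq_mul] at h1
    have f3 := Finset.card_erase_add_one hy'
    omega

/-- Adding back a vertex having a neighbour outside `S` does not create components. -/
theorem numComponents_erase_le [Fintype V] (H : SimpleGraph V) (S S' : Set V) (x : V)
    (hSS : ∀ y, y ∉ S' ↔ (y ∉ S ∨ y = x)) (y : V) (hy : y ∉ S) (hxy : H.Adj x y) :
    numComponents H S' ≤ numComponents H S := by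
  refine card_cc_le _ _ (fun a : ↥(Sᶜ) => (⟨a.1, (hSS _).mpr (Or.inl a.2)⟩ : ↥(S'ᶜ))) ?_ ?_
  · intro a b h
    exact Adj.reachable h
  · rintro ⟨b, hb⟩
    rcases (hSS b).mp hb with h | h
    · exact ⟨⟨b, h⟩, Reachable.refl _⟩
    · refine ⟨⟨y, hy⟩, Adj.reachable ?_⟩
      subst h
      exact hxy.symm

/-- Adding back a vertex whose neighbours lie in one component does not merge components. -/
theorem numComponents_le_erase [Fintype V] (H : SimpleGraph V) (S S' : Set V) (x : V)
    (hxS : x ∈ S) (hSS : ∀ y, y ∉ S' ↔ (y ∉ S ∨ y = x)) (k : ↥(Sᶜ))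
    (hk : ∀ y : ↥(Sᶜ), H.Adj x y → (H.induce Sᶜ).Reachable k y) :
    numComponents H S ≤ numComponents H S' := by
  classical
  refine card_cc_le _ _ (fun a : ↥(S'ᶜ) => if h : a.1 ∉ S then (⟨a.1, h⟩ : ↥(Sᶜ)) else k) ?_ ?_
  · rintro ⟨a, ha⟩ ⟨b, hb⟩ h
    have hab : H.Adj a b := h
    by_cases h1 : a ∉ S <;> by_cases h2 : b ∉ S
    · simp only [h1, h2, not_false_eq_true, dif_pos]
      exact Adj.reachable hab
    · have hbx : b = x := ((hSS b).mp hb).resolve_left h2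
      subst hbx
      simp only [h1, h2, not_false_eq_true, dif_pos, dif_neg]
      exact (hk ⟨a, h1⟩ hab.symm).symm
    · have hax : a = x := ((hSS a).mp ha).resolve_left h1
      subst hax
      simp only [h1, h2, not_false_eq_true, dif_pos, dif_neg]
      exact hk ⟨b, h2⟩ hab
    · have hax : a = x := ((hSS a).mp ha).resolve_left h1
      have hbx : b = x := ((hSS b).mp hb).resolve_left h2
      subst hax
      exact absurd (hbx ▸ hab) (H.irrefl)
  · rintro ⟨b, hb⟩
    refine ⟨⟨b, (hSS b).mpr (Or.inl hb)⟩, ?_⟩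
    have hb' : b ∉ S := hb
    simp only [hb', not_false_eq_true, dif_pos]
    exact Reachable.refl _

/-- Let `G` be minimally `t`-tough and claw-free, `e = uv` a non-bridge edge
with `D(e) ≠ ∅`, and `S₁ = N_{S(e)}(C(e)) − N_{S(e)}(D(e))`.  Assume
`C_u(e) ≠ {u}` and `C_v(e) ≠ {v}` (components of `(G−e) − S(e)`).  If some
`w ∈ S(e)` has `N_{C(e)}(w) = {u, v}`, then each of `u`, `v` lies in a
`2t`-vertex-cut of `G`; otherwise every vertex of `{u} ∪ S₁` lies in a
`2t`-vertex-cut of `G`, or every vertex of `{v} ∪ S₁` does. -/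
theorem min_good_cut_both_components_nontrivial [Fintype V] (G : SimpleGraph V)
    (t : ℚ) (hmt : MinimallyTough G t) (hcf : ClawFree G)
    (u v : V) (huv : G.Adj u v) (hnb : ¬ IsBridgeIn G (∅ : Set V) u v)
    (S : Finset V) (hS : IsMinGoodCut G t u v S)
    (hD : (Dset G ↑S u).Nonempty)
    (S₁ : Set V)
    (hS₁ : S₁ = nbrsIn G ↑S (compOf G ↑S u) \ nbrsIn G ↑S (Dset G ↑S u))
    (hCu : compOf (G.deleteEdges {s(u, v)}) ↑S u ≠ {u})
    (hCv : compOf (G.deleteEdges {s(u, v)}) ↑S v ≠ {v}) :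
    ((∃ w ∈ S, nbrsIn G (compOf G ↑S u) {w} = {u, v}) →
        InTwoTCut G t u ∧ InTwoTCut G t v) ∧
    ((¬ ∃ w ∈ S, nbrsIn G (compOf G ↑S u) {w} = {u, v}) →
        (∀ x ∈ ({u} : Set V) ∪ S₁, InTwoTCut G t x) ∨
        (∀ x ∈ ({v} : Set V) ∪ S₁, InTwoTCut G t x)) := by
  classical
  have hT := hmt.1
  have ht0 : 0 < t := by
    obtain ⟨T, _, h⟩ := hmt.2 u v huv
    refine lt_of_le_of_lt ?_ h
    positivity
  obtain ⟨m, hm⟩ := two_t_int G t hT hcf ht0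
  obtain ⟨⟨hg1, hg2, huS, hvS, -, hbr⟩, hmin⟩ := hS
  set H := G.deleteEdges {s(u, v)} with hH
  have hHadj : ∀ a b, H.Adj a b ↔ G.Adj a b ∧ ¬ (a = u ∧ b = v ∨ a = v ∧ b = u) := by
    intro a b
    simp [hH, deleteEdges_adj, Sym2.eq_iff]
  set K := H.induce (↑S : Set V)ᶜ with hK
  have huS' : u ∈ (↑S : Set V)ᶜ := huS
  have hvS' : v ∈ (↑S : Set V)ᶜ := hvS
  -- `u` and `v` are separated in `(G - e) - S`
  have hsep : ¬ K.Reachable ⟨u, huS'⟩ ⟨v, hvS'⟩ := by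
    intro hr
    refine absurd hbr (not_lt.mpr ?_)
    refine card_cc_le (G.induce (↑S : Set V)ᶜ) K id ?_ (fun b => ⟨b, Reachable.refl _⟩)
    rintro ⟨a, ha⟩ ⟨b, hb⟩ h
    have hab : G.Adj a b := h
    by_cases hc : a = u ∧ b = v ∨ a = v ∧ b = u
    · rcases hc with ⟨rfl, rfl⟩ | ⟨rfl, rfl⟩
      · exact hr
      · exact hr.symm
    · exact Adj.reachable ((hHadj a b).mpr ⟨hab, hc⟩)
  have hfin : Finite K.ConnectedComponent :=
    Finite.of_surjective K.connectedComponentMk Quot.mk_surjective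
  have hft : Fintype K.ConnectedComponent := Fintype.ofFinite _
  set iu := K.connectedComponentMk ⟨u, huS'⟩ with hiu
  set iv := K.connectedComponentMk ⟨v, hvS'⟩ with hiv
  have hiuv : iu ≠ iv := fun h => hsep (ConnectedComponent.exact h)
  let Q : K.ConnectedComponent → Set V := fun i =>
    {y | ∃ hy : y ∈ (↑S : Set V)ᶜ, K.connectedComponentMk ⟨y, hy⟩ = i}
  let P : K.ConnectedComponent → Set V := fun i => {y | y ≠ u ∧ y ≠ v ∧ y ∈ Q i}
  have hQuniq : ∀ i j y, y ∈ Q i → y ∈ Q j → i = j := by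
    rintro i j y ⟨_, h1⟩ ⟨_, h2⟩
    exact h1.symm.trans h2
  have huQ : u ∈ Q iu := ⟨huS', rfl⟩
  have hvQ : v ∈ Q iv := ⟨hvS', rfl⟩
  have hQadj : ∀ i, ∀ y ∈ Q i, ∀ z, z ∉ (↑S : Set V) → H.Adj y z → z ∈ Q i := by
    rintro i y ⟨hy, rfl⟩ z hz h
    refine ⟨hz, ConnectedComponent.sound (Adj.reachable ?_)⟩
    exact h.symm
  -- adjacency in `G` from a vertex distinct from `u`, `v`
  have hPadj : ∀ i, ∀ y ∈ P i, ∀ z, z ∉ (↑S : Set V) → G.Adj y z → z ∈ Q i := by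
    rintro i y ⟨hyu, hyv, hy⟩ z hz h
    refine hQadj i y hy z hz ((hHadj y z).mpr ⟨h, ?_⟩)
    rintro (⟨h1, _⟩ | ⟨h1, _⟩)
    · exact hyu h1
    · exact hyv h1
  have hP : ∀ i j, i ≠ j → ∀ a ∈ P i, ∀ b ∈ P j, a ≠ b ∧ ¬ G.Adj a b := by
    intro i j hij a ha b hb
    refine ⟨?_, fun h => ?_⟩
    · rintro rfl
      exact hij (hQuniq i j a ha.2.2 hb.2.2)
    · have hbS : b ∉ (↑S : Set V) := hb.2.2.1
      exact hij (hQuniq i j b (hPadj i a ha b hbS h) hb.2.2)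
  have hPS : ∀ i y, y ∈ P i → y ∉ S := by
    rintro i y ⟨_, _, hy, _⟩
    exact hy
  -- the cut around `P i`
  have hcutlow : ∀ i, i ≠ iu → i ≠ iv → m ≤ (nbS G S (P i)).card := by
    intro i hi1 hi2
    obtain ⟨⟨a, haS⟩, ha⟩ := i.exists_rep
    have haQ : a ∈ Q i := ⟨haS, ha⟩
    have haP : a ∈ P i := by
      refine ⟨?_, ?_, haQ⟩
      · rintro rfl; exact hi1 (hQuniq _ _ _ haQ huQ)
      · rintro rfl; exact hi2 (hQuniq _ _ _ haQ hvQ)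
    have h2 : 2 ≤ numComponents G ↑(nbS G S (P i)) := by
      refine two_le_numComponents G _ (P i) ?_ a u haP ?_ (fun h => h.1 rfl) ?_
      · intro y hy z hz h
        by_cases hzS : z ∈ S
        · exact absurd (Finset.mem_coe.mpr ((mem_nbS _ _ _ _).mpr ⟨hzS, y, hy, h.symm⟩)) hz
        · have hzQ := hPadj i y hy z hzS h
          refine ⟨?_, ?_, hzQ⟩
          · rintro rfl; exact hi1 (hQuniq _ _ _ hzQ huQ)
          · rintro rfl; exact hi2 (hQuniq _ _ _ hzQ hvQ)
      · intro h; exact haS ((mem_nbS _ _ _ _).mp (Finset.mem_coe.mp h)).1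
      · intro h; exact huS ((mem_nbS _ _ _ _).mp (Finset.mem_coe.mp h)).1
    have h3 := two_t_le G t hT _ h2 ht0
    rw [← hm] at h3
    exact_mod_cast h3
  have hcutI : ∀ i (p q : V), (p = u ∧ q = v ∨ p = v ∧ q = u) → p ∈ Q i → q ∉ Q i →
      (P i).Nonempty → 2 ≤ numComponents G ↑(insert p (nbS G S (P i))) ∧
      m ≤ (nbS G S (P i)).card + 1 ∧ (insert p (nbS G S (P i))).card = (nbS G S (P i)).card + 1 := by
    rintro i p q hpq hp hq ⟨a, ha⟩
    have hpS : p ∉ S := hp.1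
    have hqS : q ∉ S := by
      rcases hpq with ⟨_, rfl⟩ | ⟨_, rfl⟩
      · exact hvS
      · exact huS
    have hap : a ≠ p := by
      rcases hpq with ⟨rfl, _⟩ | ⟨rfl, _⟩
      · exact ha.1
      · exact ha.2.1
    have hqp : q ≠ p := fun h => hq (h ▸ hp)
    have h2 : 2 ≤ numComponents G ↑(insert p (nbS G S (P i))) := by
      refine two_le_numComponents G _ (P i) ?_ a q ha ?_ (fun h => hq h.2.2) ?_
      · intro y hy z hz h
        simp only [Finset.coe_insert, Set.mem_insert_iff, not_or, Finset.mem_coe] at hz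
        by_cases hzS : z ∈ S
        · exact absurd ((mem_nbS _ _ _ _).mpr ⟨hzS, y, hy, h.symm⟩) hz.2
        · have hzQ := hPadj i y hy z hzS h
          have hzq : z ≠ q := fun h => hq (h ▸ hzQ)
          rcases hpq with ⟨rfl, rfl⟩ | ⟨rfl, rfl⟩
          · exact ⟨hz.1, hzq, hzQ⟩
          · exact ⟨hzq, hz.1, hzQ⟩
      · simp only [Finset.coe_insert, Set.mem_insert_iff, not_or, Finset.mem_coe]
        exact ⟨hap, fun h => hPS i a ha ((mem_nbS _ _ _ _).mp h).1⟩
      · simp only [Finset.coe_insert, Set.mem_insert_iff, not_or, Finset.mem_coe]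
        exact ⟨hqp, fun h => hqS ((mem_nbS _ _ _ _).mp h).1⟩
    have h3 := two_t_le G t hT _ h2 ht0
    have h4 : (insert p (nbS G S (P i))).card = (nbS G S (P i)).card + 1 :=
      Finset.card_insert_of_notMem (fun h => hpS ((mem_nbS _ _ _ _).mp h).1)
    rw [← hm, h4] at h3
    exact ⟨h2, by exact_mod_cast h3, h4⟩
  have hPu : (P iu).Nonempty := by
    by_contra hne
    refine hCu (Set.eq_singleton_iff_unique_mem.mpr ⟨⟨huS', huS', Reachable.refl _⟩, ?_⟩)
    rintro y ⟨_, hyS, hr⟩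
    by_contra hyu
    refine hne ⟨y, hyu, ?_, hyS, ConnectedComponent.sound hr.symm⟩
    rintro rfl
    exact hsep hr
  have hPv : (P iv).Nonempty := by
    by_contra hne
    refine hCv (Set.eq_singleton_iff_unique_mem.mpr ⟨⟨hvS', hvS', Reachable.refl _⟩, ?_⟩)
    rintro y ⟨_, hyS, hr⟩
    by_contra hyv
    refine hne ⟨y, ?_, hyv, hyS, ConnectedComponent.sound hr.symm⟩
    rintro rfl
    exact hsep hr.symm
  obtain ⟨hcu, hmu, hcardu⟩ := hcutI iu u v (Or.inl ⟨rfl, rfl⟩) huQ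
    (fun h => hiuv (hQuniq _ _ _ h hvQ)) hPu
  obtain ⟨hcv, hmv, hcardv⟩ := hcutI iv v u (Or.inr ⟨rfl, rfl⟩) hvQ
    (fun h => hiuv (hQuniq _ _ _ huQ h)) hPv
  have hlt : 2 * S.card < m * Fintype.card K.ConnectedComponent := by
    rw [div_lt_iff₀ ht0] at hg2
    have e : numComponents H ↑S = Fintype.card K.ConnectedComponent := Nat.card_eq_fintype_card
    rw [e] at hg2
    have : ((2 * S.card : ℕ) : ℚ) < ((m * Fintype.card K.ConnectedComponent : ℕ) : ℚ) := by
      push_cast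
      rw [hm]
      linarith
    exact_mod_cast this
  obtain ⟨hone, hdef⟩ := core_count G hcf S P hP m iu iv hiuv hcutlow hmu hmv hlt
  have hInu : (nbS G S (P iu)).card + 1 = m → ∀ x ∈ insert u (nbS G S (P iu)),
      InTwoTCut G t x := fun h x hx =>
    ⟨insert u (nbS G S (P iu)), by rw [hcardu, h, hm], hcu, hx⟩
  have hInv : (nbS G S (P iv)).card + 1 = m → ∀ x ∈ insert v (nbS G S (P iv)),
      InTwoTCut G t x := fun h x hx =>
    ⟨insert v (nbS G S (P iv)), by rw [hcardv, h, hm], hcv, hx⟩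
  -- description of `C`
  have hC : ∀ y, y ∈ compOf G ↑S u ↔ y ∈ Q iu ∨ y ∈ Q iv := by
    intro y
    constructor
    · rintro ⟨_, hy, hr⟩
      refine closed_of_reachable G ↑S {y | y ∈ Q iu ∨ y ∈ Q iv} ?_ _ _ hr (Or.inl huQ)
      intro a ha z hz h
      by_cases hc : a = u ∧ z = v ∨ a = v ∧ z = u
      · rcases hc with ⟨_, rfl⟩ | ⟨_, rfl⟩
        · exact Or.inr hvQ
        · exact Or.inl huQ
      · have hz' := (hHadj a z).mpr ⟨h, hc⟩
        exact ha.imp (fun ha => hQadj _ _ ha _ hz hz') (fun ha => hQadj _ _ ha _ hz hz')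
    · have hle : K ≤ G.induce (↑S : Set V)ᶜ := by
        rintro ⟨a, ha⟩ ⟨b, hb⟩ h
        exact ((hHadj a b).mp h).1
      have huv' : (G.induce (↑S : Set V)ᶜ).Adj ⟨u, huS'⟩ ⟨v, hvS'⟩ := huv
      rintro (⟨hy, h⟩ | ⟨hy, h⟩)
      · exact ⟨huS', hy, ((ConnectedComponent.exact h).mono hle).symm⟩
      · exact ⟨huS', hy, huv'.reachable.trans ((ConnectedComponent.exact h).mono hle).symm⟩
  constructor
  · rintro ⟨w, hwS, hw⟩
    have hwC : ∀ y, y ∈ compOf G ↑S u → G.Adj w y → y = u ∨ y = v := by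
      intro y hy h
      have : y ∈ nbrsIn G (compOf G ↑S u) {w} :=
        ⟨⟨hy, fun h' => h.ne (Set.mem_singleton_iff.mp h').symm⟩, w, rfl, h.symm⟩
      rw [hw] at this
      simpa using this
    have hwu : G.Adj w u := by
      have : u ∈ nbrsIn G (compOf G ↑S u) {w} := by rw [hw]; simp
      obtain ⟨_, y, hy, h⟩ := this
      rw [Set.mem_singleton_iff] at hy
      subst hy
      exact h.symm
    have hno : ∀ i y, y ∈ P i → G.Adj w y → i ≠ iu := by
      rintro i y hy h rfl
      rcases hwC y ((hC y).mpr (Or.inl hy.2.2)) h with h' | h'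
      · exact hy.1 h'
      · exact hy.2.1 h'
    have hcnt : cnt G P w ≤ 1 := by
      refine cnt_le_one G P w ?_
      rintro i j ⟨a, ha, hwa⟩ ⟨b, hb, hwb⟩
      by_contra hij
      obtain ⟨n1, n2⟩ := hP i j hij a ha b hb
      refine hcf ⟨w, a, b, u, n1, ha.1, hb.1, hwa, hwb, hwu, n2, ?_, ?_⟩
      · intro h
        exact hno i a ha hwa (hQuniq _ _ _ (hPadj i a ha u huS h) huQ)
      · intro h
        exact hno j b hb hwb (hQuniq _ _ _ (hPadj j b hb u huS h) huQ)
    obtain ⟨e1, e2, -⟩ := hdef w hwS hcnt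
    exact ⟨hInu e1 u (Finset.mem_insert_self _ _), hInv e2 v (Finset.mem_insert_self _ _)⟩
  · intro hnw
    subst hS₁
    obtain ⟨d, hdS, hdC⟩ := hD
    -- facts about `S₁`
    have hS1 : ∀ x ∈ nbrsIn G ↑S (compOf G ↑S u) \ nbrsIn G ↑S (Dset G ↑S u),
        x ∈ S ∧ (∃ y ∈ compOf G ↑S u, G.Adj x y) ∧
        ∀ y, y ∉ S → G.Adj x y → y ∈ compOf G ↑S u := by
      rintro x ⟨⟨⟨hxS, _⟩, hy⟩, hx2⟩
      refine ⟨hxS, hy, ?_⟩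
      intro y hyS h
      by_contra hyC
      exact hx2 ⟨⟨hxS, fun h' => h'.1 hxS⟩, y, ⟨hyS, hyC⟩, h⟩
    -- by minimality each vertex of `S₁` sees both sides
    have hmin' : ∀ x ∈ nbrsIn G ↑S (compOf G ↑S u) \ nbrsIn G ↑S (Dset G ↑S u),
        ∀ (p : V) (hp : p ∉ S),
        (∀ y, y ∉ S → G.Adj x y → y ∈ Q (K.connectedComponentMk ⟨p, hp⟩)) → False := by
      intro x hx p hp hxp
      obtain ⟨hxS, ⟨y₀, hy₀, hxy₀⟩, hxC⟩ := hS1 x hx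
      have hy₀S : y₀ ∉ S := hy₀.2.1
      have hSS : ∀ y, y ∉ (↑(S.erase x) : Set V) ↔ (y ∉ (↑S : Set V) ∨ y = x) := by
        intro y
        simp only [Finset.coe_erase, Set.mem_diff, Set.mem_singleton_iff, Finset.mem_coe]
        tauto
      have hxu : x ≠ u := fun h => huS (h ▸ hxS)
      have hxv : x ≠ v := fun h => hvS (h ▸ hxS)
      have hcard := Finset.card_erase_add_one hxS
      have a1 : numComponents G ↑(S.erase x) ≤ numComponents G ↑S :=
        numComponents_erase_le G _ _ x hSS y₀ hy₀S hxy₀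
      have a2 : numComponents H ↑S ≤ numComponents H ↑(S.erase x) := by
        refine numComponents_le_erase H _ _ x hxS hSS ⟨p, hp⟩ ?_
        rintro ⟨y, hy⟩ h
        obtain ⟨_, h'⟩ := hxp y hy ((hHadj x y).mp h).1
        exact (ConnectedComponent.exact h').symm
      have a3 : 2 ≤ numComponents G ↑(S.erase x) := by
        refine two_le_numComponents G _ (Dset G ↑S u) ?_ d u ⟨hdS, hdC⟩
          ((hSS d).mpr (Or.inl hdS)) (fun h => h.2 ((hC u).mpr (Or.inl huQ)))
          ((hSS u).mpr (Or.inl huS))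
        rintro y ⟨hyS, hyC⟩ z hz h
        rcases (hSS z).mp hz with hzS | rfl
        · refine ⟨hzS, fun hzC => hyC ?_⟩
          obtain ⟨h1, h2, hr⟩ := hzC
          refine ⟨h1, hyS, hr.trans (Adj.reachable ?_)⟩
          exact h.symm
        · exact absurd (hxC y hyS h.symm) hyC
      have hgood : GoodCut G t u v (S.erase x) := by
        refine ⟨?_, ?_, ?_, ?_, huv, ?_⟩
        · have h1 := hT.1 _ a3
          have h2 : (2 : ℚ) ≤ numComponents G ↑(S.erase x) := by exact_mod_cast a3
          rw [le_div_iff₀ (by linarith)] at h1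
          rw [le_div_iff₀ ht0]
          linarith
        · have h1 : ((S.erase x).card : ℚ) ≤ S.card := by exact_mod_cast (by omega)
          have h2 : (numComponents H ↑S : ℚ) ≤ numComponents H ↑(S.erase x) := by
            exact_mod_cast a2
          exact lt_of_le_of_lt (div_le_div_of_nonneg_right h1 ht0.le) (lt_of_lt_of_le hg2 h2)
        · exact (hSS u).mpr (Or.inl huS)
        · exact (hSS v).mpr (Or.inl hvS)
        · exact lt_of_le_of_lt a1 (lt_of_lt_of_le hbr a2)
      have := hmin _ hgood
      omega
    have hboth : ∀ x ∈ nbrsIn G ↑S (compOf G ↑S u) \ nbrsIn G ↑S (Dset G ↑S u),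
        (x ∈ nbS G S (P iu) ∨ x ∈ nbS G S (P iv)) ∧
        (x ∉ nbS G S (P iu) → cnt G P x ≤ 1) ∧ (x ∉ nbS G S (P iv) → cnt G P x ≤ 1) := by
      intro x hx
      obtain ⟨hxS, -, hxC⟩ := hS1 x hx
      have honly : ∀ i, (∃ y ∈ P i, G.Adj x y) → i = iu ∨ i = iv := by
        rintro i ⟨y, hy, h⟩
        rcases (hC y).mp (hxC y (hPS i y hy) h) with h' | h'
        · exact Or.inl (hQuniq _ _ _ hy.2.2 h')
        · exact Or.inr (hQuniq _ _ _ hy.2.2 h')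
      refine ⟨?_, ?_, ?_⟩
      · by_contra hcon
        rw [not_or, mem_nbS, mem_nbS] at hcon
        obtain ⟨c1, c2⟩ := hcon
        have hsub : ∀ y, y ∉ S → G.Adj x y → y = u ∨ y = v := by
          intro y hy h
          by_contra hne
          rw [not_or] at hne
          rcases (hC y).mp (hxC y hy h) with h' | h'
          · exact c1 ⟨hxS, y, ⟨hne.1, hne.2, h'⟩, h⟩
          · exact c2 ⟨hxS, y, ⟨hne.1, hne.2, h'⟩, h⟩
        have hxu : G.Adj x u := by
          by_contra hxu
          refine hmin' x hx v hvS ?_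
          intro y hy h
          rcases hsub y hy h with rfl | rfl
          · exact absurd h hxu
          · exact hvQ
        have hxv : G.Adj x v := by
          by_contra hxv
          refine hmin' x hx u huS ?_
          intro y hy h
          rcases hsub y hy h with rfl | rfl
          · exact huQ
          · exact absurd h hxv
        refine hnw ⟨x, hxS, ?_⟩
        ext y
        simp only [Set.mem_insert_iff, Set.mem_singleton_iff]
        constructor
        · rintro ⟨⟨hyC, _⟩, z, hz, h⟩
          rw [Set.mem_singleton_iff] at hz
          subst hz
          exact hsub y hyC.2.1 h.symm
        · rintro (rfl | rfl)
          · exact ⟨⟨(hC _).mpr (Or.inl huQ), fun h' => hxu.ne (Set.mem_singleton_iff.mp h').symm⟩,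
              x, rfl, hxu.symm⟩
          · exact ⟨⟨(hC _).mpr (Or.inr hvQ), fun h' => hxv.ne (Set.mem_singleton_iff.mp h').symm⟩,
              x, rfl, hxv.symm⟩
      · intro hn
        refine cnt_le_one G P x ?_
        have aux : ∀ i, (∃ y ∈ P i, G.Adj x y) → i = iv := by
          intro i hi
          refine (honly i hi).resolve_left ?_
          rintro rfl
          exact hn ((mem_nbS _ _ _ _).mpr ⟨hxS, hi⟩)
        intro i j hi hj
        rw [aux i hi, aux j hj]
      · intro hn
        refine cnt_le_one G P x ?_
        have aux : ∀ i, (∃ y ∈ P i, G.Adj x y) → i = iu := by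
          intro i hi
          refine (honly i hi).resolve_right ?_
          rintro rfl
          exact hn ((mem_nbS _ _ _ _).mpr ⟨hxS, hi⟩)
        intro i j hi hj
        rw [aux i hi, aux j hj]
    have finu : (nbS G S (P iu)).card + 1 = m →
        (∀ x ∈ nbrsIn G ↑S (compOf G ↑S u) \ nbrsIn G ↑S (Dset G ↑S u), x ∈ nbS G S (P iu)) →
        ∀ x ∈ ({u} : Set V) ∪ (nbrsIn G ↑S (compOf G ↑S u) \ nbrsIn G ↑S (Dset G ↑S u)),
          InTwoTCut G t x := by
      rintro h1 h2 x (hx | hx)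
      · rw [Set.mem_singleton_iff] at hx
        exact hInu h1 x (hx ▸ Finset.mem_insert_self _ _)
      · exact hInu h1 x (Finset.mem_insert_of_mem (h2 x hx))
    have finv : (nbS G S (P iv)).card + 1 = m →
        (∀ x ∈ nbrsIn G ↑S (compOf G ↑S u) \ nbrsIn G ↑S (Dset G ↑S u), x ∈ nbS G S (P iv)) →
        ∀ x ∈ ({v} : Set V) ∪ (nbrsIn G ↑S (compOf G ↑S u) \ nbrsIn G ↑S (Dset G ↑S u)),
          InTwoTCut G t x := by
      rintro h1 h2 x (hx | hx)
      · rw [Set.mem_singleton_iff] at hx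
        exact hInv h1 x (hx ▸ Finset.mem_insert_self _ _)
      · exact hInv h1 x (Finset.mem_insert_of_mem (h2 x hx))
    by_cases hau : ∀ x ∈ nbrsIn G ↑S (compOf G ↑S u) \ nbrsIn G ↑S (Dset G ↑S u),
        x ∈ nbS G S (P iu)
    · by_cases hav : ∀ x ∈ nbrsIn G ↑S (compOf G ↑S u) \ nbrsIn G ↑S (Dset G ↑S u),
          x ∈ nbS G S (P iv)
      · rcases hone with h | h
        · exact Or.inl (finu h hau)
        · exact Or.inr (finv h hav)
      · push Not at hav
        obtain ⟨x, hx, hxv⟩ := hav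
        obtain ⟨e1, -, -⟩ := hdef x (hS1 x hx).1 ((hboth x hx).2.2 hxv)
        exact Or.inl (finu e1 hau)
    · push Not at hau
      obtain ⟨x, hx, hxu⟩ := hau
      obtain ⟨-, e2, e3⟩ := hdef x (hS1 x hx).1 ((hboth x hx).2.1 hxu)
      refine Or.inr (finv e2 ?_)
      intro y hy
      by_contra hyv
      have hyx := e3 y (hS1 y hy).1 ((hboth y hy).2.2 hyv)
      subst hyx
      exact (hboth y hy).1.elim hxu hyv
end

section
/- Let t ≥ 2 be a rational number, G a minimally t-tough, claw-free graph with minimum degree δ(G) ≥ ⌈3t⌉, and A an atom of G. Then for every edge e = xy with both endpoints x, y in A: D(e) ≠ ∅, the vertex set of C(e) is exactly {x, y}, and ⌈3t⌉−1 ≤ |N_{S(e)}(C(e))| ≤ 4t−3. -/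
open SimpleGraph

variable {V : Type*}

open Classical in
/-- vertex set of a component -/
noncomputable def cset [Fintype V] (G : SimpleGraph V) (S : Finset V)
    (c : (G.induce (↑S : Set V)ᶜ).ConnectedComponent) : Finset V :=
  Finset.univ.filter (fun v => ∃ h : v ∈ (↑S : Set V)ᶜ,
    (G.induce (↑S : Set V)ᶜ).connectedComponentMk ⟨v, h⟩ = c)

open Classical in
/-- neighbours of `Z` inside `S` -/
noncomputable def nb (G : SimpleGraph V) (S Z : Finset V) : Finset V :=
  S.filter (fun s => ∃ v ∈ Z, G.Adj s v)

lemma mem_nb (G : SimpleGraph V) (S Z : Finset V) (s : V) :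
    s ∈ nb G S Z ↔ s ∈ S ∧ ∃ v ∈ Z, G.Adj s v := by
  simp [nb]

lemma mem_cset [Fintype V] (G : SimpleGraph V) (S : Finset V)
    (c : (G.induce (↑S : Set V)ᶜ).ConnectedComponent) (v : V) :
    v ∈ cset G S c ↔ ∃ h : v ∈ (↑S : Set V)ᶜ,
      (G.induce (↑S : Set V)ᶜ).connectedComponentMk ⟨v, h⟩ = c := by
  simp [cset]

lemma cset_not_mem [Fintype V] {G : SimpleGraph V} {S : Finset V}
    {c : (G.induce (↑S : Set V)ᶜ).ConnectedComponent} {v : V} (h : v ∈ cset G S c) : v ∉ S := by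
  rw [mem_cset] at h; obtain ⟨h, _⟩ := h; simpa using h

lemma cset_nonempty [Fintype V] (G : SimpleGraph V) (S : Finset V)
    (c : (G.induce (↑S : Set V)ᶜ).ConnectedComponent) : ∃ v, v ∈ cset G S c := by
  induction c using SimpleGraph.ConnectedComponent.ind with
  | _ v => exact ⟨v.1, (mem_cset _ _ _ _).2 ⟨v.2, rfl⟩⟩

lemma cset_inj [Fintype V] {G : SimpleGraph V} {S : Finset V}
    {c d : (G.induce (↑S : Set V)ᶜ).ConnectedComponent} {v : V} (h : v ∈ cset G S c)
    (h' : v ∈ cset G S d) : c = d := by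
  rw [mem_cset] at h h'; obtain ⟨h, rfl⟩ := h; obtain ⟨_, rfl⟩ := h'; rfl

lemma cset_exists [Fintype V] (G : SimpleGraph V) (S : Finset V) (v : V) (h : v ∉ S) :
    ∃ c, v ∈ cset G S c := by
  have h' : v ∈ (↑S : Set V)ᶜ := by simpa using h
  exact ⟨(G.induce (↑S : Set V)ᶜ).connectedComponentMk ⟨v, h'⟩, (mem_cset _ _ _ _).2 ⟨h', rfl⟩⟩

lemma cset_adj [Fintype V] {G : SimpleGraph V} {S : Finset V}
    {c : (G.induce (↑S : Set V)ᶜ).ConnectedComponent} {u v : V} (h : u ∈ cset G S c)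
    (huv : G.Adj u v) (hv : v ∉ S) : v ∈ cset G S c := by
  rw [mem_cset] at h ⊢
  obtain ⟨hu, rfl⟩ := h
  have h' : v ∈ (↑S : Set V)ᶜ := by simpa using hv
  refine ⟨h', ?_⟩
  rw [SimpleGraph.ConnectedComponent.eq]
  exact SimpleGraph.Adj.reachable (by simpa using huv.symm)

lemma compOf_eq_cset [Fintype V] (G : SimpleGraph V) (S : Finset V) (u : V)
    (c : (G.induce (↑S : Set V)ᶜ).ConnectedComponent) (hu : u ∈ cset G S c) :
    compOf G ↑S u = ↑(cset G S c) := by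
  rw [mem_cset] at hu
  obtain ⟨h, rfl⟩ := hu
  ext w
  rw [Finset.mem_coe, mem_cset]
  simp only [SimpleGraph.ConnectedComponent.eq]
  constructor
  · rintro ⟨_, hw, hr⟩; exact ⟨hw, hr.symm⟩
  · rintro ⟨hw, hr⟩; exact ⟨h, hw, hr.symm⟩

/-- a set closed under adjacency outside `S` contains the component -/
lemma cset_subset [Fintype V] {G : SimpleGraph V} {S : Finset V}
    {c : (G.induce (↑S : Set V)ᶜ).ConnectedComponent} {u : V} (h : u ∈ cset G S c)
    (P : V → Prop) (hP : P u) (hcl : ∀ a b, a ∉ S → b ∉ S → G.Adj a b → P a → P b) :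
    ∀ v ∈ cset G S c, P v := by
  intro v hv
  rw [mem_cset] at h hv
  obtain ⟨hu, rfl⟩ := h
  obtain ⟨hv, he⟩ := hv
  rw [SimpleGraph.ConnectedComponent.eq] at he
  obtain ⟨w⟩ := he.symm
  have key : ∀ (a b : ↥((↑S : Set V)ᶜ)), (G.induce (↑S : Set V)ᶜ).Walk a b → P a.1 → P b.1 := by
    intro a b w
    induction w with
    | nil => exact id
    | @cons a b c hab _ ih =>
      intro hp
      exact ih (hcl _ _ (fun h => a.2 (by simpa using h)) (fun h => b.2 (by simpa using h))
        (by simpa using hab) hp)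
  exact key _ _ w hP

lemma label {β : Type*} [Fintype V] (G : SimpleGraph V) (S : Finset V) (f : V → β)
    (hf : ∀ u v, u ∉ S → v ∉ S → G.Adj u v → f u = f v)
    (hs : ∀ b : β, ∃ v, v ∉ S ∧ f v = b) : Nat.card β ≤ numComponents G ↑S := by
  have hw : ∀ (a b : ↥((↑S : Set V)ᶜ)), (G.induce (↑S : Set V)ᶜ).Walk a b → f a.1 = f b.1 := by
    intro a b w
    induction w with
    | nil => rfl
    | @cons u v w hab _ ih =>
      rw [← ih]
      exact hf _ _ (fun h => u.2 (by simpa using h)) (fun h => v.2 (by simpa using h)) (by simpa using hab)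
  let g : (G.induce (↑S : Set V)ᶜ).ConnectedComponent → β :=
    fun c => c.lift (fun v => f v.1) (fun a b w _ => hw a b w)
  unfold numComponents
  apply Nat.card_le_card_of_surjective g
  intro b
  obtain ⟨v, hv, rfl⟩ := hs b
  exact ⟨(G.induce (↑S : Set V)ᶜ).connectedComponentMk ⟨v, by simpa using hv⟩, rfl⟩

lemma cutL [Fintype V] (G : SimpleGraph V) (Z N : Finset V) (z y : V) (hz : z ∈ Z)
    (hd : ∀ v ∈ Z, v ∉ N) (hcl : ∀ u ∈ Z, ∀ v, G.Adj u v → v ∈ Z ∨ v ∈ N)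
    (hy : y ∉ Z) (hyN : y ∉ N) : 2 ≤ numComponents G ↑N := by
  classical
  have := label G N (fun v => decide (v ∈ Z)) (by
    intro u v hu hv huv
    have h1 := hcl u
    have h2 := hcl v
    have h3 := h1
    by_cases a : u ∈ Z <;> by_cases b : v ∈ Z <;> simp [a, b]
    · have := hcl u a v huv; tauto
    · have := hcl v b u huv.symm; tauto) (by
    intro b
    cases b
    · exact ⟨y, hyN, by simpa using hy⟩
    · exact ⟨z, hd z hz, by simpa using hz⟩)
  simpa using this

lemma numC_eq [Fintype V] (G : SimpleGraph V) (S : Finset V)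
    [Fintype (G.induce (↑S : Set V)ᶜ).ConnectedComponent] :
    numComponents G ↑S = Fintype.card (G.induce (↑S : Set V)ᶜ).ConnectedComponent := by
  unfold numComponents
  exact Nat.card_eq_fintype_card

lemma claw3 [Fintype V] {G : SimpleGraph V} (hcf : ClawFree G) {S : Finset V}
    {c d e : (G.induce (↑S : Set V)ᶜ).ConnectedComponent} {s : V}
    (hcd : c ≠ d) (hce : c ≠ e) (hde : d ≠ e)
    (hc : s ∈ nb G S (cset G S c)) (hd : s ∈ nb G S (cset G S d))
    (he : s ∈ nb G S (cset G S e)) : False := by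
  rw [mem_nb] at hc hd he
  obtain ⟨_, u, hu, hsu⟩ := hc
  obtain ⟨_, v, hv, hsv⟩ := hd
  obtain ⟨_, w, hw, hsw⟩ := he
  have nadj : ∀ {c d : (G.induce (↑S : Set V)ᶜ).ConnectedComponent} {a b : V}, c ≠ d →
      a ∈ cset G S c → b ∈ cset G S d → a ≠ b ∧ ¬ G.Adj a b := by
    intro c d a b hcd ha hb
    refine ⟨?_, ?_⟩
    · rintro rfl; exact hcd (cset_inj ha hb)
    · intro h; exact hcd (cset_inj (cset_adj ha h (cset_not_mem hb)) hb)
  exact hcf ⟨s, u, v, w, (nadj hcd hu hv).1, (nadj hce hu hw).1, (nadj hde hv hw).1, hsu, hsv, hsw,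
    (nadj hcd hu hv).2, (nadj hce hu hw).2, (nadj hde hv hw).2⟩

open Classical in
/-- number of components adjacent to `s` -/
noncomputable def cdeg [Fintype V] (G : SimpleGraph V) (S : Finset V) (s : V)
    [Fintype (G.induce (↑S : Set V)ᶜ).ConnectedComponent] : ℕ :=
  (Finset.univ.filter (fun c => s ∈ nb G S (cset G S c))).card

lemma cdeg_le [Fintype V] {G : SimpleGraph V} (hcf : ClawFree G) (S : Finset V) (s : V)
    [Fintype (G.induce (↑S : Set V)ᶜ).ConnectedComponent] : cdeg G S s ≤ 2 := by
  classical
  unfold cdeg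
  by_contra! h
  obtain ⟨a, b, c, ha, hb, hc, h1, h2, h3⟩ := Finset.two_lt_card_iff.1 h
  simp only [Finset.mem_filter, Finset.mem_univ, true_and] at ha hb hc
  exact claw3 hcf h1 h2 h3 ha hb hc

lemma double_count [Fintype V] (G : SimpleGraph V) (S : Finset V)
    [Fintype (G.induce (↑S : Set V)ᶜ).ConnectedComponent] :
    ∑ c, (nb G S (cset G S c)).card = ∑ s ∈ S, cdeg G S s := by
  classical
  unfold cdeg
  have := Finset.sum_card_bipartiteAbove_eq_sum_card_bipartiteBelow (s := S)
    (t := (Finset.univ : Finset (G.induce (↑S : Set V)ᶜ).ConnectedComponent))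
    (fun s c => s ∈ nb G S (cset G S c))
  unfold Finset.bipartiteAbove Finset.bipartiteBelow at this
  rw [this]
  apply Finset.sum_congr rfl
  intro c _
  congr 1
  ext s
  simp only [Finset.mem_filter]
  constructor
  · intro h; exact ⟨((mem_nb _ _ _ _).1 h).1, h⟩
  · exact fun h => h.2

lemma cset_cut [Fintype V] (G : SimpleGraph V) (S : Finset V)
    (c d : (G.induce (↑S : Set V)ᶜ).ConnectedComponent) (hcd : d ≠ c) :
    2 ≤ numComponents G ↑(nb G S (cset G S c)) := by
  obtain ⟨z, hz⟩ := cset_nonempty G S c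
  obtain ⟨y, hy⟩ := cset_nonempty G S d
  refine cutL G (cset G S c) _ z y hz ?_ ?_ ?_ ?_
  · intro v hv h; exact cset_not_mem hv ((mem_nb _ _ _ _).1 h).1
  · intro u hu v huv
    by_cases hv : v ∈ S
    · right; exact (mem_nb _ _ _ _).2 ⟨hv, u, hu, huv.symm⟩
    · left; exact cset_adj hu huv hv
  · intro h; exact hcd (cset_inj hy h)
  · intro h; exact cset_not_mem hy ((mem_nb _ _ _ _).1 h).1

lemma vconn_le [Fintype V] (G : SimpleGraph V) (N : Finset V) (h : 2 ≤ numComponents G ↑N) :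
    vconn G ≤ N.card := Nat.sInf_le ⟨N, rfl, h⟩

lemma other_comp [Fintype V] (G : SimpleGraph V) (S : Finset V) (h : 2 ≤ numComponents G ↑S)
    (c : (G.induce (↑S : Set V)ᶜ).ConnectedComponent) : ∃ d, d ≠ c := by
  classical
  have := Fintype.ofFinite (G.induce (↑S : Set V)ᶜ).ConnectedComponent
  rw [numC_eq] at h
  exact Fintype.exists_ne_of_one_lt_card (by omega) c

lemma vconn_eq [Fintype V] (G : SimpleGraph V) (t : ℚ) (hcf : ClawFree G)
    (h : HasToughness G t) : (vconn G : ℚ) = 2 * t := by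
  classical
  obtain ⟨h1, S, hS, hSt⟩ := h
  have hmem : vconn G ∈ {k | ∃ S : Finset V, S.card = k ∧ 2 ≤ numComponents G ↑S} :=
    Nat.sInf_mem ⟨S.card, S, rfl, hS⟩
  obtain ⟨T, hT, hT2⟩ := hmem
  have ht0 : 0 ≤ t := by rw [hSt]; positivity
  apply le_antisymm
  · have := Fintype.ofFinite (G.induce (↑S : Set V)ᶜ).ConnectedComponent
    have hdc := double_count G S
    have e1 : ∑ s ∈ S, cdeg G S s ≤ S.card * 2 :=
      Finset.sum_le_card_nsmul _ _ _ (fun s _ => cdeg_le hcf S s)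
    have e2 : Fintype.card (G.induce (↑S : Set V)ᶜ).ConnectedComponent * vconn G ≤
        ∑ c, (nb G S (cset G S c)).card :=
      Finset.card_nsmul_le_sum _ _ _ (fun c _ => by
        obtain ⟨d, hd⟩ := other_comp G S hS c
        exact vconn_le G _ (cset_cut G S c d hd))
    rw [← numC_eq] at e2
    have e3 : numComponents G ↑S * vconn G ≤ S.card * 2 := by omega
    have e4 : ((numComponents G ↑S : ℕ) : ℚ) * vconn G ≤ S.card * 2 := by exact_mod_cast e3
    have hpos : (0 : ℚ) < (numComponents G ↑S : ℕ) := by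
      have : 0 < numComponents G ↑S := by omega
      exact_mod_cast this
    rw [hSt, mul_div_assoc', le_div_iff₀ hpos]
    linarith
  · have := h1 T hT2
    have hw : (2 : ℚ) ≤ (numComponents G ↑T : ℕ) := by exact_mod_cast hT2
    rw [le_div_iff₀ (by linarith), hT] at this
    nlinarith

/-- closedness: all neighbours of `Z` lie in `Z ∪ N`, and `Z`, `N` disjoint -/
def GSep (G : SimpleGraph V) (Z N : Finset V) : Prop :=
  (∀ v ∈ Z, v ∉ N) ∧ ∀ u ∈ Z, ∀ v, G.Adj u v → v ∈ Z ∨ v ∈ N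

/-- abstract fragment hypothesis -/
def FragH (G : SimpleGraph V) (k a : ℕ) : Prop :=
  ∀ (Z N : Finset V) (z y : V), z ∈ Z → GSep G Z N → y ∉ Z → y ∉ N →
    k ≤ N.card ∧ (N.card ≤ k → a ≤ Z.card)

lemma fragH [Fintype V] (G : SimpleGraph V) (A : Set V) (hA : IsGraphAtom G A) :
    FragH G (vconn G) A.ncard := by
  intro Z N z y hz hsep hy hyN
  have h2 := cutL G Z N z y hz hsep.1 hsep.2 hy hyN
  have h3 := vconn_le G N h2
  refine ⟨h3, fun hN => ?_⟩
  obtain ⟨c, hc⟩ := cset_exists G N z (hsep.1 z hz)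
  have := hA.2 (cset G N c) ⟨N, z, le_antisymm hN h3, h2, hsep.1 z hz,
    (compOf_eq_cset G N z c hc).symm⟩
  rw [Set.ncard_coe_finset] at this
  refine this.trans (Finset.card_le_card ?_)
  intro v hv
  exact cset_subset hc (fun v => v ∈ Z) hz (fun a b ha hb hab haZ => by
    rcases hsep.2 a haZ b hab with h | h
    · exact h
    · exact absurd h hb) v hv

lemma quad [DecidableEq V] {G : SimpleGraph V} {k a : ℕ} (hF : FragH G k a)
    (P T X N : Finset V) (y : V) (h1 : GSep G P T) (h2 : GSep G X N) (hy : y ∉ P) (hyT : y ∉ T) :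
    (P ∩ X).card = 0 ∨ (k ≤ (P ∩ N).card + (T ∩ N).card + (T ∩ X).card ∧
      ((P ∩ N).card + (T ∩ N).card + (T ∩ X).card ≤ k → a ≤ (P ∩ X).card)) := by
  rcases Finset.eq_empty_or_nonempty (P ∩ X) with h | ⟨z, hz⟩
  · left; simp [h]
  right
  have hc : ((P ∩ N) ∪ (T ∩ N) ∪ (T ∩ X)).card ≤
      (P ∩ N).card + (T ∩ N).card + (T ∩ X).card :=
    (Finset.card_union_le _ _).trans (by have := Finset.card_union_le (P ∩ N) (T ∩ N); omega)
  have := hF (P ∩ X) ((P ∩ N) ∪ (T ∩ N) ∪ (T ∩ X)) z y hz (by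
    constructor
    · intro v hv
      have := h1.1 v
      have := h2.1 v
      simp only [Finset.mem_union, Finset.mem_inter] at hv ⊢
      tauto
    · intro u hu v huv
      simp only [Finset.mem_union, Finset.mem_inter] at hu ⊢
      have := h1.2 u hu.1 v huv
      have := h2.2 u hu.2 v huv
      tauto) (by simp [hy]) (by simp [hy, hyT])
  exact ⟨this.1.trans hc, fun h => this.2 (hc.trans h)⟩

lemma split3 [DecidableEq V] (W P Q R : Finset V) (hPQ : ∀ v ∈ P, v ∉ Q) (hPR : ∀ v ∈ P, v ∉ R)
    (hQR : ∀ v ∈ Q, v ∉ R) (hc : ∀ v, v ∈ P ∨ v ∈ Q ∨ v ∈ R) :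
    W.card = (P ∩ W).card + (Q ∩ W).card + (R ∩ W).card := by
  rw [← Finset.card_union_of_disjoint, ← Finset.card_union_of_disjoint]
  · congr 1
    ext v
    have := hc v
    simp only [Finset.mem_union, Finset.mem_inter]
    tauto
  · rw [Finset.disjoint_left]
    intro v
    have := hPR v
    have := hQR v
    simp only [Finset.mem_union, Finset.mem_inter]
    tauto
  · rw [Finset.disjoint_left]
    intro v
    have := hPQ v
    simp only [Finset.mem_inter]
    tauto

lemma atom_no_cut [Fintype V] [DecidableEq V] {G : SimpleGraph V} {k : ℕ} (A T : Finset V)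
    (hF : FragH G k A.card) (hT : T.card = k) (hAT : GSep G A T) (b : V) (hbA : b ∉ A)
    (hbT : b ∉ T) (hAk : k + 1 ≤ 2 * A.card) (X N : Finset V) (z y : V) (hz : z ∈ X)
    (hXN : GSep G X N) (hy : y ∉ X) (hyN : y ∉ N) (hN : N.card ≤ k) (v : V) (hv : v ∈ A) :
    v ∉ N := by
  intro hvN
  have hNk : N.card = k := le_antisymm hN (hF X N z y hz hXN hy hyN).1
  obtain ⟨B, hB⟩ : ∃ B, B = Finset.univ \ (A ∪ T) := ⟨_, rfl⟩
  obtain ⟨Y, hY⟩ : ∃ Y, Y = Finset.univ \ (X ∪ N) := ⟨_, rfl⟩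
  have mB : ∀ v, v ∈ B ↔ v ∉ A ∧ v ∉ T := by intro v; simp [hB]
  have mY : ∀ v, v ∈ Y ↔ v ∉ X ∧ v ∉ N := by intro v; simp [hY]
  have sep' : ∀ (P Q R : Finset V), GSep G P Q → (∀ v, v ∈ R ↔ v ∉ P ∧ v ∉ Q) → GSep G R Q := by
    intro P Q R h hR
    constructor
    · intro v hv; exact ((hR v).1 hv).2
    · intro u hu w huw
      have h3 := (hR u).1 hu
      have := hR w
      by_cases hw : w ∈ P
      · have := h.2 w hw u huw.symm
        tauto
      · tauto
  have sB := sep' A T B hAT mB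
  have sY := sep' X N Y hXN mY
  have hvB : v ∉ B := by simp [mB, hv]
  have hvT : v ∉ T := hAT.1 v hv
  have cov : ∀ (P Q R : Finset V), (∀ v, v ∈ R ↔ v ∉ P ∧ v ∉ Q) →
      ∀ v, v ∈ P ∨ v ∈ Q ∨ v ∈ R := by
    intro P Q R h v
    rw [h v]
    by_cases h1 : v ∈ P <;> by_cases h2 : v ∈ Q <;> simp [h1, h2]
  have q1 := quad hF A T X N b hAT hXN hbA hbT
  have q2 := quad hF A T Y N b hAT sY hbA hbT
  have q3 := quad hF B T X N v sB hXN hvB hvT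
  have q4 := quad hF B T Y N v sB sY hvB hvT
  have d1 : ∀ v ∈ A, v ∉ B := fun v h h' => ((mB v).1 h').1 h
  have d2 : ∀ v ∈ T, v ∉ B := fun v h h' => ((mB v).1 h').2 h
  have d3 : ∀ v, v ∈ A ∨ v ∈ T ∨ v ∈ B := cov _ _ _ mB
  have e1 : ∀ v ∈ X, v ∉ Y := fun v h h' => ((mY v).1 h').1 h
  have e2 : ∀ v ∈ N, v ∉ Y := fun v h h' => ((mY v).1 h').2 h
  have e3 : ∀ v, v ∈ X ∨ v ∈ N ∨ v ∈ Y := cov _ _ _ mY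
  have c1 := split3 X A T B hAT.1 d1 d2 d3
  have c2 := split3 N A T B hAT.1 d1 d2 d3
  have c3 := split3 Y A T B hAT.1 d1 d2 d3
  have c4 := split3 A X N Y hXN.1 e1 e2 e3
  have c5 := split3 T X N Y hXN.1 e1 e2 e3
  have c6 := split3 B X N Y hXN.1 e1 e2 e3
  rw [Finset.inter_comm X, Finset.inter_comm N, Finset.inter_comm Y] at c4 c5 c6
  have f1 := (hF X N z y hz hXN hy hyN).2 hN
  have f2 := (hF Y N y z ((mY y).2 ⟨hy, hyN⟩) sY (e1 z hz) (hXN.1 z hz)).2 hN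
  have f3 := (hF B T b v ((mB b).2 ⟨hbA, hbT⟩) sB hvB hvT).2 hT.le
  have f4 : 0 < (A ∩ N).card := Finset.card_pos.2 ⟨v, by simp [hv, hvN]⟩
  omega

lemma getg [Fintype V] (G : SimpleGraph V) (S : Finset V)
    (c0 : (G.induce (↑S : Set V)ᶜ).ConnectedComponent) :
    ∃ g : V → (G.induce (↑S : Set V)ᶜ).ConnectedComponent,
      (∀ v, v ∉ S → v ∈ cset G S (g v)) ∧ ∀ v ∈ S, g v = c0 := by
  have : ∀ v, ∃ c : (G.induce (↑S : Set V)ᶜ).ConnectedComponent,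
      (v ∉ S → v ∈ cset G S c) ∧ (v ∈ S → c = c0) := by
    intro v
    by_cases hv : v ∈ S
    · exact ⟨c0, by simp [hv], by simp⟩
    · obtain ⟨c, hc⟩ := cset_exists G S v hv
      exact ⟨c, by simp [hc], by simp [hv]⟩
  choose g hg using this
  exact ⟨g, fun v => (hg v).1, fun v => (hg v).2⟩

lemma merge [Fintype V] (G H : SimpleGraph V) (S S' : Finset V) (hSS : S' ⊆ S)
    (c0 c1 : (H.induce (↑S : Set V)ᶜ).ConnectedComponent) (h01 : c0 ≠ c1)
    (h1 : ∀ u v c d, G.Adj u v → u ∈ cset H S c → v ∈ cset H S d →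
      c = d ∨ ((c = c0 ∨ c = c1) ∧ (d = c0 ∨ d = c1)))
    (h2 : ∀ u v c, u ∈ S → u ∉ S' → G.Adj u v → v ∈ cset H S c → c = c0 ∨ c = c1) :
    numComponents H ↑S ≤ numComponents G ↑S' + 1 := by
  classical
  have := Fintype.ofFinite (H.induce (↑S : Set V)ᶜ).ConnectedComponent
  obtain ⟨g, hg1, hg2⟩ := getg H S c0
  let r : (H.induce (↑S : Set V)ᶜ).ConnectedComponent →
      {c : (H.induce (↑S : Set V)ᶜ).ConnectedComponent // c ≠ c1} :=
    fun c => if h : c = c1 then ⟨c0, h01⟩ else ⟨c, h⟩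
  have r01 : ∀ c, c = c0 ∨ c = c1 → r c = ⟨c0, h01⟩ := by
    rintro c (rfl | rfl)
    · simp [r, h01]
    · simp [r]
  have key := label G S' (fun v => r (g v)) (by
    intro u v hu hv huv
    by_cases hu2 : u ∈ S <;> by_cases hv2 : v ∈ S
    · simp only [hg2 u hu2, hg2 v hv2]
    · have := h2 u v _ hu2 hu huv (hg1 v hv2)
      simp only [hg2 u hu2]
      rw [r01 _ this, r01 _ (Or.inl rfl)]
    · have := h2 v u _ hv2 hv huv.symm (hg1 u hu2)
      simp only [hg2 v hv2]
      rw [r01 _ this, r01 _ (Or.inl rfl)]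
    · rcases h1 u v _ _ huv (hg1 u hu2) (hg1 v hv2) with h | ⟨h, h'⟩
      · simp only [h]
      · rw [r01 _ h, r01 _ h']) (by
    rintro ⟨c, hc⟩
    obtain ⟨v, hv⟩ := cset_nonempty H S c
    have hvS := cset_not_mem hv
    refine ⟨v, fun h => hvS (hSS h), ?_⟩
    have : g v = c := cset_inj (hg1 v hvS) hv
    simp [this, r, hc])
  rw [Nat.card_eq_fintype_card, Fintype.card_subtype_compl] at key
  simp only [Fintype.card_subtype_eq] at key
  rw [numC_eq]
  omega

/-- structure of the two sides of a bridge -/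
lemma bridge [Fintype V] (G : SimpleGraph V) (S : Finset V) (x y : V)
    (hb : IsBridgeIn G ↑S x y) (c0 : (G.induce (↑S : Set V)ᶜ).ConnectedComponent)
    (hc0 : x ∈ cset G S c0) :
    numComponents (G.deleteEdges {s(x, y)}) ↑S ≤ numComponents G ↑S + 1 ∧
    ∃ X Y : Finset V, x ∈ X ∧ y ∈ Y ∧ y ∉ X ∧ x ∉ Y ∧ (∀ v ∈ X, v ∉ Y) ∧
      (∀ u ∈ X, ∀ v, G.Adj u v → v ∈ X ∨ v ∈ S ∨ (u = x ∧ v = y)) ∧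
      (∀ u ∈ Y, ∀ v, G.Adj u v → v ∈ Y ∨ v ∈ S ∨ (u = y ∧ v = x)) ∧
      (∀ v, v ∈ cset G S c0 ↔ v ∈ X ∨ v ∈ Y) := by
  classical
  obtain ⟨hx, hy, hxy, hlt⟩ := hb
  have hx : x ∉ S := by simpa using hx
  have hy : y ∉ S := by simpa using hy
  obtain ⟨H, hH⟩ : ∃ H, H = G.deleteEdges {s(x, y)} := ⟨_, rfl⟩
  rw [← hH] at hlt ⊢
  have hHadj : ∀ u v, G.Adj u v → H.Adj u v ∨ (u = x ∧ v = y) ∨ (u = y ∧ v = x) := by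
    intro u v h
    simp only [hH, SimpleGraph.deleteEdges_adj, Set.mem_singleton_iff, h, true_and, Sym2.eq_iff]
    tauto
  have hHG : ∀ u v, H.Adj u v → G.Adj u v := by
    intro u v h
    rw [hH, SimpleGraph.deleteEdges_adj] at h
    exact h.1
  obtain ⟨cx, hcx⟩ := cset_exists H S x hx
  obtain ⟨cy, hcy⟩ := cset_exists H S y hy
  have hne : cx ≠ cy := by
    rintro rfl
    obtain ⟨g, hg, _⟩ := getg H S cx
    have := label G S g (by
      intro u v hu hv huv
      rcases hHadj u v huv with h | ⟨rfl, rfl⟩ | ⟨rfl, rfl⟩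
      · exact cset_inj (cset_adj (hg u hu) h hv) (hg v hv)
      · rw [cset_inj (hg u hu) hcx, cset_inj (hg v hv) hcy]
      · rw [cset_inj (hg u hu) hcy, cset_inj (hg v hv) hcx]) (by
      intro c
      obtain ⟨v, hv⟩ := cset_nonempty H S c
      exact ⟨v, cset_not_mem hv, cset_inj (hg v (cset_not_mem hv)) hv⟩)
    unfold numComponents at hlt this
    omega
  have h0y : y ∈ cset G S c0 := cset_adj hc0 hxy hy
  refine ⟨?_, cset H S cx, cset H S cy, hcx, hcy, ?_, ?_, ?_, ?_, ?_, ?_⟩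
  · refine merge G H S S (le_refl _) cx cy hne ?_ ?_
    · intro u v c d huv hu hv
      rcases hHadj u v huv with h | ⟨rfl, rfl⟩ | ⟨rfl, rfl⟩
      · left; exact cset_inj (cset_adj hu h (cset_not_mem hv)) hv
      · right; exact ⟨Or.inl (cset_inj hu hcx), Or.inr (cset_inj hv hcy)⟩
      · right; exact ⟨Or.inr (cset_inj hu hcy), Or.inl (cset_inj hv hcx)⟩
    · intro u v c h1 h2; exact absurd h1 h2
  · intro h; exact hne (cset_inj h hcy)
  · intro h; exact hne (cset_inj hcx h)
  · intro v h h'; exact hne (cset_inj h h')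
  · intro u hu v huv
    by_cases hv : v ∈ S
    · exact Or.inr (Or.inl hv)
    rcases hHadj u v huv with h | h | ⟨rfl, rfl⟩
    · left; exact cset_adj hu h hv
    · exact Or.inr (Or.inr h)
    · left; exact hcx
  · intro u hu v huv
    by_cases hv : v ∈ S
    · exact Or.inr (Or.inl hv)
    rcases hHadj u v huv with h | ⟨rfl, rfl⟩ | h
    · left; exact cset_adj hu h hv
    · left; exact hcy
    · exact Or.inr (Or.inr h)
  · intro v
    constructor
    · intro hv
      refine cset_subset hc0 (fun v => v ∈ cset H S cx ∨ v ∈ cset H S cy) (Or.inl hcx) ?_ v hv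
      intro a b ha hb hab hP
      rcases hHadj a b hab with h | ⟨rfl, rfl⟩ | ⟨rfl, rfl⟩
      · exact hP.imp (fun k => cset_adj k h hb) (fun k => cset_adj k h hb)
      · exact Or.inr hcy
      · exact Or.inl hcx
    · rintro (hv | hv)
      · exact cset_subset hcx (fun v => v ∈ cset G S c0) hc0
          (fun a b _ hb hab h => cset_adj h (hHG _ _ hab) hb) v hv
      · exact cset_subset hcy (fun v => v ∈ cset G S c0) h0y
          (fun a b _ hb hab h => cset_adj h (hHG _ _ hab) hb) v hv

/-- no small separator meets `A` -/
def NoCut (G : SimpleGraph V) (k : ℕ) (A : Finset V) : Prop :=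
  ∀ (X N : Finset V) (z y : V), z ∈ X → GSep G X N → y ∉ X → y ∉ N → N.card ≤ k →
    ∀ v ∈ A, v ∉ N

lemma side [Fintype V] [DecidableEq V] {G : SimpleGraph V} [DecidableRel G.Adj] {k : ℕ}
    {A S : Finset V}
    (hNC : NoCut G k A) (hdeg : ∀ v, 3 * k ≤ 2 * G.degree v) (x y : V) (hxA : x ∈ A)
    (hyS : y ∉ S) (X M : Finset V) (hxX : x ∈ X) (hyX : y ∉ X) (hXS : ∀ v ∈ X, v ∉ S)
    (hX : ∀ u ∈ X, ∀ v, G.Adj u v → v ∈ X ∨ v ∈ S ∨ (u = x ∧ v = y))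
    (hM : M ⊆ nb G S X) (hM2 : ∀ s ∈ M, s ∉ nb G S (X.erase x)) :
    (X = {x} ∧ 3 * k ≤ 2 * ((nb G S X).card + 1)) ∨ k + M.card ≤ (nb G S X).card := by
  by_cases h : X = {x}
  · left
    refine ⟨h, ?_⟩
    have h1 : G.neighborFinset x ⊆ insert y (nb G S X) := by
      intro v hv
      rw [SimpleGraph.mem_neighborFinset] at hv
      rw [Finset.mem_insert]
      rcases hX x hxX v hv with h' | h' | h'
      · rw [h, Finset.mem_singleton] at h'
        subst h'
        exact absurd hv (G.irrefl)
      · right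
        exact (mem_nb _ _ _ _).2 ⟨h', x, hxX, hv.symm⟩
      · left; exact h'.2
    have h2 := (Finset.card_le_card h1).trans (Finset.card_insert_le _ _)
    rw [SimpleGraph.card_neighborFinset_eq_degree] at h2
    have := hdeg x
    omega
  · right
    obtain ⟨z, hz, hzx⟩ : ∃ z ∈ X, z ≠ x := by
      by_contra! hcon
      exact h (Finset.eq_singleton_iff_unique_mem.2 ⟨hxX, hcon⟩)
    have hxnb : x ∉ nb G S (X.erase x) := fun hh => hXS x hxX ((mem_nb _ _ _ _).1 hh).1
    have hk : k + 1 ≤ (insert x (nb G S (X.erase x))).card := by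
      by_contra! hcon
      refine hNC (X.erase x) _ z y (Finset.mem_erase.2 ⟨hzx, hz⟩) ?_ (by simp [hyX]) ?_
        (Nat.lt_succ_iff.1 hcon) x hxA (Finset.mem_insert_self _ _)
      · constructor
        · intro v hv hv2
          rw [Finset.mem_erase] at hv
          rw [Finset.mem_insert, mem_nb] at hv2
          rcases hv2 with h' | h'
          · exact hv.1 h'
          · exact hXS v hv.2 h'.1
        · intro u hu v huv
          have hu' := Finset.mem_erase.1 hu
          by_cases hvx : v = x
          · right; simp [hvx]
          rcases hX u hu'.2 v huv with h' | h' | h'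
          · left; exact Finset.mem_erase.2 ⟨hvx, h'⟩
          · right
            exact Finset.mem_insert_of_mem ((mem_nb _ _ _ _).2 ⟨h', u, hu, huv.symm⟩)
          · exact absurd h'.1 hu'.1
      · rw [Finset.mem_insert, mem_nb]
        rintro (h' | h')
        · subst h'; exact hyX hxX
        · exact hyS h'.1
    rw [Finset.card_insert_of_notMem hxnb] at hk
    have hd : Disjoint (nb G S (X.erase x)) M := by
      rw [Finset.disjoint_left]
      intro s hs hsM
      exact hM2 s hsM hs
    have hsub : nb G S (X.erase x) ∪ M ⊆ nb G S X := by
      apply Finset.union_subset _ hM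
      intro s hs
      rw [mem_nb] at hs ⊢
      obtain ⟨h1, v, hv, hsv⟩ := hs
      exact ⟨h1, v, (Finset.mem_erase.1 hv).2, hsv⟩
    have := Finset.card_le_card hsub
    rw [Finset.card_union_of_disjoint hd] at this
    omega

lemma sum_cdeg [Fintype V] [DecidableEq V] {G : SimpleGraph V} (hcf : ClawFree G) (S E : Finset V)
    [Fintype (G.induce (↑S : Set V)ᶜ).ConnectedComponent] (hE : E ⊆ S)
    (h1 : ∀ s ∈ E, cdeg G S s ≤ 1) : ∑ s ∈ S, cdeg G S s + E.card ≤ 2 * S.card := by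
  rw [← Finset.sum_sdiff hE]
  have e1 : ∑ s ∈ E, cdeg G S s ≤ E.card * 1 := Finset.sum_le_card_nsmul _ _ _ h1
  have e2 : ∑ s ∈ S \ E, cdeg G S s ≤ (S \ E).card * 2 :=
    Finset.sum_le_card_nsmul _ _ _ (fun s _ => cdeg_le hcf S s)
  have e3 := Finset.card_sdiff_add_card_eq_card hE
  omega

lemma cset_GSep [Fintype V] (G : SimpleGraph V) (S : Finset V)
    (c : (G.induce (↑S : Set V)ᶜ).ConnectedComponent) :
    GSep G (cset G S c) (nb G S (cset G S c)) := by
  constructor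
  · intro v hv h; exact cset_not_mem hv ((mem_nb _ _ _ _).1 h).1
  · intro u hu v huv
    by_cases hv : v ∈ S
    · right; exact (mem_nb _ _ _ _).2 ⟨hv, u, hu, huv.symm⟩
    · left; exact cset_adj hu huv hv

lemma cdeg_two [Fintype V] {G : SimpleGraph V} {S : Finset V} {s : V}
    [Fintype (G.induce (↑S : Set V)ᶜ).ConnectedComponent] (h : ¬ cdeg G S s ≤ 1)
    (c0 : (G.induce (↑S : Set V)ᶜ).ConnectedComponent) :
    ∃ c, c ≠ c0 ∧ s ∈ nb G S (cset G S c) := by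
  classical
  unfold cdeg at h
  push Not at h
  obtain ⟨c, hc, hne⟩ := Finset.exists_mem_ne h c0
  exact ⟨c, hne, by simpa using hc⟩

lemma stage1 [Fintype V] [DecidableEq V] {G : SimpleGraph V} [DecidableRel G.Adj] {k : ℕ}
    {A S : Finset V} (hcf : ClawFree G) (hk : 4 ≤ k)
    (hcut : ∀ N : Finset V, 2 ≤ numComponents G ↑N → k ≤ N.card)
    (hNC : NoCut G k A) (hdeg : ∀ v, 3 * k ≤ 2 * G.degree v) (x y : V) (hxA : x ∈ A)
    (hyA : y ∈ A) (hb : IsBridgeIn G ↑S x y)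
    (c0 : (G.induce (↑S : Set V)ᶜ).ConnectedComponent) (hc0 : x ∈ cset G S c0)
    (hS : 2 * S.card + 1 ≤ k * (numComponents (G.deleteEdges {s(x, y)}) ↑S)) :
    2 ≤ numComponents G ↑S ∧ cset G S c0 = {x, y} ∧
    2 * S.card + 1 ≤ k * (numComponents G ↑S + 1) ∧
    3 * k ≤ 2 * ((nb G S (cset G S c0)).card + 1) := by
  classical
  have := Fintype.ofFinite (G.induce (↑S : Set V)ᶜ).ConnectedComponent
  obtain ⟨hw, X, Y, hxX, hyY, hyX, hxY, hXY, hX, hY, hC⟩ := bridge G S x y hb c0 hc0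
  have hS2 := hS.trans (Nat.mul_le_mul_left k hw)
  have hxS : x ∉ S := by simpa using hb.1
  have hyS : y ∉ S := by simpa using hb.2.1
  have hXS : ∀ v ∈ X, v ∉ S := fun v hv => cset_not_mem ((hC v).2 (Or.inl hv))
  have hYS : ∀ v ∈ Y, v ∉ S := fun v hv => cset_not_mem ((hC v).2 (Or.inr hv))
  -- no adjacency between c0 and others
  have nadj : ∀ {c : (G.induce (↑S : Set V)ᶜ).ConnectedComponent} {a b : V}, c ≠ c0 →
      a ∈ cset G S c0 → b ∈ cset G S c → a ≠ b ∧ ¬ G.Adj a b := by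
    intro c a b hcd ha hb
    refine ⟨?_, ?_⟩
    · rintro rfl; exact hcd (cset_inj hb ha)
    · intro h; exact hcd (cset_inj hb (cset_adj ha h (cset_not_mem hb)))
  let M : Finset V := S.filter (fun s => G.Adj s x ∧ G.Adj s y ∧
    ∃ c, c ≠ c0 ∧ s ∈ nb G S (cset G S c))
  have mM : ∀ s, s ∈ M ↔ s ∈ S ∧ G.Adj s x ∧ G.Adj s y ∧
    ∃ c, c ≠ c0 ∧ s ∈ nb G S (cset G S c) := by intro s; simp [M]
  have hMX : M ⊆ nb G S X := by
    intro s hs; rw [mM] at hs; exact (mem_nb _ _ _ _).2 ⟨hs.1, x, hxX, hs.2.1⟩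
  have hMY : M ⊆ nb G S Y := by
    intro s hs; rw [mM] at hs; exact (mem_nb _ _ _ _).2 ⟨hs.1, y, hyY, hs.2.2.1⟩
  have claw : ∀ s u v c, u ∈ X → v ∈ Y → c ≠ c0 → s ∈ nb G S (cset G S c) → G.Adj s u →
      G.Adj s v → u = x ∧ v = y := by
    intro s u v c hu hv hc hs hsu hsv
    obtain ⟨_, d, hd, hsd⟩ := (mem_nb _ _ _ _).1 hs
    by_contra hcon
    have h1 := nadj hc ((hC u).2 (Or.inl hu)) hd
    have h2 := nadj hc ((hC v).2 (Or.inr hv)) hd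
    refine hcf ⟨s, u, v, d, ?_, h1.1, h2.1, hsu, hsv, hsd, ?_, h1.2, h2.2⟩
    · rintro rfl; exact hXY u hu hv
    · intro huv
      rcases hX u hu v huv with h | h | h
      · exact hXY v h hv
      · exact hYS v hv h
      · exact hcon h
  have hMX2 : ∀ s ∈ M, s ∉ nb G S (X.erase x) := by
    intro s hs hs2
    rw [mM] at hs
    obtain ⟨_, u, hu, hsu⟩ := (mem_nb _ _ _ _).1 hs2
    obtain ⟨_, _, hsy, c, hc, hsc⟩ := hs
    rw [Finset.mem_erase] at hu
    exact hu.1 (claw s u y c hu.2 hyY hc hsc hsu hsy).1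
  have hMY2 : ∀ s ∈ M, s ∉ nb G S (Y.erase y) := by
    intro s hs hs2
    rw [mM] at hs
    obtain ⟨_, u, hu, hsu⟩ := (mem_nb _ _ _ _).1 hs2
    obtain ⟨_, hsx, _, c, hc, hsc⟩ := hs
    rw [Finset.mem_erase] at hu
    exact hu.1 (claw s x u c hxX hu.2 hc hsc hsx hsu).2
  have sX := side hNC hdeg x y hxA hyS X M hxX hyX hXS hX hMX hMX2
  have sY := side hNC hdeg y x hyA hxS Y M hyY hxY hYS hY hMY hMY2
  have hunion : nb G S X ∪ nb G S Y = nb G S (cset G S c0) := by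
    ext s
    simp only [Finset.mem_union, mem_nb, hC]
    constructor
    · rintro (⟨h, v, hv, h'⟩ | ⟨h, v, hv, h'⟩)
      · exact ⟨h, v, Or.inl hv, h'⟩
      · exact ⟨h, v, Or.inr hv, h'⟩
    · rintro ⟨h, v, hv | hv, h'⟩
      · exact Or.inl ⟨h, v, hv, h'⟩
      · exact Or.inr ⟨h, v, hv, h'⟩
  have hui := Finset.card_union_add_card_inter (nb G S X) (nb G S Y)
  rw [hunion] at hui
  have hMI : M ⊆ nb G S X ∩ nb G S Y := Finset.subset_inter hMX hMY
  have hsd := Finset.card_sdiff_add_card_eq_card hMI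
  have hE := sum_cdeg hcf S ((nb G S X ∩ nb G S Y) \ M) (by
    intro s hs
    simp only [Finset.mem_sdiff, Finset.mem_inter, mem_nb] at hs
    exact hs.1.1.1) (by
    intro s hs
    by_contra hcon
    obtain ⟨c, hc, hsc⟩ := cdeg_two hcon c0
    simp only [Finset.mem_sdiff, Finset.mem_inter] at hs
    obtain ⟨⟨h1, h2⟩, h3⟩ := hs
    obtain ⟨hsS, u, hu, hsu⟩ := (mem_nb _ _ _ _).1 h1
    obtain ⟨_, v, hv, hsv⟩ := (mem_nb _ _ _ _).1 h2
    obtain ⟨rfl, rfl⟩ := claw s u v c hu hv hc hsc hsu hsv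
    exact h3 ((mM s).2 ⟨hsS, hsu, hsv, c, hc, hsc⟩))
  rw [← double_count, ← Finset.add_sum_erase _ _ (Finset.mem_univ c0)] at hE
  have hlow : (Finset.univ.erase c0).card * k ≤
      ∑ c ∈ Finset.univ.erase c0, (nb G S (cset G S c)).card :=
    Finset.card_nsmul_le_sum _ _ _ (fun c hc =>
      hcut _ (cset_cut G S c c0 (Finset.mem_erase.1 hc).1.symm))
  rw [Finset.card_erase_of_mem (Finset.mem_univ _), Finset.card_univ, ← numC_eq] at hlow
  have hpos : 1 ≤ numComponents G ↑S := by
    rw [numC_eq]; exact Fintype.card_pos_iff.2 ⟨c0⟩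
  obtain ⟨w, hw'⟩ : ∃ w, numComponents G ↑S = w + 1 := ⟨_, (Nat.sub_add_cancel hpos).symm⟩
  rw [hw'] at hlow hS2 ⊢
  have hle : (nb G S X).card ≤ S.card := Finset.card_le_card (fun s hs => ((mem_nb _ _ _ _).1 hs).1)
  have e1 : k * (w + 1 + 1) = w * k + 2 * k := by ring
  rw [e1] at hS2 ⊢
  simp only [Nat.add_sub_cancel] at hlow
  generalize hp : w * k = p at *
  rcases sX with ⟨rfl, sX⟩ | sX <;> rcases sY with ⟨rfl, sY⟩ | sY
  · refine ⟨?_, ?_, hS2, ?_⟩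
    · by_contra hcon
      have : w = 0 := by omega
      subst this
      omega
    · ext v
      rw [hC]
      simp
    · have := Finset.card_le_card (Finset.subset_union_left (s₁ := nb G S {x}) (s₂ := nb G S {y}))
      rw [hunion] at this
      omega
  all_goals exfalso; omega

lemma stage2 [Fintype V] [DecidableEq V] {G : SimpleGraph V} [DecidableRel G.Adj] {k : ℕ}
    {A T S : Finset V} (hcf : ClawFree G) (hk : 4 ≤ k)
    (htough : ∀ N : Finset V, 2 ≤ numComponents G ↑N → k * numComponents G ↑N ≤ 2 * N.card)
    (hcut : ∀ N : Finset V, 2 ≤ numComponents G ↑N → k ≤ N.card)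
    (hF : FragH G k A.card) (hT : T.card = k) (hAT : GSep G A T) (b : V) (hbA : b ∉ A)
    (hbT : b ∉ T)
    (hNC : NoCut G k A) (hdeg : ∀ v, 3 * k ≤ 2 * G.degree v) (x y : V) (hxA : x ∈ A)
    (hyA : y ∈ A)
    (c0 : (G.induce (↑S : Set V)ᶜ).ConnectedComponent) (hc0 : cset G S c0 = {x, y})
    (hw2 : 2 ≤ numComponents G ↑S)
    (hS : 2 * S.card + 1 ≤ k * (numComponents G ↑S + 1)) :
    (nb G S (cset G S c0)).card + 3 ≤ 2 * k := by
  classical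
  have := Fintype.ofFinite (G.induce (↑S : Set V)ᶜ).ConnectedComponent
  by_contra! hn0
  have hxC : x ∈ cset G S c0 := by simp [hc0]
  have hCA : ∀ v ∈ cset G S c0, v ∈ A := by
    intro v hv; rw [hc0] at hv; simp only [Finset.mem_insert, Finset.mem_singleton] at hv
    rcases hv with rfl | rfl <;> assumption
  have hNAT : ∀ s ∈ nb G S (cset G S c0), s ∈ A ∨ s ∈ T := by
    intro s hs
    obtain ⟨_, v, hv, hsv⟩ := (mem_nb _ _ _ _).1 hs
    exact hAT.2 v (hCA v hv) s hsv.symm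
  have hdc := double_count G S
  have hlowc : ∀ c, c ≠ c0 → k ≤ (nb G S (cset G S c)).card := fun c hc =>
    hcut _ (cset_cut G S c c0 hc.symm)
  have hlowA : ∀ c, c ≠ c0 → ∀ s ∈ A, s ∈ nb G S (cset G S c) →
      k + 1 ≤ (nb G S (cset G S c)).card := by
    intro c hc s hsA hs
    by_contra! hcon
    obtain ⟨z, hz⟩ := cset_nonempty G S c
    exact hNC (cset G S c) _ z x hz (cset_GSep G S c) (fun h => hc (cset_inj h hxC))
      (fun h => cset_not_mem hxC ((mem_nb _ _ _ _).1 h).1) (Nat.lt_succ_iff.1 hcon) s hsA hs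
  obtain ⟨w, hw⟩ : ∃ w, numComponents G ↑S = w + 2 := ⟨_, (Nat.sub_add_cancel hw2).symm⟩
  have hcard : Fintype.card (G.induce (↑S : Set V)ᶜ).ConnectedComponent = w + 2 := by
    rw [← numC_eq, hw]
  rw [hw] at hS
  have e1 : k * (w + 2 + 1) = w * k + 3 * k := by ring
  rw [e1] at hS
  by_cases hex : ∃ c1, c1 ≠ c0 ∧ ∃ s ∈ A, s ∈ nb G S (cset G S c1)
  swap
  · push Not at hex
    have hlow : (Finset.univ.erase c0).card * k ≤
        ∑ c ∈ Finset.univ.erase c0, (nb G S (cset G S c)).card :=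
      Finset.card_nsmul_le_sum _ _ _ (fun c hc => hlowc c (Finset.mem_erase.1 hc).1)
    rw [Finset.card_erase_of_mem (Finset.mem_univ _), Finset.card_univ, hcard] at hlow
    have e2 : (w + 2 - 1) * k = w * k + k := by
      rw [show w + 2 - 1 = w + 1 by omega]; ring
    rw [e2] at hlow
    let E : Finset V := (S ∩ A).filter (fun s => G.Adj x s)
    have hE := sum_cdeg hcf S E (by intro s hs; simp [E] at hs; exact hs.1.1) (by
      intro s hs
      by_contra hcon
      obtain ⟨c, hc, hsc⟩ := cdeg_two hcon c0
      simp only [E, Finset.mem_filter, Finset.mem_inter] at hs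
      exact hex c hc s hs.1.2 hsc)
    rw [← hdc, ← Finset.add_sum_erase _ _ (Finset.mem_univ c0)] at hE
    have hnx : G.neighborFinset x ⊆ insert y (E ∪ T) := by
      intro v hv
      rw [SimpleGraph.mem_neighborFinset] at hv
      rw [Finset.mem_insert, Finset.mem_union]
      by_cases hvS : v ∈ S
      · rcases hAT.2 x hxA v hv with h | h
        · right; left; simp [E, hvS, h, hv]
        · right; right; exact h
      · left
        have := cset_adj hxC hv hvS
        rw [hc0] at this
        simp only [Finset.mem_insert, Finset.mem_singleton] at this
        rcases this with rfl | h
        · exact absurd hv G.irrefl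
        · exact h
    have h2 := (Finset.card_le_card hnx).trans (Finset.card_insert_le _ _)
    rw [SimpleGraph.card_neighborFinset_eq_degree] at h2
    have h3 := Finset.card_union_le E T
    have h4 := hdeg x
    have hk4 : k = 4 := by omega
    subst hk4
    omega
  obtain ⟨c1, hc1, s1, hs1A, hs1⟩ := hex
  have hn1 := hlowA c1 hc1 s1 hs1A hs1
  have hmem1 : c1 ∈ Finset.univ.erase c0 := by simp [hc1]
  have hcr : ((Finset.univ.erase c0).erase c1).card = w := by
    rw [Finset.card_erase_of_mem hmem1, Finset.card_erase_of_mem (Finset.mem_univ _),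
      Finset.card_univ, hcard]; omega
  have hrest : w * k ≤ ∑ c ∈ (Finset.univ.erase c0).erase c1, (nb G S (cset G S c)).card := by
    have := Finset.card_nsmul_le_sum ((Finset.univ.erase c0).erase c1)
      (fun c => (nb G S (cset G S c)).card) k (fun c hc => hlowc c (by simp at hc; exact hc.2))
    rw [hcr] at this
    exact this
  have hsum : ∑ s ∈ S, cdeg G S s = (nb G S (cset G S c0)).card + ((nb G S (cset G S c1)).card +
      ∑ c ∈ (Finset.univ.erase c0).erase c1, (nb G S (cset G S c)).card) := by
    have a1 := Finset.add_sum_erase _ (fun c => (nb G S (cset G S c)).card) hmem1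
    have a2 := Finset.add_sum_erase _ (fun c => (nb G S (cset G S c)).card) (Finset.mem_univ c0)
    rw [a1, a2, hdc]
  have hE0 := sum_cdeg hcf S ∅ (by simp) (by simp)
  rw [hsum, Finset.card_empty] at hE0
  have t0 : (nb G S (cset G S c0)).card + 2 = 2 * k := by omega
  have t1 : (nb G S (cset G S c1)).card = k + 1 := by omega
  have tS : 2 * S.card + 1 = w * k + 3 * k := by omega
  have tr : ∑ c ∈ (Finset.univ.erase c0).erase c1, (nb G S (cset G S c)).card = w * k := by omega
  have hd2 : ∀ s ∈ S, ¬ cdeg G S s ≤ 1 := by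
    intro s hs h
    have := sum_cdeg hcf S {s} (by simpa using hs) (by simpa using h)
    rw [hsum, Finset.card_singleton] at this
    omega
  have hoth : ∀ c, c ≠ c0 → c ≠ c1 → ∀ s ∈ A, s ∉ nb G S (cset G S c) := by
    intro c h0 h1 s hsA hs
    have h2 := hlowA c h0 s hsA hs
    have hlt : ∑ c ∈ (Finset.univ.erase c0).erase c1, k <
        ∑ c ∈ (Finset.univ.erase c0).erase c1, (nb G S (cset G S c)).card :=
      Finset.sum_lt_sum (fun c hc => hlowc c (by simp at hc; exact hc.2))
        ⟨c, by simp [h0, h1], h2⟩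
    rw [Finset.sum_const, hcr, tr, smul_eq_mul] at hlt
    omega
  -- third component
  have hthird0 : ∀ s, s ∈ nb G S (cset G S c0) → s ∉ nb G S (cset G S c1) →
      ∃ c, c ≠ c0 ∧ c ≠ c1 ∧ s ∈ nb G S (cset G S c) := by
    intro s h0 h1
    obtain ⟨c, hc, hs⟩ := cdeg_two (hd2 s ((mem_nb _ _ _ _).1 h0).1) c0
    exact ⟨c, hc, fun h => h1 (h ▸ hs), hs⟩
  have hthird1 : ∀ s, s ∈ nb G S (cset G S c1) → s ∉ nb G S (cset G S c0) → s ∉ A := by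
    intro s h0 h1 hsA
    obtain ⟨c, hc, hs⟩ := cdeg_two (hd2 s ((mem_nb _ _ _ _).1 h0).1) c1
    exact hoth c (fun h => h1 (h ▸ hs)) hc s hsA hs
  obtain ⟨N0, hN0⟩ : ∃ N0, N0 = nb G S (cset G S c0) := ⟨_, rfl⟩
  obtain ⟨N1, hN1⟩ : ∃ N1, N1 = nb G S (cset G S c1) := ⟨_, rfl⟩
  obtain ⟨D, hD⟩ : ∃ D, D = cset G S c1 := ⟨_, rfl⟩
  have hDN : GSep G D N1 := by rw [hD, hN1]; exact cset_GSep G S c1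
  have hDS : ∀ v ∈ D, v ∉ S := by intro v hv; rw [hD] at hv; exact cset_not_mem hv
  have hN0S : ∀ v ∈ N0, v ∈ S := by intro v hv; rw [hN0] at hv; exact ((mem_nb _ _ _ _).1 hv).1
  have hN1S : ∀ v ∈ N1, v ∈ S := by intro v hv; rw [hN1] at hv; exact ((mem_nb _ _ _ _).1 hv).1
  have hxD : x ∉ D := by rw [hD]; exact fun h => hc1 (cset_inj h hxC)
  obtain ⟨z, hz⟩ : ∃ z, z ∈ D := by rw [hD]; exact cset_nonempty G S c1
  rw [← hN0] at t0 hthird0 hthird1 hNAT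
  rw [← hN1] at t1 hthird0 hthird1
  have hL : ∀ s ∈ N0 \ N1, s ∈ T := by
    intro s hs
    rw [Finset.mem_sdiff] at hs
    obtain ⟨c, h0, h1, hsc⟩ := hthird0 s hs.1 hs.2
    rcases hNAT s hs.1 with h | h
    · exact absurd hsc (hoth c h0 h1 s h)
    · exact h
  have k0 := Finset.card_sdiff_add_card_inter N0 N1
  have k1 := Finset.card_sdiff_add_card_inter N1 N0
  rw [Finset.inter_comm N1 N0] at k1
  have hw1 : 1 ≤ w := by
    obtain ⟨s, hs⟩ : (N0 \ N1).Nonempty := by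
      rw [← Finset.card_pos]; omega
    rw [Finset.mem_sdiff] at hs
    obtain ⟨c, h0, h1, hsc⟩ := hthird0 s hs.1 hs.2
    rw [← hcr]
    exact Finset.card_pos.2 ⟨c, by simp [h0, h1]⟩
  have hmerge := merge G G S (S \ (N0 ∩ N1)) Finset.sdiff_subset c0 c1 hc1.symm (by
    intro u v c d huv hu hv
    left; exact cset_inj (cset_adj hu huv (cset_not_mem hv)) hv) (by
    intro u v c hu hu' huv hv
    have hu2 : u ∈ N0 ∩ N1 := by
      rw [Finset.mem_sdiff] at hu'; by_contra h; exact hu' ⟨hu, h⟩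
    rw [Finset.mem_inter, hN0, hN1] at hu2
    by_contra! hcon
    exact claw3 hcf hc1.symm hcon.1.symm hcon.2.symm hu2.1 hu2.2
      ((mem_nb _ _ _ _).2 ⟨hu, v, hv, huv⟩))
  rw [hw] at hmerge
  have htt := htough _ (show 2 ≤ numComponents G ↑(S \ (N0 ∩ N1)) by omega)
  have htt2 : k * (w + 1) ≤ k * numComponents G ↑(S \ (N0 ∩ N1)) :=
    Nat.mul_le_mul_left k (by omega)
  have hKS : N0 ∩ N1 ⊆ S := fun s hs => hN0S s (Finset.mem_inter.1 hs).1
  have kS := Finset.card_sdiff_add_card_eq_card hKS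
  have e3 : k * (w + 1) = w * k + k := by ring
  rw [e3] at htt2
  have ha : (N0 ∩ N1).card + 1 ≤ k := by omega
  -- count inside T
  have hTc : (N0 \ N1).card + (T ∩ N1).card + (T ∩ D).card ≤ k := by
    rw [← hT, ← Finset.card_union_of_disjoint, ← Finset.card_union_of_disjoint]
    · apply Finset.card_le_card
      intro s hs
      simp only [Finset.mem_union, Finset.mem_inter] at hs
      rcases hs with (h | h) | h
      · exact hL s h
      · exact h.1
      · exact h.1
    · rw [Finset.disjoint_left]
      intro s hs hs2
      simp only [Finset.mem_union, Finset.mem_inter, Finset.mem_sdiff] at hs hs2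
      rcases hs with h | h
      · exact hDS s hs2.2 (hN0S s h.1)
      · exact hDS s hs2.2 (hN1S s h.2)
    · rw [Finset.disjoint_left]
      intro s hs hs2
      simp only [Finset.mem_inter, Finset.mem_sdiff] at hs hs2
      exact hs.2 hs2.2
  have hAN : (A ∩ N1).card ≤ (N0 ∩ N1).card := by
    apply Finset.card_le_card
    intro s hs
    rw [Finset.mem_inter] at hs ⊢
    refine ⟨?_, hs.2⟩
    by_contra h
    exact hthird1 s hs.2 h hs.1
  have hAD : (A ∩ D).card < A.card := by
    apply Finset.card_lt_card
    rw [Finset.ssubset_iff_of_subset Finset.inter_subset_left]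
    exact ⟨x, hxA, by simp [hxD]⟩
  have q1 := quad hF A T D N1 b hAT hDN hbA hbT
  obtain ⟨B, hB⟩ : ∃ B, B = Finset.univ \ (A ∪ T) := ⟨_, rfl⟩
  have mB : ∀ v, v ∈ B ↔ v ∉ A ∧ v ∉ T := by intro v; simp [hB]
  have sB : GSep G B T := by
    constructor
    · intro v hv; exact ((mB v).1 hv).2
    · intro u hu v huv
      have h3 := (mB u).1 hu
      by_cases hvT : v ∈ T
      · exact Or.inr hvT
      · left
        refine (mB v).2 ⟨fun h => ?_, hvT⟩
        rcases hAT.2 v h u huv.symm with h' | h'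
        · exact h3.1 h'
        · exact h3.2 h'
  have hxB : x ∉ B := fun h => ((mB x).1 h).1 hxA
  have q2 := quad hF B T D N1 x sB hDN hxB (hAT.1 x hxA)
  have hBN : (B ∩ N1).card ≤ (N1 \ N0).card := by
    apply Finset.card_le_card
    intro s hs
    rw [Finset.mem_inter] at hs
    rw [Finset.mem_sdiff]
    refine ⟨hs.2, fun h => ?_⟩
    have h3 := (mB s).1 hs.1
    rcases hNAT s h with h' | h'
    · exact h3.1 h'
    · exact h3.2 h'
  have hsp := split3 D A T B hAT.1 (fun v h h' => ((mB v).1 h').1 h)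
    (fun v h h' => ((mB v).1 h').2 h) (by
      intro v
      by_cases h1 : v ∈ A
      · exact Or.inl h1
      by_cases h2 : v ∈ T
      · exact Or.inr (Or.inl h2)
      exact Or.inr (Or.inr ((mB v).2 ⟨h1, h2⟩)))
  have hnz : G.neighborFinset z ⊆ D.erase z ∪ N1 := by
    intro v hv
    rw [SimpleGraph.mem_neighborFinset] at hv
    rw [Finset.mem_union, Finset.mem_erase]
    rcases hDN.2 z hz v hv with h | h
    · left; exact ⟨hv.ne', h⟩
    · right; exact h
  have h2 := (Finset.card_le_card hnz).trans (Finset.card_union_le _ _)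
  rw [SimpleGraph.card_neighborFinset_eq_degree, Finset.card_erase_of_mem hz] at h2
  have h3 := hdeg z
  clear htt htt2 hmerge hE0 hsum hrest tr
  omega

/-- Let `t ≥ 2`, `G` a minimally `t`-tough, claw-free graph with
`δ(G) ≥ ⌈3t⌉`, and `A` an atom of `G`.  For every edge `e = xy` with both
endpoints in `A` and `S = S(e)` a minimum good cut for `e`: `D(e) ≠ ∅`, the
vertex set of `C(e)` is exactly `{x, y}`, and
`⌈3t⌉ − 1 ≤ |N_{S(e)}(C(e))| ≤ 4t − 3`. -/
theorem atom_edge_structure [Fintype V] (G : SimpleGraph V) [DecidableRel G.Adj]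
    (t : ℚ) (ht : 2 ≤ t) (hmt : MinimallyTough G t) (hcf : ClawFree G)
    (hδ : ∀ v : V, ⌈3 * t⌉ ≤ (G.degree v : ℤ))
    (A : Set V) (hA : IsGraphAtom G A)
    (x y : V) (hx : x ∈ A) (hy : y ∈ A) (hxy : G.Adj x y)
    (S : Finset V) (hS : IsMinGoodCut G t x y S) :
    (Dset G ↑S x).Nonempty ∧
    compOf G ↑S x = {x, y} ∧
    (⌈3 * t⌉ - 1 ≤ ((nbrsIn G ↑S (compOf G ↑S x)).ncard : ℤ)) ∧
    (((nbrsIn G ↑S (compOf G ↑S x)).ncard : ℚ) ≤ 4 * t - 3) := by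
  classical
  obtain ⟨hmt1, _⟩ := hmt
  have hk2 := vconn_eq G t hcf hmt1
  obtain ⟨k, hk⟩ : ∃ k, k = vconn G := ⟨_, rfl⟩
  rw [← hk] at hk2
  have ht2 : t = k / 2 := by linarith
  have hF0 := fragH G A hA
  obtain ⟨⟨T, a, hT, hT2, haT, hAT⟩, _⟩ := hA
  obtain ⟨ca, hca⟩ := cset_exists G T a haT
  rw [compOf_eq_cset G T a ca hca] at hAT
  obtain ⟨A', hA'⟩ : ∃ A', A' = cset G T ca := ⟨_, rfl⟩
  rw [← hA'] at hAT
  subst hAT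
  rw [Set.ncard_coe_finset, ← hk] at hF0
  rw [← hk] at hT
  rw [Finset.mem_coe] at hx hy
  have hk4 : 4 ≤ k := by
    have : (4 : ℚ) ≤ k := by linarith
    exact_mod_cast this
  have hdeg : ∀ v, 3 * k ≤ 2 * G.degree v := by
    intro v
    have h1 := Int.ceil_le.1 (hδ v)
    rw [ht2] at h1
    have h2 : (3 * k : ℚ) ≤ 2 * G.degree v := by push_cast at h1; linarith
    exact_mod_cast h2
  have hsep : GSep G A' T := by
    rw [hA']
    constructor
    · intro v hv; exact cset_not_mem hv
    · intro u hu v huv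
      by_cases hv : v ∈ T
      · exact Or.inr hv
      · exact Or.inl (cset_adj hu huv hv)
  obtain ⟨cb, hcb⟩ := other_comp G T hT2 ca
  obtain ⟨b, hb⟩ := cset_nonempty G T cb
  have hbA : b ∉ A' := by rw [hA']; exact fun h => hcb (cset_inj hb h)
  have hbT : b ∉ T := cset_not_mem hb
  have hAk : k + 1 ≤ 2 * A'.card := by
    have h1 : G.neighborFinset x ⊆ A'.erase x ∪ T := by
      intro v hv
      rw [SimpleGraph.mem_neighborFinset] at hv
      rw [Finset.mem_union, Finset.mem_erase]
      rcases hsep.2 x hx v hv with h | h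
      · left; exact ⟨hv.ne', h⟩
      · right; exact h
    have h2 := (Finset.card_le_card h1).trans (Finset.card_union_le _ _)
    rw [SimpleGraph.card_neighborFinset_eq_degree, Finset.card_erase_of_mem hx] at h2
    have h3 := hdeg x
    have h4 := Finset.card_pos.2 ⟨x, hx⟩
    omega
  have hNC : NoCut G k A' := by
    intro X N z y hz hXN hy hyN hN v hv
    exact atom_no_cut A' T hF0 hT hsep b hbA hbT hAk X N z y hz hXN hy hyN hN v hv
  have hcut : ∀ N : Finset V, 2 ≤ numComponents G ↑N → k ≤ N.card := by
    intro N hN; rw [hk]; exact vconn_le G N hN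
  have htough : ∀ N : Finset V, 2 ≤ numComponents G ↑N →
      k * numComponents G ↑N ≤ 2 * N.card := by
    intro N hN
    have h1 := hmt1.1 N hN
    have hpos : (0 : ℚ) < (numComponents G ↑N : ℕ) := by
      have : 0 < numComponents G ↑N := by omega
      exact_mod_cast this
    rw [le_div_iff₀ hpos, ht2] at h1
    have h2 : (k * (numComponents G ↑N : ℕ) : ℚ) ≤ 2 * N.card := by linarith
    exact_mod_cast h2
  obtain ⟨⟨_, hS2, hbr⟩, _⟩ := hS
  have hxS : x ∉ S := by simpa using hbr.1
  have hS3 : 2 * S.card + 1 ≤ k * (numComponents (G.deleteEdges {s(x, y)}) ↑S) := by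
    rw [div_lt_iff₀ (by linarith), ht2] at hS2
    have h2 : (2 * S.card : ℚ) <
        k * (numComponents (G.deleteEdges {s(x, y)}) ↑S : ℕ) := by linarith
    have h3 : 2 * S.card < k * (numComponents (G.deleteEdges {s(x, y)}) ↑S) := by
      exact_mod_cast h2
    omega
  obtain ⟨c0, hc0⟩ := cset_exists G S x hxS
  obtain ⟨r1, r2, r3, r4⟩ := stage1 hcf hk4 hcut hNC hdeg x y hx hy hbr c0 hc0 hS3
  have r5 := stage2 hcf hk4 htough hcut hF0 hT hsep b hbA hbT hNC hdeg x y hx hy c0 r2 r1 r3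
  have hcomp := compOf_eq_cset G S x c0 hc0
  have hnb : nbrsIn G ↑S (compOf G ↑S x) = ↑(nb G S (cset G S c0)) := by
    rw [hcomp]
    ext s
    simp only [nbrsIn, Set.mem_setOf_eq, Finset.mem_coe, mem_nb, Set.mem_diff]
    constructor
    · rintro ⟨⟨h1, _⟩, h2⟩; exact ⟨h1, h2⟩
    · rintro ⟨h1, h2⟩; exact ⟨⟨h1, fun h => cset_not_mem h h1⟩, h2⟩
  rw [hnb, Set.ncard_coe_finset]
  refine ⟨?_, ?_, ?_, ?_⟩
  · obtain ⟨d, hd⟩ := other_comp G S r1 c0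
    obtain ⟨v, hv⟩ := cset_nonempty G S d
    refine ⟨v, ?_, ?_⟩
    · simpa using cset_not_mem hv
    · rw [hcomp]; exact fun h => hd (cset_inj hv h)
  · rw [hcomp, r2]; simp
  · rw [sub_le_iff_le_add, Int.ceil_le, ht2]
    have : (3 * k : ℚ) ≤ 2 * ((nb G S (cset G S c0)).card + 1) := by exact_mod_cast r4
    push_cast
    linarith
  · have : ((nb G S (cset G S c0)).card + 3 : ℚ) ≤ 2 * k := by exact_mod_cast r5
    rw [ht2]
    linarith
end
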